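/- arXiv:1310.4892 — 2 statements merged into one kernel-verified Lean document; each statement's English description precedes it below -/
import Mathlib

section
/- For every p with 1 ≤ p < ∞ there is an assignment U ↦ E_U taking each subset U ⊆ ω to a Borel equivalence relation E_U on [0,1]^ω such that: (i) for every q with p < q < ∞, ℝ^ω/ℓ_p ≤_B E_U and E_U ≤_B ℝ^ω/ℓ_q; and (ii) for all U, V ⊆ ω, U ⊆* V if and only if E_U ≤_B E_V. -/
open Set

/-- `f` is essentially increasing on `D`: for some `C ≥ 1`,
`x ≤ y` implies `f x ≤ C * f y` for `x, y ∈ D`. -/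
def EssIncOn (f : ℝ → ℝ) (D : Set ℝ) : Prop :=
  ∃ C : ℝ, 1 ≤ C ∧ ∀ x ∈ D, ∀ y ∈ D, x ≤ y → f x ≤ C * f y

/-- `(f x)_{x ∈ D} ≈ (g x)_{x ∈ D}`: for some `C ≥ 1`,
`g x / C ≤ f x ≤ C * g x` for all `x ∈ D`. -/
def EquivOn (f g : ℝ → ℝ) (D : Set ℝ) : Prop :=
  ∃ C : ℝ, 1 ≤ C ∧ ∀ x ∈ D, g x / C ≤ f x ∧ f x ≤ C * g x

/-- `(u n) ≈ (v n)`: for some `C ≥ 1`, `v n / C ≤ u n ≤ C * v n` for all `n`. -/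
def SeqEquiv (u v : ℕ → ℝ) : Prop :=
  ∃ C : ℝ, 1 ≤ C ∧ ∀ n, v n / C ≤ u n ∧ u n ≤ C * v n

/-- The relation `E_f` on `[0,1]^ω`: `(x_n) E_f (y_n)` iff `Σ f(|x_n − y_n|) < ∞`
(for `f ≥ 0` this is equivalent to summability). -/
def EF (f : ℝ → ℝ) (x y : ℕ → Icc (0:ℝ) 1) : Prop :=
  Summable fun n => f |(x n : ℝ) - (y n : ℝ)|

/-- Borel reducibility of binary relations. -/
def BorelReducible {X Y : Type*} [MeasurableSpace X] [MeasurableSpace Y]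
    (E : X → X → Prop) (F : Y → Y → Prop) : Prop :=
  ∃ θ : X → Y, Measurable θ ∧ ∀ x y, E x y ↔ F (θ x) (θ y)

/-- The relation `ℝ^ω/ℓ_p`: `x E y` iff `Σ |x_n − y_n|^p < ∞`. -/
def lpRel (p : ℝ) (x y : ℕ → ℝ) : Prop :=
  Summable fun n => |x n - y n| ^ p

section Main

open Set Filter Topology MeasureTheory
open scoped ENNReal Pointwise

lemma lusin_compact {S : Type*} [TopologicalSpace S] [MeasurableSpace S] [BorelSpace S] [CompactSpace S]
    [T2Space S] (μ : Measure S) [IsFiniteMeasure μ] [μ.InnerRegularCompactLTTop] (hμ : μ univ ≠ 0)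
    {Y : Type*} [TopologicalSpace Y] [SecondCountableTopology Y] [MeasurableSpace Y] [OpensMeasurableSpace Y]
    (f : S → Y) (hf : Measurable f) :
    ∃ K : Set S, IsCompact K ∧ μ K ≠ 0 ∧ ContinuousOn f K := by
  obtain ⟨ε, hε, hsum⟩ := ENNReal.exists_pos_sum_of_countable' (ε := μ univ / 2)
    (by simpa using hμ) (TopologicalSpace.countableBasis Y)
  have hB := TopologicalSpace.isBasis_countableBasis Y
  have key : ∀ B : TopologicalSpace.countableBasis Y, ∃ K C : Set S, K ⊆ f ⁻¹' B ∧ C ⊆ (f ⁻¹' B)ᶜ ∧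
      IsCompact K ∧ IsCompact C ∧ μ ((K ∪ C)ᶜ) ≤ ε B := by
    intro B
    have hm : MeasurableSet (f ⁻¹' (B : Set Y)) := hf (hB.isOpen B.2).measurableSet
    have h2 : ε B / 2 ≠ 0 := by simpa using (hε B).ne'
    obtain ⟨K, hK, hKc, hKe⟩ := hm.exists_isCompact_sdiff_lt (μ := μ) (measure_ne_top _ _) h2
    obtain ⟨C, hC, hCc, hCe⟩ := hm.compl.exists_isCompact_sdiff_lt (μ := μ) (measure_ne_top _ _) h2
    refine ⟨K, C, hK, hC, hKc, hCc, ?_⟩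
    calc μ ((K ∪ C)ᶜ) ≤ μ ((f ⁻¹' (B : Set Y) \ K) ∪ ((f ⁻¹' (B : Set Y))ᶜ \ C)) := by
          apply measure_mono
          intro x hx
          simp only [mem_compl_iff, mem_union, not_or, Set.mem_sdiff] at hx ⊢
          by_cases h : x ∈ f ⁻¹' (B : Set Y)
          · exact Or.inl ⟨h, hx.1⟩
          · exact Or.inr ⟨h, hx.2⟩
      _ ≤ ε B / 2 + ε B / 2 := (measure_union_le _ _).trans (add_le_add hKe.le hCe.le)
      _ = ε B := ENNReal.add_halves _
  choose K C hK hC hKc hCc hKC using key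
  have hcl : ∀ B, IsClosed (K B ∪ C B) := fun B => ((hKc B).union (hCc B)).isClosed
  refine ⟨⋂ B, (K B ∪ C B), (isClosed_iInter hcl).isCompact, ?_, ?_⟩
  · intro h0
    have h1 : μ ((⋂ B, (K B ∪ C B))ᶜ) ≤ μ univ / 2 := by
      rw [compl_iInter]
      exact (measure_iUnion_le _).trans ((ENNReal.tsum_le_tsum hKC).trans hsum.le)
    have h2 : μ univ ≤ μ (⋂ B, (K B ∪ C B)) + μ ((⋂ B, (K B ∪ C B))ᶜ) := by
      rw [← union_compl_self (⋂ B, (K B ∪ C B))]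
      exact measure_union_le _ _
    rw [h0, zero_add] at h2
    exact absurd (h2.trans h1) (not_le.2 (ENNReal.half_lt_self hμ (measure_ne_top _ _)))
  · intro x hx
    rw [ContinuousWithinAt, hB.nhds_hasBasis.tendsto_right_iff]
    rintro B ⟨hB1, hxB⟩
    let B' : TopologicalSpace.countableBasis Y := ⟨B, hB1⟩
    have : (C B')ᶜ ∈ 𝓝 x := (hCc B').isClosed.isOpen_compl.mem_nhds (fun h => hC B' h hxB)
    filter_upwards [mem_nhdsWithin_of_mem_nhds this, self_mem_nhdsWithin] with y hy1 hy2
    have := mem_iInter.1 hy2 B'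
    rcases this with h | h
    · exact hK B' h
    · exact absurd h hy1

lemma shift_pos {S : Type*} [TopologicalSpace S] [AddCommGroup S] [IsTopologicalAddGroup S]
    [MeasurableSpace S] [BorelSpace S] [CompactSpace S] [T2Space S]
    (μ : Measure S) [IsFiniteMeasure μ] [μ.IsAddHaarMeasure] [μ.InnerRegularCompactLTTop]
    {G : Type*} [Finite G] (σ : ℕ → G → S) (hσ : ∀ g, Tendsto (fun b => σ b g) atTop (𝓝 0))
    (A : Set S) (hA : IsCompact A) (hpos : μ A ≠ 0) :
    ∀ᶠ b in atTop, IsCompact (A ∩ ⋂ g, (fun x => x + σ b g) ⁻¹' A) ∧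
      μ (A ∩ ⋂ g, (fun x => x + σ b g) ⁻¹' A) ≠ 0 := by
  have := Fintype.ofFinite G
  have hlim : Tendsto (fun b => ∑ g, μ ((σ b g +ᵥ A) \ A)) atTop (𝓝 0) := by
    rw [show (0 : ℝ≥0∞) = ∑ g : G, 0 by simp]
    refine tendsto_finsetSum _ fun g _ => ?_
    exact (tendsto_measure_vadd_sdiff_isCompact_isClosed (μ := μ) hA hA.isClosed).comp (hσ g)
  have hcont : ∀ s : S, Continuous fun x => x + s := fun s => by fun_prop
  filter_upwards [hlim.eventually (gt_mem_nhds (pos_iff_ne_zero.2 hpos))] with b hb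
  refine ⟨hA.inter_right (isClosed_iInter fun g => hA.isClosed.preimage (hcont _)), fun h0 => ?_⟩
  have : A ⊆ (A ∩ ⋂ g, (fun x => x + σ b g) ⁻¹' A) ∪ ⋃ g, (fun x => x + σ b g) ⁻¹' ((σ b g +ᵥ A) \ A) := by
    intro x hx
    by_cases h : ∀ g, x + σ b g ∈ A
    · exact Or.inl ⟨hx, mem_iInter.2 h⟩
    · push Not at h
      obtain ⟨g, hg⟩ := h
      refine Or.inr (mem_iUnion.2 ⟨g, ⟨x, hx, ?_⟩, hg⟩)
      simp [add_comm]
  have h2 : μ A ≤ 0 + ∑ g, μ ((σ b g +ᵥ A) \ A) := by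
    refine (measure_mono this).trans ((measure_union_le _ _).trans ?_)
    rw [h0]
    gcongr
    refine (measure_iUnion_fintype_le _ _).trans ?_
    exact Finset.sum_le_sum fun g _ => (measure_preimage_add_right μ _ _).le
  rw [zero_add] at h2
  exact absurd h2 (not_le.2 hb)


/-- finitely supported elements of the big product -/
def HH (G : ℕ → Type) [∀ i, AddCommGroup (G i)] (L : ℕ) : Set (∀ i, ℕ → G i) :=
  {h | ∀ i n, ¬ (i < L ∧ n < L) → h i n = 0}

lemma HH_finite (G : ℕ → Type) [∀ i, AddCommGroup (G i)] [∀ i, Finite (G i)] (L : ℕ) :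
    (HH G L).Finite := by
  classical
  let F : (∀ i : Fin L, Fin L → G i) → (∀ i, ℕ → G i) := fun u i n =>
    if h : i < L ∧ n < L then u ⟨i, h.1⟩ ⟨n, h.2⟩ else 0
  refine (Set.finite_range F).subset ?_
  intro h hh
  refine ⟨fun i n => h i n, ?_⟩
  funext i n
  by_cases hc : i < L ∧ n < L
  · simp [F, hc]
  · simp [F, hc, hh i n hc]

section Fusion

set_option linter.unusedSectionVars false

variable {G : ℕ → Type} [∀ i, AddCommGroup (G i)] [∀ i, Finite (G i)]
  [∀ i, TopologicalSpace (G i)] [∀ i, DiscreteTopology (G i)]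
  [∀ i, MeasurableSpace (G i)] [∀ i, BorelSpace (G i)]

/-- tail of the cost -/
noncomputable def tailC (c : ℕ → ℝ → ℝ → ℝ≥0∞) (K : ℕ) (u v : ℕ → ℝ) : ℝ≥0∞ :=
  ∑' j, c (j + K) (u (j + K)) (v (j + K))

def TT0 (c : ℕ → ℝ → ℝ → ℝ≥0∞) (f : (∀ i, ℕ → G i) → ℕ → ℝ) (L K : ℕ) (δ : ℝ≥0∞) :
    Set (∀ i, ℕ → G i) :=
  {x | ∀ h ∈ HH G L, ∀ h' ∈ HH G L, tailC c K (f (x + h)) (f (x + h')) ≤ δ}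

lemma TT0_measurable (c : ℕ → ℝ → ℝ → ℝ≥0∞) (hc : ∀ j, Continuous fun z : ℝ × ℝ => c j z.1 z.2)
    (f : (∀ i, ℕ → G i) → ℕ → ℝ) (hf : Measurable f) (L K : ℕ) (δ : ℝ≥0∞) :
    MeasurableSet (TT0 c f L K δ) := by
  have : TT0 c f L K δ = ⋂ h ∈ HH G L, ⋂ h' ∈ HH G L,
      {x | tailC c K (f (x + h)) (f (x + h')) ≤ δ} := by
    ext x; simp [TT0]
  rw [this]
  refine MeasurableSet.biInter (HH_finite G L).countable fun h _ =>
    MeasurableSet.biInter (HH_finite G L).countable fun h' _ => ?_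
  refine measurableSet_le ?_ measurable_const
  unfold tailC
  refine Measurable.tsum fun j => ?_
  have h1 : ∀ h : (∀ i, ℕ → G i), Measurable fun x => f (x + h) (j + K) := by
    intro h
    have : Measurable fun x : (∀ i, ℕ → G i) => x + h := (continuous_add_const h).measurable
    exact (measurable_pi_apply _).comp (hf.comp this)
  exact (hc (j + K)).measurable.comp ((h1 h).prodMk (h1 h'))

lemma head_mod (c : ℕ → ℝ → ℝ → ℝ≥0∞) (hc : ∀ j, Continuous fun z : ℝ × ℝ => c j z.1 z.2)
    (hc0 : ∀ j a, c j a a = 0)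
    (f : (∀ i, ℕ → G i) → ℕ → ℝ) (Kc : Set (∀ i, ℕ → G i)) (hK : IsCompact Kc)
    (hf : ContinuousOn f Kc) (K : ℕ) (δ : ℝ≥0∞) (hδ : δ ≠ 0) :
    ∃ L : ℕ, ∀ x ∈ Kc, ∀ x' ∈ Kc, (∀ i n, i < L → n < L → x i n = x' i n) →
      ∑ j ∈ Finset.range K, c j (f x j) (f x' j) ≤ δ := by
  by_contra hcon
  push Not at hcon
  choose x hx x' hx' hag hgt using hcon
  obtain ⟨⟨y, y'⟩, hy, φ, hφ, hlim⟩ := (hK.prod hK).tendsto_subseq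
    (x := fun n => (x n, x' n)) (fun n => ⟨hx n, hx' n⟩)
  have hl1 : Tendsto (fun n => x (φ n)) atTop (𝓝 y) := (continuous_fst.tendsto _).comp hlim
  have hl2 : Tendsto (fun n => x' (φ n)) atTop (𝓝 y') := (continuous_snd.tendsto _).comp hlim
  have hyy : y = y' := by
    funext i n
    have e1 := ((tendsto_pi_nhds.1 (tendsto_pi_nhds.1 hl1 i)) n)
    have e2 := ((tendsto_pi_nhds.1 (tendsto_pi_nhds.1 hl2 i)) n)
    refine tendsto_nhds_unique e1 (e2.congr' ?_)
    filter_upwards [eventually_gt_atTop (max i n)] with m hm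
    have := hφ.id_le m
    have h3 : max i n < φ m := lt_of_lt_of_le hm this
    exact (hag (φ m) i n (lt_of_le_of_lt (le_max_left _ _) h3)
      (lt_of_le_of_lt (le_max_right _ _) h3)).symm
  subst hyy
  have hf1 : Tendsto (fun n => f (x (φ n))) atTop (𝓝 (f y)) :=
    (hf y hy.1).tendsto.comp (tendsto_nhdsWithin_iff.2 ⟨hl1, Eventually.of_forall fun n => hx _⟩)
  have hf2 : Tendsto (fun n => f (x' (φ n))) atTop (𝓝 (f y)) :=
    (hf y hy.1).tendsto.comp (tendsto_nhdsWithin_iff.2 ⟨hl2, Eventually.of_forall fun n => hx' _⟩)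
  have hs : Tendsto (fun n => ∑ j ∈ Finset.range K, c j (f (x (φ n)) j) (f (x' (φ n)) j)) atTop
      (𝓝 (∑ j ∈ Finset.range K, c j (f y j) (f y j))) := by
    refine tendsto_finsetSum _ fun j _ => ?_
    exact ((hc j).tendsto (f y j, f y j)).comp
      ((tendsto_pi_nhds.1 hf1 j).prodMk_nhds (tendsto_pi_nhds.1 hf2 j))
  simp only [hc0, Finset.sum_const_zero] at hs
  have := (hs.eventually (gt_mem_nhds (pos_iff_ne_zero.2 hδ))).exists
  obtain ⟨n, hn⟩ := this
  exact absurd (hgt (φ n)) (not_lt.2 hn.le)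

open Classical in
/-- single coordinate element -/
noncomputable def sg (i b : ℕ) (g : G i) : ∀ i, ℕ → G i := Pi.single i (Pi.single b g)

lemma sg_tendsto (i : ℕ) (g : G i) : Tendsto (fun b => sg i b g) atTop (𝓝 (0 : ∀ i, ℕ → G i)) := by
  rw [tendsto_pi_nhds]; intro i'
  rw [tendsto_pi_nhds]; intro n
  refine tendsto_const_nhds.congr' ?_
  filter_upwards [eventually_gt_atTop n] with b hb
  by_cases h : i' = i
  · subst h
    simp [sg, hb.ne]
  · simp [sg, h]

lemma fusion_step (μ : Measure (∀ i, ℕ → G i)) [IsFiniteMeasure μ] [μ.IsAddHaarMeasure]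
    [μ.InnerRegularCompactLTTop]
    (c : ℕ → ℝ → ℝ → ℝ≥0∞) (hc : ∀ j, Continuous fun z : ℝ × ℝ => c j z.1 z.2)
    (hc0 : ∀ j a, c j a a = 0)
    (f : (∀ i, ℕ → G i) → ℕ → ℝ) (hfm : Measurable f)
    (hfin : ∀ x L, ∀ h ∈ HH G L, ∀ h' ∈ HH G L, ∑' j, c j (f (x + h) j) (f (x + h') j) ≠ ⊤)
    (Kc : Set (∀ i, ℕ → G i)) (hK : IsCompact Kc)
    (hf : ContinuousOn f Kc) (i : ℕ) (δ : ℝ≥0∞) (hδ : δ ≠ 0)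
    (A : Set (∀ i, ℕ → G i)) (L K0 : ℕ) (hA : IsCompact A) (hA0 : μ A ≠ 0) :
    ∃ (A' A'' : Set (∀ i, ℕ → G i)) (b K1 : ℕ), A' ⊆ A ∧ IsCompact A' ∧ A'' ⊆ A' ∧ IsCompact A'' ∧
      μ A'' ≠ 0 ∧ (∀ x ∈ A'', ∀ g, x + sg i b g ∈ A') ∧ A' ⊆ TT0 c f L K1 δ ∧ K0 < K1 ∧ L ≤ b ∧
      i ≤ b ∧
      (∀ x ∈ Kc, ∀ x' ∈ Kc, (∀ i n, i < b → n < b → x i n = x' i n) →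
      ∑ j ∈ Finset.range K1, c j (f x j) (f x' j) ≤ δ) := by
  have hex : ∃ K1, K0 < K1 ∧ μ (A ∩ TT0 c f L K1 δ) ≠ 0 := by
    by_contra hcon
    push Not at hcon
    apply hA0
    have : A ⊆ ⋃ K1 : ℕ, A ∩ TT0 c f L (K0 + 1 + K1) δ := by
      intro x hx
      have : ∀ᶠ K in atTop, ∀ h ∈ HH G L, ∀ h' ∈ HH G L, tailC c K (f (x + h)) (f (x + h')) ≤ δ := by
        rw [(HH_finite G L).eventually_all]
        intro h hh
        rw [(HH_finite G L).eventually_all]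
        intro h' hh'
        exact (ENNReal.tendsto_sum_nat_add _ (hfin x L h hh h' hh')).eventually
          (ge_mem_nhds (pos_iff_ne_zero.2 hδ))
      obtain ⟨K, hK⟩ := eventually_atTop.1 this
      exact mem_iUnion.2 ⟨K, hx, hK _ (by omega)⟩
    refine measure_mono_null this (measure_iUnion_null fun K1 => hcon _ (by omega))
  obtain ⟨K1, hK1, hpos⟩ := hex
  obtain ⟨A', hA'1, hA'c, hA'0⟩ := (hA.measurableSet.inter
    (TT0_measurable c hc f hfm L K1 δ)).exists_lt_isCompact_of_ne_top (measure_ne_top μ _)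
    (pos_iff_ne_zero.2 hpos)
  obtain ⟨L', hL'⟩ := head_mod c hc hc0 f Kc hK hf K1 δ hδ
  obtain ⟨b, ⟨hb1, hb2⟩, hb3⟩ := ((shift_pos μ (fun b g => sg i b g) (sg_tendsto i) A' hA'c
    hA'0.ne').and (eventually_ge_atTop (max (max L i) L'))).exists
  refine ⟨A', _, b, K1, fun x hx => (hA'1 hx).1, hA'c, inter_subset_left, hb1, hb2, ?_,
    fun x hx => (hA'1 hx).2, hK1, ?_, ?_, ?_⟩
  · intro x hx g
    exact mem_iInter.1 hx.2 g
  · exact (le_max_left _ _).trans ((le_max_left _ _).trans hb3)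
  · exact (le_max_right _ _).trans ((le_max_left _ _).trans hb3)
  · intro x hx x' hx' h
    have := (le_max_right _ _).trans hb3
    exact hL' x hx x' hx' fun i n hi hn => h i n (by omega) (by omega)


/-- insert values along `b` -/
def ins (b : ℕ → ℕ) (g : ∀ i, G i) : ∀ i, ℕ → G i := fun i n => if n = b i then g i else 0

lemma ins_add_sg (b : ℕ → ℕ) (g : ∀ i, G i) (l : ℕ) :
    sg l (b l) (g l) + ins b (Function.update g l 0) = ins b g := by
  classical
  funext i n
  by_cases h : i = l
  · subst h
    by_cases hn : n = b i
    · simp [ins, sg, hn]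
    · simp [ins, sg, hn]
  · simp [ins, sg, h]

theorem fusion
    (c : ℕ → ℝ → ℝ → ℝ≥0∞) (hc : ∀ j, Continuous fun z : ℝ × ℝ => c j z.1 z.2)
    (hc0 : ∀ j a, c j a a = 0)
    (f : (∀ i, ℕ → G i) → ℕ → ℝ) (hfm : Measurable f)
    (hfin : ∀ x L, ∀ h ∈ HH G L, ∀ h' ∈ HH G L, ∑' j, c j (f (x + h) j) (f (x + h') j) ≠ ⊤) :
    ∃ (b : ℕ → ℕ) (z : ∀ i, ℕ → G i) (K : ℕ → ℕ), StrictMono K ∧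
      (∀ i (v v' : ∀ i, G i), (∀ l, i ≤ l → v l = v' l) →
        tailC c (K i) (f fun i n => if n = b i then v i else z i n)
          (f fun i n => if n = b i then v' i else z i n) ≤ 2⁻¹ ^ i) ∧
      (∀ i (v v' : ∀ i, G i), (∀ l, l < i → v l = v' l) →
        ∑ j ∈ Finset.range (K i), c j (f (fun i n => if n = b i then v i else z i n) j)
          (f (fun i n => if n = b i then v' i else z i n) j) ≤ 2⁻¹ ^ i) := by
  classical
  let μ : Measure (∀ i, ℕ → G i) := Measure.addHaarMeasure ⊤
  have hμ0 : μ univ ≠ 0 := (isOpen_univ.measure_pos μ univ_nonempty).ne'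
  obtain ⟨Kc, hKc, hKc0, hfK⟩ := lusin_compact μ hμ0 f hfm
  let St := {s : Set (∀ i, ℕ → G i) × ℕ × ℕ // IsCompact s.1 ∧ μ s.1 ≠ 0}
  have step : ∀ (i : ℕ) (s : St), ∃ (s' : St) (A' : Set (∀ i, ℕ → G i)) (b : ℕ),
      A' ⊆ s.1.1 ∧ IsCompact A' ∧ s'.1.1 ⊆ A' ∧ (∀ x ∈ s'.1.1, ∀ g, x + sg i b g ∈ A') ∧
      A' ⊆ TT0 c f s.1.2.1 s'.1.2.2 (2⁻¹ ^ i) ∧ s.1.2.2 < s'.1.2.2 ∧ s.1.2.1 ≤ b ∧ i ≤ b ∧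
      s'.1.2.1 = b + 1 ∧
      (∀ x ∈ Kc, ∀ x' ∈ Kc, (∀ i n, i < b → n < b → x i n = x' i n) →
      ∑ j ∈ Finset.range s'.1.2.2, c j (f x j) (f x' j) ≤ 2⁻¹ ^ i) := by
    rintro i ⟨⟨A, L, K0⟩, hA, hA0⟩
    obtain ⟨A', A'', b, K1, h1, h2, h3, h4, h5, h6, h7, h8, h9, h10, h11⟩ :=
      fusion_step μ c hc hc0 f hfm hfin Kc hKc hfK i (2⁻¹ ^ i) (by simp) A L K0 hA hA0
    exact ⟨⟨⟨A'', b + 1, K1⟩, h4, h5⟩, A', b, h1, h2, h3, h6, h7, h8, h9, h10, rfl, h11⟩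
  choose nxt A' b h1 h2 h3 h6 h7 h8 h9 h10 hL h11 using step
  let st : ℕ → St := fun n => Nat.rec ⟨⟨Kc, 0, 0⟩, hKc, hKc0⟩ (fun i s => nxt i s) n
  have hst : ∀ i, st (i + 1) = nxt i (st i) := fun i => rfl
  have hst0 : (st 0).1.1 = Kc := rfl
  clear_value st
  let B : ℕ → ℕ := fun i => b i (st i)
  let P : ℕ → Set (∀ i, ℕ → G i) := fun i => A' i (st i)
  have hP1 : ∀ i, P i ⊆ (st i).1.1 := fun i => h1 i (st i)
  have hPc : ∀ i, IsCompact (P i) := fun i => h2 i (st i)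
  have hP3 : ∀ i, (st (i + 1)).1.1 ⊆ P i := fun i => by rw [hst]; exact h3 i (st i)
  have hP6 : ∀ i, ∀ x ∈ (st (i + 1)).1.1, ∀ g, x + sg i (B i) g ∈ P i := fun i => by
    rw [hst]; exact h6 i (st i)
  have hP7 : ∀ i, P i ⊆ TT0 c f (st i).1.2.1 (st (i + 1)).1.2.2 (2⁻¹ ^ i) := fun i => by
    rw [hst]; exact h7 i (st i)
  have hP8 : ∀ i, (st i).1.2.2 < (st (i + 1)).1.2.2 := fun i => by
    rw [hst]; exact h8 i (st i)
  have hP9 : ∀ i, (st i).1.2.1 ≤ B i := fun i => h9 i (st i)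
  have hP10 : ∀ i, i ≤ B i := fun i => h10 i (st i)
  have hPL : ∀ i, (st (i + 1)).1.2.1 = B i + 1 := fun i => by
    rw [hst]; exact hL i (st i)
  have hP11 : ∀ i, ∀ x ∈ Kc, ∀ x' ∈ Kc, (∀ l n, l < B i → n < B i → x l n = x' l n) →
      ∑ j ∈ Finset.range (st (i + 1)).1.2.2, c j (f x j) (f x' j) ≤ 2⁻¹ ^ i := fun i => by
    rw [hst]; exact h11 i (st i)
  clear_value B P
  have hBmono : StrictMono B := strictMono_nat_of_lt_succ fun i => by
    have := hP9 (i + 1); rw [hPL] at this; omega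
  have hLB : ∀ i l, l < i → B l < (st i).1.2.1 := by
    intro i l hl
    obtain ⟨k, rfl⟩ : ∃ k, i = k + 1 := ⟨i - 1, by omega⟩
    rw [hPL]
    have := hBmono.monotone (show l ≤ k by omega)
    omega
  -- the limit point
  obtain ⟨z, hz⟩ : (⋂ i, (st i).1.1).Nonempty := by
    apply IsCompact.nonempty_iInter_of_sequence_nonempty_isCompact_isClosed
    · intro i; exact (hP3 i).trans (hP1 i)
    · intro i
      exact nonempty_of_measure_ne_zero (st i).2.2
    · exact (st 0).2.1
    · intro i; exact (st i).2.1.isClosed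
  rw [mem_iInter] at hz
  have hM : ∀ n i x, x ∈ (st (i + n)).1.1 → ∀ g : ∀ i, G i,
      (∀ l, ¬ (i ≤ l ∧ l < i + n) → g l = 0) → x + ins B g ∈ (st i).1.1 := by
    intro n
    induction n with
    | zero =>
      intro i x hx g hg
      have : ins B g = 0 := by
        funext l n
        simp [ins, hg l (by omega)]
      rw [this, add_zero]; exact hx
    | succ n ih =>
      intro i x hx g hg
      have h1 := hP1 _ (hP6 (i + n) x hx (g (i + n)))
      have := ih i _ h1 (Function.update g (i + n) 0) (by
        intro l hl
        by_cases hl2 : l = i + n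
        · subst hl2; simp
        · rw [Function.update_of_ne hl2]; exact hg l (by omega))
      rwa [add_assoc, ins_add_sg] at this
  have hM' : ∀ i n, ∀ g : ∀ i, G i,
      (∀ l, ¬ (i ≤ l ∧ l < i + 1 + n) → g l = 0) → z + ins B g ∈ P i := by
    intro i n g hg
    have h1 := hM n (i + 1) z (hz _) (Function.update g i 0) (by
      intro l hl
      by_cases hl2 : l = i
      · subst hl2; simp
      · rw [Function.update_of_ne hl2]; exact hg l (by omega))
    have h2 := hP6 i _ h1 (g i)
    rwa [add_assoc, add_comm (ins B _), ins_add_sg] at h2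
  have hMi : ∀ i, ∀ g : ∀ i, G i, (∀ l, l < i → g l = 0) → z + ins B g ∈ P i := by
    intro i g hg
    have hlim : Tendsto (fun n => z + ins B (fun l => if l < i + 1 + n then g l else 0)) atTop
        (𝓝 (z + ins B g)) := by
      refine tendsto_const_nhds.add ?_
      rw [tendsto_pi_nhds]; intro l
      rw [tendsto_pi_nhds]; intro m
      refine tendsto_const_nhds.congr' ?_
      filter_upwards [eventually_gt_atTop l] with n hn
      have : l < i + 1 + n := by omega
      simp [ins, this]
    refine (hPc i).isClosed.mem_of_tendsto hlim (Eventually.of_forall fun n => ?_)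
    refine hM' i n _ fun l hl => ?_
    by_cases hl2 : l < i + 1 + n
    · simp only [hl2, if_true]; exact hg l (by omega)
    · simp [hl2]
  have hX : ∀ v : ∀ i, G i, (fun i n => if n = B i then v i else z i n) =
      z + ins B (fun i => v i - z i (B i)) := by
    intro v
    funext i n
    by_cases hn : n = B i
    · simp [ins, hn]
    · simp [ins, hn]
  have hXK : ∀ v : ∀ i, G i, (fun i n => if n = B i then v i else z i n) ∈ Kc := by
    intro v
    rw [hX]
    rw [← hst0]
    exact hP1 0 (hMi 0 _ (by omega))
  refine ⟨B, z, fun i => (st (i + 1)).1.2.2, strictMono_nat_of_lt_succ fun i => hP8 _, ?_, ?_⟩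
  · intro i v v' hvv
    have hsplit : ∀ v : ∀ i, G i, (fun i n => if n = B i then v i else z i n) =
        (z + ins B (fun l => if l < i then 0 else v l - z l (B l))) +
          ins B (fun l => if l < i then v l - z l (B l) else 0) := by
      intro v
      rw [hX, add_assoc]
      congr 1
      funext l n
      by_cases hn : n = B l <;> by_cases hl : l < i <;> simp [ins, hn, hl]
    have hH : ∀ v : ∀ i, G i, ins B (fun l => if l < i then v l - z l (B l) else 0) ∈
        HH G (st i).1.2.1 := by
      intro v l n hln
      by_cases hl : l < i
      · have h1 := hLB i l hl
        have h2 := hP10 l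
        have : n ≠ B l := by rintro rfl; exact hln ⟨by omega, h1⟩
        simp [ins, this]
      · simp [ins, hl]
    have e : (fun l => if l < i then (0 : G l) else v' l - z l (B l)) =
        (fun l => if l < i then 0 else v l - z l (B l)) := by
      funext l
      by_cases hl : l < i
      · simp [hl]
      · simp [hl, hvv l (by omega)]
    rw [hsplit v, hsplit v', e]
    exact hP7 i (hMi i _ (fun l hl => by simp [hl])) _ (hH v) _ (hH v')
  · intro i v v' hvv
    refine hP11 i _ (hXK v) _ (hXK v') fun l n hl hn => ?_
    by_cases hli : l < i
    · simp [hvv l hli]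
    · have := hBmono.monotone (show i ≤ l by omega)
      have : n ≠ B l := by omega
      simp [this]

end Fusion


/-- cost of a pair of reals -/
noncomputable def cst (r : ℝ) (a b : ℝ) : ℝ≥0∞ := edist a b ^ r

lemma cst_self {r : ℝ} (hr : 0 < r) (a : ℝ) : cst r a a = 0 := by
  simp [cst, hr]

lemma cst_comm (r a b : ℝ) : cst r a b = cst r b a := by
  simp [cst, edist_comm]

lemma cst_ne_top {r : ℝ} (hr : 0 ≤ r) (a b : ℝ) : cst r a b ≠ ⊤ :=
  ENNReal.rpow_ne_top_of_nonneg hr (edist_ne_top _ _)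

lemma cst_continuous (r : ℝ) : Continuous fun z : ℝ × ℝ => cst r z.1 z.2 := by
  unfold cst
  exact ENNReal.continuous_rpow_const.comp continuous_edist

lemma cst_eq_zero {r : ℝ} (hr : 0 < r) {a b : ℝ} (h : cst r a b = 0) : a = b := by
  unfold cst at h
  rw [ENNReal.rpow_eq_zero_iff_of_pos hr] at h
  exact edist_eq_zero.1 h

lemma cst_triangle {r P : ℝ} (hr : 1 ≤ r) (hP : r ≤ P) (a b c : ℝ) :
    cst r a c ≤ 2 ^ P * (cst r a b + cst r b c) := by
  unfold cst
  calc edist a c ^ r ≤ (edist a b + edist b c) ^ r :=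
        ENNReal.rpow_le_rpow (edist_triangle _ _ _) (by linarith)
    _ ≤ 2 ^ (r - 1) * (edist a b ^ r + edist b c ^ r) := ENNReal.rpow_add_le_mul_rpow_add_rpow _ _ hr
    _ ≤ _ := by
      gcongr
      · norm_num
      · linarith

lemma cst_chain {r R : ℝ} (hr : 1 ≤ r) (hR : r ≤ R) (a : ℕ → ℝ) (m : ℕ) (hm : 1 ≤ m) :
    cst r (a 0) (a m) ≤ (m : ℝ≥0∞) ^ (R - 1) * ∑ s ∈ Finset.range m, cst r (a s) (a (s + 1)) := by
  unfold cst
  calc edist (a 0) (a m) ^ r ≤ (∑ s ∈ Finset.range m, edist (a s) (a (s + 1))) ^ r :=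
        ENNReal.rpow_le_rpow (edist_le_range_sum_edist a m) (by linarith)
    _ ≤ (Finset.range m).card ^ (r - 1) * ∑ s ∈ Finset.range m, edist (a s) (a (s + 1)) ^ r :=
        ENNReal.rpow_sum_le_const_mul_sum_rpow _ _ hr
    _ ≤ _ := by
      rw [Finset.card_range]
      gcongr
      exact_mod_cast hm

lemma chain_step (m : ℕ) (hm : 1 ≤ m) (a : ℕ → ℕ → ℝ) (J : Finset ℕ) (r : ℕ → ℝ) (hr : ∀ j, 1 ≤ r j)
    (R : ℝ) (κ ε : ℝ≥0∞) (hε0 : ε ≠ 0) (hεt : ε ≠ ⊤)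
    (hJ : ∀ j ∈ J, r j ≤ R ∨ ∀ s, s < m → cst (r j) (a s j) (a (s + 1) j) = 0 ∨
      κ ≤ cst (r j) (a s j) (a (s + 1) j))
    (hε : ε ≤ ∑ j ∈ J, cst (r j) (a 0 j) (a m j)) :
    ∃ s < m, min κ (ε * (m : ℝ≥0∞) ^ (-R)) ≤ ∑ j ∈ J, cst (r j) (a s j) (a (s + 1) j) := by
  by_contra hcon
  push Not at hcon
  have hm0 : (m : ℝ≥0∞) ≠ 0 := by
    have : m ≠ 0 := by omega
    exact_mod_cast this
  have hmt : (m : ℝ≥0∞) ≠ ⊤ := ENNReal.natCast_ne_top m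
  have key : ∀ j ∈ J, cst (r j) (a 0 j) (a m j) ≤
      (m : ℝ≥0∞) ^ (R - 1) * ∑ s ∈ Finset.range m, cst (r j) (a s j) (a (s + 1) j) := by
    intro j hj
    rcases hJ j hj with h | h
    · exact cst_chain (hr j) h (fun s => a s j) m hm
    · have hz : ∀ s, s < m → cst (r j) (a s j) (a (s + 1) j) = 0 := by
        intro s hs
        rcases h s hs with h | h
        · exact h
        · exfalso
          have h1 := (hcon s hs).trans_le (min_le_left _ _)
          have h2 : cst (r j) (a s j) (a (s + 1) j) ≤ ∑ j ∈ J, cst (r j) (a s j) (a (s + 1) j) :=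
            Finset.single_le_sum (f := fun j => cst (r j) (a s j) (a (s + 1) j))
              (fun _ _ => zero_le) hj
          exact absurd (h.trans h2) (not_le.2 h1)
      have hconst : ∀ s, s ≤ m → a s j = a 0 j := by
        intro s
        induction s with
        | zero => simp
        | succ s ih =>
          intro hs
          rw [← cst_eq_zero (lt_of_lt_of_le one_pos (hr j)) (hz s (by omega))]
          exact ih (by omega)
      rw [hconst m le_rfl, cst_self (lt_of_lt_of_le one_pos (hr j))]
      exact zero_le
  have h1 : ε ≤ (m : ℝ≥0∞) ^ (R - 1) *
      ∑ s ∈ Finset.range m, ∑ j ∈ J, cst (r j) (a s j) (a (s + 1) j) := by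
    rw [Finset.sum_comm, Finset.mul_sum]
    exact hε.trans (Finset.sum_le_sum key)
  have h2 : ∑ s ∈ Finset.range m, ∑ j ∈ J, cst (r j) (a s j) (a (s + 1) j) <
      ∑ s ∈ Finset.range m, ε * (m : ℝ≥0∞) ^ (-R) := by
    apply ENNReal.sum_lt_sum_of_nonempty
    · exact ⟨0, by simp; omega⟩
    · intro s hs
      exact (hcon s (by simpa using hs)).trans_le (min_le_right _ _)
  have hp0 : (m : ℝ≥0∞) ^ (R - 1) ≠ 0 := by
    simp [ENNReal.rpow_eq_zero_iff, hm0, hmt]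
  have hpt : (m : ℝ≥0∞) ^ (R - 1) ≠ ⊤ := by
    simp [ENNReal.rpow_eq_top_iff, hm0, hmt]
  have h3 : (m : ℝ≥0∞) ^ (R - 1) *
      ∑ s ∈ Finset.range m, ∑ j ∈ J, cst (r j) (a s j) (a (s + 1) j) <
      (m : ℝ≥0∞) ^ (R - 1) * ∑ s ∈ Finset.range m, ε * (m : ℝ≥0∞) ^ (-R) :=
    (ENNReal.mul_lt_mul_iff_right hp0 hpt).2 h2
  have h4 : (m : ℝ≥0∞) ^ (R - 1) * ∑ s ∈ Finset.range m, ε * (m : ℝ≥0∞) ^ (-R) = ε := by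
    rw [Finset.sum_const, Finset.card_range, nsmul_eq_mul]
    calc (m : ℝ≥0∞) ^ (R - 1) * (m * (ε * (m : ℝ≥0∞) ^ (-R)))
        = ε * ((m : ℝ≥0∞) ^ (R - 1) * (m : ℝ≥0∞) ^ (1 : ℝ) * (m : ℝ≥0∞) ^ (-R)) := by
          rw [ENNReal.rpow_one]; ring
      _ = ε := by
        rw [← ENNReal.rpow_add _ _ hm0 hmt, ← ENNReal.rpow_add _ _ hm0 hmt]
        simp
  rw [h4] at h3
  exact absurd h1 (not_le.2 h3)

lemma tsum_blocks (a : ℕ → ℝ≥0∞) (K : ℕ → ℕ) (hK : StrictMono K) :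
    ∑' j, a j = ∑ j ∈ Finset.range (K 0), a j + ∑' i, ∑ j ∈ Finset.Ico (K i) (K (i + 1)), a j := by
  have h1 : Tendsto (fun n => ∑ j ∈ Finset.range (K n), a j) atTop (𝓝 (∑' j, a j)) :=
    (ENNReal.tendsto_nat_tsum a).comp hK.tendsto_atTop
  have h2 : ∀ n, ∑ j ∈ Finset.range (K n), a j = ∑ j ∈ Finset.range (K 0), a j +
      ∑ i ∈ Finset.range n, ∑ j ∈ Finset.Ico (K i) (K (i + 1)), a j := by
    intro n
    induction n with
    | zero => simp
    | succ n ih =>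
      rw [Finset.sum_range_succ, ← add_assoc, ← ih,
        Finset.sum_range_add_sum_Ico _ (hK.monotone (Nat.le_succ n))]
  exact tendsto_nhds_unique (h1.congr h2) (tendsto_const_nhds.add (ENNReal.tendsto_nat_tsum _))

theorem modular {G : ℕ → Type} (v0 : ∀ i, G i) (r : ℕ → ℝ) (P : ℝ) (hr : ∀ j, 1 ≤ r j)
    (hP : ∀ j, r j ≤ P) (F : (∀ i, G i) → ℕ → ℝ) (K : ℕ → ℕ) (hK : StrictMono K)
    (ha : ∀ i (v v' : ∀ i, G i), (∀ l, i ≤ l → v l = v' l) →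
        tailC (fun j => cst (r j)) (K i) (F v) (F v') ≤ 2⁻¹ ^ i)
    (hb : ∀ i (v v' : ∀ i, G i), (∀ l, l < i → v l = v' l) →
        ∑ j ∈ Finset.range (K i), cst (r j) (F v j) (F v' j) ≤ 2⁻¹ ^ i)
    (v v' : ∀ i, G i) :
    ∑' j, cst (r j) (F v j) (F v' j) ≠ ⊤ ↔
    ∑' i, ∑ j ∈ Finset.Ico (K i) (K (i + 1)), cst (r j) (F (Function.update v0 i (v i)) j)
      (F (Function.update v0 i (v' i)) j) ≠ ⊤ := by
  classical
  let blk : ℕ → (ℕ → ℝ) → (ℕ → ℝ) → ℝ≥0∞ := fun i u w =>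
    ∑ j ∈ Finset.Ico (K i) (K (i + 1)), cst (r j) (u j) (w j)
  have hCt : (2 : ℝ≥0∞) ^ P ≠ ⊤ :=
    ENNReal.rpow_ne_top_of_nonneg (by linarith [hr 0, hP 0]) (by simp)
  have htri : ∀ i u w x, blk i u x ≤ 2 ^ P * (blk i u w + blk i w x) := by
    intro i u w x
    simp only [blk]
    rw [← Finset.sum_add_distrib, Finset.mul_sum]
    exact Finset.sum_le_sum fun j _ => cst_triangle (hr j) (hP j) _ _ _
  have hcomm : ∀ i u w, blk i u w = blk i w u := by
    intro i u w
    exact Finset.sum_congr rfl fun j _ => cst_comm _ _ _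
  have hnear : ∀ (v : ∀ i, G i) i, blk i (F v) (F (Function.update v0 i (v i))) ≤
      2 ^ P * (2⁻¹ ^ i + 2⁻¹ ^ i) := by
    intro v i
    refine (htri i _ (F fun l => if l ≤ i then v l else v0 l) _).trans ?_
    gcongr
    · refine le_trans ?_ ((hb (i + 1) v (fun l => if l ≤ i then v l else v0 l) ?_).trans ?_)
      · refine Finset.sum_le_sum_of_subset ?_
        intro j hj
        simp at hj ⊢
        exact hj.2
      · intro l hl
        simp [Nat.lt_succ_iff.1 hl]
      · rw [pow_succ]
        refine mul_le_of_le_one_right' ?_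
        simp
    · refine le_trans ?_ (ha i (fun l => if l ≤ i then v l else v0 l) (Function.update v0 i (v i)) ?_)
      · simp only [blk, tailC]
        rw [Finset.sum_Ico_eq_sum_range]
        simp_rw [add_comm (K i)]
        exact ENNReal.sum_le_tsum (f := fun j => cst (r (j + K i))
          (F (fun l => if l ≤ i then v l else v0 l) (j + K i))
          (F (Function.update v0 i (v i)) (j + K i))) _
      · intro l hl
        rcases eq_or_lt_of_le hl with h | h
        · subst h; simp
        · simp [h.not_ge, h.ne']
  have hgeo : ∑' i : ℕ, (2 : ℝ≥0∞) ^ P * (2⁻¹ ^ i + 2⁻¹ ^ i) ≠ ⊤ := by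
    rw [ENNReal.tsum_mul_left, ENNReal.tsum_add, ENNReal.tsum_geometric]
    refine ENNReal.mul_ne_top hCt ?_
    simp
  have hbig : ∀ (u w u' w' : ℕ → ℕ → ℝ), (∀ i, blk i (u i) (w i) ≤ 2 ^ P * (2⁻¹ ^ i + 2⁻¹ ^ i)) →
      (∀ i, blk i (u' i) (w' i) ≤ 2 ^ P * (2⁻¹ ^ i + 2⁻¹ ^ i)) → ∑' i, blk i (w i) (w' i) ≠ ⊤ →
      ∑' i, blk i (u i) (u' i) ≠ ⊤ := by
    intro u w u' w' h1 h2 h3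
    have : ∀ i, blk i (u i) (u' i) ≤ 2 ^ P * (2 ^ P * (2⁻¹ ^ i + 2⁻¹ ^ i) +
        2 ^ P * (blk i (w i) (w' i) + 2 ^ P * (2⁻¹ ^ i + 2⁻¹ ^ i))) := by
      intro i
      refine (htri i _ (w i) _).trans ?_
      gcongr
      · exact h1 i
      · refine (htri i _ (w' i) _).trans ?_
        gcongr
        rw [hcomm]; exact h2 i
    refine ne_top_of_le_ne_top ?_ (ENNReal.tsum_le_tsum this)
    rw [ENNReal.tsum_mul_left, ENNReal.tsum_add, ENNReal.tsum_mul_left (a := 2 ^ P) (f := fun i =>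
      blk i (w i) (w' i) + 2 ^ P * (2⁻¹ ^ i + 2⁻¹ ^ i)), ENNReal.tsum_add]
    exact ENNReal.mul_ne_top hCt (ENNReal.add_ne_top.2 ⟨hgeo, ENNReal.mul_ne_top hCt
      (ENNReal.add_ne_top.2 ⟨h3, hgeo⟩)⟩)
  rw [tsum_blocks _ K hK]
  have hhead : ∑ j ∈ Finset.range (K 0), cst (r j) (F v j) (F v' j) ≠ ⊤ :=
    ENNReal.sum_ne_top.2 fun j _ => cst_ne_top (by linarith [hr j]) _ _
  constructor
  · intro h
    have h := (ENNReal.add_ne_top.1 h).2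
    refine hbig (fun i => F (Function.update v0 i (v i))) (fun i => F v)
      (fun i => F (Function.update v0 i (v' i))) (fun i => F v') ?_ ?_ h
    · intro i; rw [hcomm]; exact hnear v i
    · intro i; rw [hcomm]; exact hnear v' i
  · intro h
    refine ENNReal.add_ne_top.2 ⟨hhead, ?_⟩
    exact hbig (fun i => F v) (fun i => F (Function.update v0 i (v i)))
      (fun i => F v') (fun i => F (Function.update v0 i (v' i))) (hnear v) (hnear v') h


theorem contra (m : ℕ → ℕ) (hm : ∀ k, 1 ≤ m k) (τ : ℕ → ℕ) (W : Set ℕ) (hW : W.Infinite)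
    (hτ : ∀ k ∈ W, {i | τ i = k}.Infinite)
    (ee R : ℕ → ℝ) (hee : ∀ k, 1 ≤ ee k) (κ : ℕ → ℝ≥0∞)
    (hN : ∀ k ∈ W, ∃ N : ℕ, 1 ≤ N * κ k ∧ 1 ≤ N * (2⁻¹ ^ k * (m k : ℝ≥0∞) ^ (-R k)) ∧
      N * (m k : ℝ≥0∞) ^ (-ee k) ≤ 2⁻¹ ^ k)
    (r : ℕ → ℝ) (P : ℝ) (hr : ∀ j, 1 ≤ r j) (hP : ∀ j, r j ≤ P)
    (F : (∀ i, Fin (m (τ i) + 1)) → ℕ → ℝ) (K : ℕ → ℕ) (hK : StrictMono K)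
    (ha : ∀ i (v v' : ∀ i, Fin (m (τ i) + 1)), (∀ l, i ≤ l → v l = v' l) →
        tailC (fun j => cst (r j)) (K i) (F v) (F v') ≤ 2⁻¹ ^ i)
    (hb : ∀ i (v v' : ∀ i, Fin (m (τ i) + 1)), (∀ l, l < i → v l = v' l) →
        ∑ j ∈ Finset.range (K i), cst (r j) (F v j) (F v' j) ≤ 2⁻¹ ^ i)
    (hred : ∀ v v' : (∀ i, Fin (m (τ i) + 1)), ∑' j, cst (r j) (F v j) (F v' j) ≠ ⊤ ↔
      ∑' i, cst (ee (τ i)) (((v i : ℕ) : ℝ) / m (τ i)) (((v' i : ℕ) : ℝ) / m (τ i)) ≠ ⊤)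
    (hdich : ∀ k ∈ W, ∀ j, r j ≤ R k ∨ ∀ v v', cst (r j) (F v j) (F v' j) = 0 ∨
      κ k ≤ cst (r j) (F v j) (F v' j)) : False := by
  classical
  let v0 : ∀ i, Fin (m (τ i) + 1) := fun i => 0
  let E : ∀ i, Fin (m (τ i) + 1) → Fin (m (τ i) + 1) → ℝ≥0∞ := fun i a a' =>
    ∑ j ∈ Finset.Ico (K i) (K (i + 1)), cst (r j) (F (Function.update v0 i a) j)
      (F (Function.update v0 i a') j)
  have hE : ∀ v v' : (∀ i, Fin (m (τ i) + 1)), ∑' i, E i (v i) (v' i) ≠ ⊤ ↔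
      ∑' i, cst (ee (τ i)) (((v i : ℕ) : ℝ) / m (τ i)) (((v' i : ℕ) : ℝ) / m (τ i)) ≠ ⊤ := by
    intro v v'
    rw [← hred, modular v0 r P hr hP F K hK ha hb]
  have hE0 : ∀ i a, E i a a = 0 := fun i a =>
    Finset.sum_eq_zero fun j _ => cst_self (lt_of_lt_of_le one_pos (hr j)) _
  have hc0 : ∀ i (x : ℝ), cst (ee (τ i)) x x = 0 := fun i x =>
    cst_self (lt_of_lt_of_le one_pos (hee _)) _
  have hm' : ∀ k, (m k : ℝ) ≠ 0 := fun k => by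
    have := hm k
    have : m k ≠ 0 := by omega
    exact_mod_cast this
  -- claim 1
  obtain ⟨n0, hn0⟩ : ∃ n0 : ℕ, {i | E i 0 (Fin.last _) < 2⁻¹ ^ n0}.Finite := by
    by_contra hcon
    push Not at hcon
    obtain ⟨φ, hφ, hφ2⟩ := Filter.extraction_forall_of_frequently
      (P := fun n i => E i 0 (Fin.last _) < 2⁻¹ ^ n)
      (fun n => Nat.frequently_atTop_iff_infinite.2 (hcon n))
    have h := hE (fun i => 0) (fun i => if i ∈ range φ then Fin.last _ else 0)
    have e1 : ∑' i, E i 0 (if i ∈ range φ then Fin.last _ else 0) =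
        ∑' n, E (φ n) 0 (Fin.last _) := by
      rw [← hφ.injective.tsum_eq (f := fun i => E i 0 (if i ∈ range φ then Fin.last _ else 0))]
      · simp
      · intro i hi
        by_contra hcc
        refine hi ?_
        show E i 0 (if i ∈ range φ then Fin.last _ else 0) = 0
        rw [if_neg hcc, hE0]
    have e2 : ∑' i, cst (ee (τ i)) ((((0 : Fin (m (τ i) + 1)) : ℕ) : ℝ) / m (τ i))
        ((((if i ∈ range φ then Fin.last _ else 0 : Fin (m (τ i) + 1)) : ℕ) : ℝ) / m (τ i)) =
        ∑' n : ℕ, (1 : ℝ≥0∞) := by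
      rw [← hφ.injective.tsum_eq]
      · congr 1
        funext n
        simp [cst, hm']
      · intro i hi
        by_contra hcc
        refine hi ?_
        show cst (ee (τ i)) ((((0 : Fin (m (τ i) + 1)) : ℕ) : ℝ) / m (τ i))
          ((((if i ∈ range φ then Fin.last _ else 0 : Fin (m (τ i) + 1)) : ℕ) : ℝ) / m (τ i)) = 0
        rw [if_neg hcc]; exact hc0 _ _
    rw [e1, e2, ENNReal.tsum_const_eq_top_of_ne_zero one_ne_zero] at h
    refine absurd (h.1 ?_) (by simp)
    refine ne_top_of_le_ne_top ?_ (ENNReal.tsum_le_tsum fun n => (hφ2 n).le)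
    rw [ENNReal.tsum_geometric]; simp
  -- choose N, I
  choose! N hN1 hN2 hN3 using hN
  have hI : ∀ k, ∃ I : Finset ℕ, (∀ i ∈ I, τ i = k ∧ k ∈ W ∧ 2⁻¹ ^ n0 ≤ E i 0 (Fin.last _)) ∧
      (k ∈ W → I.card = N k) ∧ (I.card : ℝ≥0∞) * (m k : ℝ≥0∞) ^ (-ee k) ≤ 2⁻¹ ^ k := by
    intro k
    by_cases hk : k ∈ W
    · have : ({i | τ i = k} \ {i | E i 0 (Fin.last _) < 2⁻¹ ^ n0}).Infinite := (hτ k hk).diff hn0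
      obtain ⟨I, hI, hIc⟩ := this.exists_subset_card_eq (N k)
      refine ⟨I, fun i hi => ?_, fun _ => hIc, ?_⟩
      · have := hI hi
        simp only [Set.mem_sdiff, mem_setOf_eq, not_lt] at this
        exact ⟨this.1, hk, this.2⟩
      · rw [hIc]; exact hN3 k hk
    · exact ⟨∅, by simp, fun h => absurd h hk, by simp⟩
  choose I hI1 hI2 hI3 using hI
  have hs : ∀ i, ∃ s < m (τ i), i ∈ I (τ i) →
      min (κ (τ i)) (2⁻¹ ^ n0 * (m (τ i) : ℝ≥0∞) ^ (-R (τ i))) ≤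
        E i (Fin.ofNat _ s) (Fin.ofNat _ (s + 1)) := by
    intro i
    by_cases hi : i ∈ I (τ i)
    · obtain ⟨-, hk, hge⟩ := hI1 _ i hi
      obtain ⟨s, hs, hs2⟩ := chain_step (m (τ i)) (hm _)
        (fun s => F (Function.update v0 i (Fin.ofNat _ s))) (Finset.Ico (K i) (K (i + 1))) r hr
        (R (τ i)) (κ (τ i)) (2⁻¹ ^ n0) (by simp) (by simp) (by
          intro j _
          rcases hdich _ hk j with h | h
          · exact Or.inl h
          · exact Or.inr fun s _ => h _ _) (by
          refine hge.trans (le_of_eq ?_)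
          simp only [E]
          have : (Fin.ofNat (m (τ i) + 1) (m (τ i))) = Fin.last _ := by
            ext; simp
          rw [this]
          rfl)
      exact ⟨s, hs, fun _ => hs2⟩
    · exact ⟨0, hm _, fun h => absurd h hi⟩
  choose s hs1 hs2 using hs
  let v : ∀ i, Fin (m (τ i) + 1) := fun i => if i ∈ I (τ i) then Fin.ofNat _ (s i) else 0
  let v' : ∀ i, Fin (m (τ i) + 1) := fun i => if i ∈ I (τ i) then Fin.ofNat _ (s i + 1) else 0
  have hre : ∀ a : ℕ → ℝ≥0∞, (∀ i, i ∉ I (τ i) → a i = 0) → ∑' i, a i = ∑' k, ∑ i ∈ I k, a i := by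
    intro a h0
    calc ∑' i, a i = ∑' i, ∑' k, if k = τ i then a i else 0 := by
          congr 1; funext i
          rw [tsum_ite_eq]
      _ = ∑' k, ∑' i, if k = τ i then a i else 0 := ENNReal.tsum_comm
      _ = _ := by
        congr 1; funext k
        rw [tsum_eq_sum (s := I k)]
        · refine Finset.sum_congr rfl fun i hi => ?_
          rw [if_pos (hI1 k i hi).1.symm]
        · intro i hi
          by_cases hk : k = τ i
          · subst hk; simp [h0 i hi]
          · simp [hk]
  have hsrc : ∑' i, cst (ee (τ i)) (((v i : ℕ) : ℝ) / m (τ i)) (((v' i : ℕ) : ℝ) / m (τ i)) ≠ ⊤ := by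
    rw [hre]
    · have hle : ∀ k, ∑ i ∈ I k, cst (ee (τ i)) (((v i : ℕ) : ℝ) / m (τ i))
          (((v' i : ℕ) : ℝ) / m (τ i)) ≤ 2⁻¹ ^ k := by
        intro k
        refine le_trans (le_of_eq ?_) (hI3 k)
        rw [← nsmul_eq_mul, ← Finset.sum_const]
        refine Finset.sum_congr rfl fun i hi => ?_
        obtain ⟨rfl, -, -⟩ := hI1 k i hi
        have h1 : (v i : ℕ) = s i := by
          simp only [v, hi, if_true, Fin.val_ofNat]
          exact Nat.mod_eq_of_lt (by have := hs1 i; omega)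
        have h2 : (v' i : ℕ) = s i + 1 := by
          simp only [v', hi, if_true, Fin.val_ofNat]
          exact Nat.mod_eq_of_lt (by have := hs1 i; omega)
        rw [h1, h2, cst, ENNReal.rpow_neg, ← ENNReal.inv_rpow]
        congr 1
        rw [edist_dist, Real.dist_eq]
        have : ((s i : ℕ) : ℝ) / m (τ i) - ((s i + 1 : ℕ) : ℝ) / m (τ i) = - (m (τ i) : ℝ)⁻¹ := by
          push_cast; field_simp; ring
        rw [this, abs_neg, abs_of_nonneg (by positivity), ENNReal.ofReal_inv_of_pos]
        · simp
        · exact lt_of_le_of_ne (by positivity) (hm' _).symm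
      refine ne_top_of_le_ne_top ?_ (ENNReal.tsum_le_tsum hle)
      rw [ENNReal.tsum_geometric]; simp
    · intro i hi
      simp [v, v', hi, hc0]
  have htgt : ∑' i, E i (v i) (v' i) = ⊤ := by
    rw [hre]
    · have hinf : (W \ {k | k < n0}).Infinite := hW.diff (Set.finite_lt_nat n0)
      have := hinf.to_subtype
      rw [eq_top_iff, ← ENNReal.tsum_const_eq_top_of_ne_zero (α := ↥(W \ {k | k < n0}))
        (c := (1 : ℝ≥0∞)) one_ne_zero]
      refine le_trans (ENNReal.tsum_le_tsum ?_) (ENNReal.tsum_comp_le_tsum_of_injective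
        (Subtype.val_injective (p := fun k => k ∈ W \ {k | k < n0})) _)
      rintro ⟨k, hk, hkn⟩
      simp only [mem_setOf_eq, not_lt] at hkn
      have h1 : (N k : ℝ≥0∞) * min (κ k) (2⁻¹ ^ k * (m k : ℝ≥0∞) ^ (-R k)) ≤
          ∑ i ∈ I k, E i (v i) (v' i) := by
        rw [← hI2 k hk, ← nsmul_eq_mul, ← Finset.sum_const]
        refine Finset.sum_le_sum fun i hi => ?_
        obtain ⟨rfl, -, -⟩ := hI1 k i hi
        have : E i (v i) (v' i) = E i (Fin.ofNat _ (s i)) (Fin.ofNat _ (s i + 1)) := by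
          simp only [v, v', hi, if_true]
        rw [this]
        refine le_trans ?_ (hs2 i hi)
        have h21 : (2⁻¹ : ℝ≥0∞) ≤ 1 := by simp
        exact min_le_min le_rfl (mul_le_mul' (pow_le_pow_right_of_le_one' h21 hkn) le_rfl)
      refine le_trans ?_ h1
      rcases min_choice (κ k) (2⁻¹ ^ k * (m k : ℝ≥0∞) ^ (-R k)) with h | h
      · rw [h]; exact hN1 k hk
      · rw [h]; exact hN2 k hk
    · intro i hi
      simp [v, v', hi, hE0]
  exact (hE v v').2 hsrc htgt


lemma cst_eq_ofReal {r : ℝ} (hr : 0 ≤ r) (a b : ℝ) : cst r a b = ENNReal.ofReal (|a - b| ^ r) := by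
  rw [cst, edist_dist, Real.dist_eq, ENNReal.ofReal_rpow_of_nonneg (abs_nonneg _) hr]

lemma lpRel_iff {q : ℝ} (hq : 0 ≤ q) (x y : ℕ → ℝ) :
    lpRel q x y ↔ ∑' n, cst q (x n) (y n) ≠ ⊤ := by
  have h : ∀ n, cst q (x n) (y n) = ((nndist (x n) (y n) ^ q : NNReal) : ℝ≥0∞) := fun n => by
    rw [cst, edist_nndist, ENNReal.coe_rpow_of_nonneg _ hq]
  simp_rw [h]
  rw [ENNReal.tsum_coe_ne_top_iff_summable, ← NNReal.summable_coe, lpRel]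
  simp [Real.dist_eq]

/-- the exponents -/
noncomputable def ex (p : ℝ) (k : ℕ) : ℝ := p + 1 / (k : ℝ)

lemma ex_zero (p : ℝ) : ex p 0 = p := by simp [ex]

lemma le_ex (p : ℝ) (k : ℕ) : p ≤ ex p k := by
  have : (0:ℝ) ≤ 1 / (k:ℝ) := by positivity
  unfold ex; linarith

lemma ex_le (p : ℝ) (k : ℕ) : ex p k ≤ p + 1 := by
  unfold ex
  rcases Nat.eq_zero_or_pos k with h | h
  · simp [h]
  · have : (1:ℝ) ≤ k := by exact_mod_cast h
    have : 1 / (k:ℝ) ≤ 1 := by rw [div_le_one (by linarith)]; exact this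
    linarith

lemma ex_anti (p : ℝ) {k l : ℕ} (hk : 1 ≤ k) (h : k ≤ l) : ex p l ≤ ex p k := by
  unfold ex
  have h1 : (1:ℝ) ≤ k := by exact_mod_cast hk
  have h2 : (k:ℝ) ≤ l := by exact_mod_cast h
  have := one_div_le_one_div_of_le (by linarith) h2
  linarith

lemma ex_lt (p : ℝ) {k : ℕ} (hk : 1 ≤ k) : ex p (k + 1) < ex p k := by
  unfold ex
  have h1 : (1:ℝ) ≤ k := by exact_mod_cast hk
  have := one_div_lt_one_div_of_lt (a := (k:ℝ)) (b := k + 1) (by linarith) (by linarith)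
  push_cast
  linarith

/-- the grids -/
noncomputable def gam (m : ℕ → ℕ) (k : ℕ) (v : ℝ) : ℝ :=
  if k = 0 then v else ((min ⌊v⌋₊ (m k) : ℕ) : ℝ) / (m k)

lemma gam_zero_right (m : ℕ → ℕ) (k : ℕ) : gam m k 0 = 0 := by
  unfold gam; split_ifs <;> simp

lemma gam_nat (m : ℕ → ℕ) {k : ℕ} (hk : k ≠ 0) {s : ℕ} (hs : s ≤ m k) :
    gam m k s = (s : ℝ) / m k := by
  simp [gam, hk, hs]

lemma gam_measurable (m : ℕ → ℕ) (k : ℕ) : Measurable (gam m k) := by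
  unfold gam
  split_ifs
  · exact measurable_id
  · refine Measurable.div_const ?_ _
    have : Measurable fun n : ℕ => ((min n (m k) : ℕ) : ℝ) := measurable_from_nat
    exact this.comp Nat.measurable_floor

lemma gam_edist (m : ℕ → ℕ) {k : ℕ} (hk : k ≠ 0) (hm : 1 ≤ m k) (u v : ℝ) :
    edist (gam m k u) (gam m k v) = 0 ∨
      ((m k : ℝ≥0∞)⁻¹ ≤ edist (gam m k u) (gam m k v) ∧ edist (gam m k u) (gam m k v) ≤ 1) := by
  simp only [gam, hk, if_false]
  have ha : min ⌊u⌋₊ (m k) ≤ m k := min_le_right _ _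
  have hb : min ⌊v⌋₊ (m k) ≤ m k := min_le_right _ _
  generalize min ⌊u⌋₊ (m k) = a at *
  generalize min ⌊v⌋₊ (m k) = b at *
  by_cases hab : a = b
  · left; simp [hab]
  right
  have hm0 : (0:ℝ) < m k := by exact_mod_cast hm
  have e : edist ((a:ℝ) / m k) ((b:ℝ) / m k) = ENNReal.ofReal (|(a:ℝ) - b| / m k) := by
    rw [edist_dist, Real.dist_eq, ← sub_div, abs_div, abs_of_pos hm0]
  have e2 : ((m k : ℝ≥0∞))⁻¹ = ENNReal.ofReal ((m k : ℝ)⁻¹) := by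
    rw [ENNReal.ofReal_inv_of_pos hm0]; simp
  rw [e, e2]
  have h1 : (1:ℝ) ≤ |(a:ℝ) - b| := by
    have : (1:ℤ) ≤ |(a:ℤ) - b| := Int.one_le_abs (by omega)
    exact_mod_cast this
  have h2 : |(a:ℝ) - b| ≤ m k := by
    have : |(a:ℤ) - b| ≤ m k := by rw [abs_le]; omega
    exact_mod_cast this
  constructor
  · apply ENNReal.ofReal_le_ofReal
    rw [inv_eq_one_div]
    gcongr
  · rw [ENNReal.ofReal_le_one, div_le_one hm0]; exact h2

lemma cst_comp {M : ℝ≥0∞} (hM : 1 ≤ M) (hMt : M ≠ ⊤) {a b r r' D : ℝ} (hr : 0 < r) (hr' : 0 < r')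
    (hD : 0 < D) (hrD : r' ≤ r + D)
    (h : edist a b = 0 ∨ (M⁻¹ ≤ edist a b ∧ edist a b ≤ 1)) :
    cst r a b ≤ M ^ D * cst r' a b := by
  rcases h with h | ⟨h1, h2⟩
  · simp [cst, h, hr]
  unfold cst
  generalize edist a b = d at *
  have hM0 : M ≠ 0 := fun h => by simp [h] at hM
  have hd0 : d ≠ 0 := by
    rintro rfl
    simp [hMt] at h1
  have hdt : d ≠ ⊤ := ne_top_of_le_ne_top ENNReal.one_ne_top h2
  have h3 : 1 ≤ M ^ D * d ^ D := by
    rw [← ENNReal.mul_rpow_of_nonneg _ _ hD.le]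
    have : 1 ≤ M * d := by
      calc (1:ℝ≥0∞) = M * M⁻¹ := (ENNReal.mul_inv_cancel hM0 hMt).symm
        _ ≤ _ := by gcongr
    exact ENNReal.one_le_rpow this hD
  calc d ^ r = 1 * d ^ r := (one_mul _).symm
    _ ≤ (M ^ D * d ^ D) * d ^ r := by gcongr
    _ = M ^ D * d ^ (r + D) := by
      rw [mul_assoc, ← ENNReal.rpow_add _ _ hd0 hdt, add_comm]
    _ ≤ _ := by
      refine mul_le_mul' le_rfl ?_
      exact ENNReal.rpow_le_rpow_of_exponent_ge h2 hrD


open Classical in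
/-- the coordinate map -/
noncomputable def TU (m : ℕ → ℕ) (U : Set ℕ) (x : ℕ × ℕ → ℝ) (ki : ℕ × ℕ) : ℝ :=
  if ki.1 ∈ U then gam m ki.1 (x ki) else 0

/-- the total cost -/
noncomputable def DD (p : ℝ) (u v : ℕ × ℕ → ℝ) : ℝ≥0∞ :=
  ∑' ki : ℕ × ℕ, cst (ex p ki.1) (u ki) (v ki)

/-- the relations -/
def RR (p : ℝ) (m : ℕ → ℕ) (U : Set ℕ) (x y : ℕ × ℕ → ℝ) : Prop :=
  DD p (TU m U x) (TU m U y) ≠ ⊤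

lemma TU_eq_gam (m : ℕ → ℕ) (U : Set ℕ) (x : ℕ × ℕ → ℝ) (ki : ℕ × ℕ) :
    ∃ v, TU m U x ki = gam m ki.1 v := by
  unfold TU
  split_ifs
  · exact ⟨_, rfl⟩
  · exact ⟨0, (gam_zero_right _ _).symm⟩

lemma TU_measurable (m : ℕ → ℕ) (U : Set ℕ) : Measurable (TU m U) := by
  refine measurable_pi_lambda _ fun ki => ?_
  unfold TU
  split_ifs
  · exact (gam_measurable m _).comp (measurable_pi_apply _)
  · exact measurable_const

lemma ne_top_comp {ι : Type*} {a b : ι → ℝ≥0∞} {C : ℝ≥0∞} (hC : C ≠ ⊤) (h : ∀ i, a i ≤ C * b i)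
    (hb : ∑' i, b i ≠ ⊤) : ∑' i, a i ≠ ⊤ := by
  refine ne_top_of_le_ne_top ?_ (ENNReal.tsum_le_tsum h)
  rw [ENNReal.tsum_mul_left]
  exact ENNReal.mul_ne_top hC hb

lemma RR_equiv {p : ℝ} (hp : 1 ≤ p) (m : ℕ → ℕ) (U : Set ℕ) : Equivalence (RR p m U) := by
  have h1 : ∀ k, 1 ≤ ex p k := fun k => hp.trans (le_ex p k)
  refine ⟨fun x => ?_, fun {x y} h => ?_, fun {x y z} h h' => ?_⟩
  · unfold RR DD
    rw [ENNReal.tsum_eq_zero.2]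
    · simp
    · intro ki
      exact cst_self (by linarith [h1 ki.1]) _
  · unfold RR DD at *
    simp_rw [cst_comm _ (TU m U y _)]
    exact h
  · unfold RR DD at *
    refine ne_top_comp (C := 2 ^ (p + 1))
      (b := fun ki => cst (ex p ki.1) (TU m U x ki) (TU m U y ki) +
        cst (ex p ki.1) (TU m U y ki) (TU m U z ki)) (by
          exact ENNReal.rpow_ne_top_of_nonneg (by linarith) (by simp))
        (fun ki => cst_triangle (h1 _) (ex_le p _) _ _ _) ?_
    rw [ENNReal.tsum_add]
    exact ENNReal.add_ne_top.2 ⟨h, h'⟩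

lemma RR_meas (p : ℝ) (m : ℕ → ℕ) (U : Set ℕ) :
    MeasurableSet {z : (ℕ × ℕ → ℝ) × (ℕ × ℕ → ℝ) | RR p m U z.1 z.2} := by
  have : Measurable fun z : (ℕ × ℕ → ℝ) × (ℕ × ℕ → ℝ) => DD p (TU m U z.1) (TU m U z.2) := by
    unfold DD
    refine Measurable.tsum fun ki => ?_
    refine (cst_continuous _).measurable.comp (Measurable.prodMk ?_ ?_)
    · exact (measurable_pi_apply ki).comp ((TU_measurable m U).comp measurable_fst)
    · exact (measurable_pi_apply ki).comp ((TU_measurable m U).comp measurable_snd)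
  exact this (measurableSet_singleton ⊤).compl

lemma tsum_block0 (a : ℕ → ℝ≥0∞) :
    ∑' ki : ℕ × ℕ, (if ki.1 = 0 then a ki.2 else 0) = ∑' n, a n := by
  rw [ENNReal.tsum_prod (f := fun k i => if k = 0 then a i else 0), tsum_eq_single 0]
  · simp
  · intro k hk
    simp [hk]

lemma RR_lower {p : ℝ} (hp : 1 ≤ p) (m : ℕ → ℕ) {U : Set ℕ} (hU : 0 ∈ U) :
    BorelReducible (lpRel p) (RR p m U) := by
  refine ⟨fun x ki => if ki.1 = 0 then x ki.2 else 0, ?_, fun x y => ?_⟩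
  · refine measurable_pi_lambda _ fun ki => ?_
    split_ifs
    · exact measurable_pi_apply _
    · exact measurable_const
  · rw [lpRel_iff (by linarith), RR, DD, ← tsum_block0]
    refine iff_of_eq (congrArg (fun t => t ≠ ⊤) (tsum_congr fun ki => ?_))
    obtain ⟨k, i⟩ := ki
    by_cases hk : k = 0
    · subst hk
      simp [TU, hU, gam, ex_zero]
    · have : 0 < ex p k := by linarith [le_ex p k]
      simp only [TU, hk, if_false]
      rw [cst_self this]

lemma RR_fin {p : ℝ} (hp : 1 ≤ p) (m : ℕ → ℕ) (hm : ∀ k, 1 ≤ m k) {U V : Set ℕ}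
    (hU : 0 ∈ U) (hV : 0 ∈ V) (hUV : (U \ V).Finite) :
    BorelReducible (RR p m U) (RR p m V) := by
  classical
  have hpos : ∀ k, 0 < ex p k := fun k => by linarith [le_ex p k]
  refine ⟨fun x ki => if ki.1 = 0 then
      (if ki.2.unpair.1 = 0 ∨ ki.2.unpair.1 ∈ U \ V then gam m ki.2.unpair.1 (x ki.2.unpair) else 0)
      else if ki.1 ∈ U then x ki else 0, ?_, fun x y => ?_⟩
  · refine measurable_pi_lambda _ fun ki => ?_
    split_ifs
    · exact (gam_measurable m _).comp (measurable_pi_apply _)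
    · exact measurable_const
    · exact measurable_pi_apply _
    · exact measurable_const
  · let A : ℕ × ℕ → ℝ≥0∞ := fun ki => if ki.1 = 0 ∨ ki.1 ∈ U \ V then
      cst p (gam m ki.1 (x ki)) (gam m ki.1 (y ki)) else 0
    let B : ℕ × ℕ → ℝ≥0∞ := fun ki => if ki.1 ≠ 0 ∧ ki.1 ∈ U ∧ ki.1 ∈ V then
      cst (ex p ki.1) (gam m ki.1 (x ki)) (gam m ki.1 (y ki)) else 0
    let S : ℕ × ℕ → ℝ≥0∞ := fun ki => if ki.1 ∈ U then
      cst (ex p ki.1) (gam m ki.1 (x ki)) (gam m ki.1 (y ki)) else 0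
    have hS : DD p (TU m U x) (TU m U y) = ∑' ki, S ki := by
      refine tsum_congr fun ki => ?_
      by_cases h : ki.1 ∈ U
      · simp [S, TU, h]
      · simp [S, TU, h, cst_self (hpos _)]
    have hT : ∀ x' y' : ℕ × ℕ → ℝ, (x' = fun ki => if ki.1 = 0 then
      (if ki.2.unpair.1 = 0 ∨ ki.2.unpair.1 ∈ U \ V then gam m ki.2.unpair.1 (x ki.2.unpair) else 0)
      else if ki.1 ∈ U then x ki else 0) → (y' = fun ki => if ki.1 = 0 then
      (if ki.2.unpair.1 = 0 ∨ ki.2.unpair.1 ∈ U \ V then gam m ki.2.unpair.1 (y ki.2.unpair) else 0)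
      else if ki.1 ∈ U then y ki else 0) →
        DD p (TU m V x') (TU m V y') = ∑' ki, (A ki + B ki) := by
      intro x' y' hx' hy'
      rw [ENNReal.tsum_add]
      have hA : ∑' ki, A ki = ∑' n : ℕ, A n.unpair := (Nat.pairEquiv.symm.tsum_eq A).symm
      rw [hA, ← tsum_block0, ← ENNReal.tsum_add]
      refine tsum_congr fun ki => ?_
      obtain ⟨k, i⟩ := ki
      by_cases hk : k = 0
      · subst hk
        by_cases hi : i.unpair.1 = 0 ∨ i.unpair.1 ∈ U \ V
        · simp only [TU, hV, if_true, gam, hx', hy', A, B, ex_zero, hi, ne_eq, not_true_eq_false,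
            false_and, if_false, add_zero]
        · simp only [TU, hV, if_true, gam, hx', hy', A, B, ex_zero, hi, ne_eq, not_true_eq_false,
            false_and, if_false, add_zero]
          exact cst_self (by linarith) _
      · by_cases hkV : k ∈ V
        · by_cases hkU : k ∈ U
          · simp [TU, hkV, hkU, hk, hx', hy', B]
          · simp [TU, hkV, hkU, hk, hx', hy', B, cst_self (hpos _)]
        · simp [TU, hkV, hk, B, cst_self (hpos _)]
    rw [RR, RR, hS, hT _ _ rfl rfl]
    let C : ℝ≥0∞ := 1 + ∑ k ∈ hUV.toFinset, (m k : ℝ≥0∞)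
    have hC : C ≠ ⊤ := by simp [C, ENNReal.sum_eq_top]
    have hC1 : 1 ≤ C := le_self_add
    have hCm : ∀ k ∈ U \ V, (m k : ℝ≥0∞) ^ (1:ℝ) ≤ C := fun k hk => by
      rw [ENNReal.rpow_one]
      refine le_trans ?_ le_add_self
      exact Finset.single_le_sum (f := fun k => (m k : ℝ≥0∞)) (fun _ _ => zero_le)
        (hUV.mem_toFinset.2 hk)
    have hle : ∀ a : ℝ≥0∞, a ≤ C * a := fun a => by
      calc a = 1 * a := (one_mul a).symm
        _ ≤ _ := by gcongr
    have hm1 : ∀ k, (1:ℝ≥0∞) ≤ m k := fun k => by exact_mod_cast hm k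
    constructor
    · refine ne_top_comp hC fun ki => ?_
      obtain ⟨k, i⟩ := ki
      by_cases hk : k = 0
      · subst hk
        simp [A, B, S, hU, ex_zero, hle]
      · by_cases hkU : k ∈ U
        · by_cases hkV : k ∈ V
          · simp [A, B, S, hk, hkU, hkV, hle]
          · simp only [A, B, S, hk, hkU, hkV, Set.mem_sdiff, not_false_eq_true, and_true, or_true,
              if_true, and_false, if_false, add_zero]
            refine le_trans (cst_comp (hm1 k) (by simp) (by linarith) (hpos k) (one_pos)
              (ex_le p k) (gam_edist m hk (hm k) _ _)) ?_
            exact mul_le_mul' (hCm k ⟨hkU, hkV⟩) le_rfl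
        · simp [A, B, S, hk, hkU]
    · refine ne_top_comp hC fun ki => ?_
      obtain ⟨k, i⟩ := ki
      by_cases hk : k = 0
      · subst hk
        simp [A, B, S, hU, ex_zero, hle]
      · by_cases hkU : k ∈ U
        · by_cases hkV : k ∈ V
          · simp [A, B, S, hk, hkU, hkV, hle]
          · simp only [A, B, S, hk, hkU, hkV, Set.mem_sdiff, not_false_eq_true, and_true, or_true,
              if_true, and_false, if_false, add_zero]
            refine le_trans (cst_comp (hm1 k) (by simp) (hpos k) (by linarith) (one_pos)
              (by linarith [le_ex p k]) (gam_edist m hk (hm k) _ _)) ?_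
            exact mul_le_mul' (hCm k ⟨hkU, hkV⟩) le_rfl
        · simp [S, hkU]


/-- circle coordinates -/
noncomputable def circ (q r : ℝ) (j : ℤ) (b : Bool) (t : ℝ) : ℝ :=
  (2:ℝ) ^ (-(j * r / q)) * (if b then Real.cos ((2:ℝ) ^ (j:ℝ) * t) else Real.sin ((2:ℝ) ^ (j:ℝ) * t))

lemma circ_measurable (q r : ℝ) (j : ℤ) (b : Bool) : Measurable (circ q r j b) := by
  unfold circ
  cases b <;> simp <;> fun_prop

lemma cs_diff (b : Bool) (u v : ℝ) :
    |(if b then Real.cos u else Real.sin u) - (if b then Real.cos v else Real.sin v)| ≤ |u - v| ∧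
    |(if b then Real.cos u else Real.sin u) - (if b then Real.cos v else Real.sin v)| ≤ 2 := by
  cases b
  · simp only [Bool.false_eq_true, if_false]
    constructor
    · have := Real.lipschitzWith_sin.dist_le_mul u v
      simpa [Real.dist_eq] using this
    · rw [abs_le]
      constructor <;> linarith [Real.neg_one_le_sin u, Real.sin_le_one u, Real.neg_one_le_sin v, Real.sin_le_one v]
  · simp only [if_true]
    constructor
    · have := Real.lipschitzWith_cos.dist_le_mul u v
      simpa [Real.dist_eq] using this
    · rw [abs_le]
      constructor <;> linarith [Real.neg_one_le_cos u, Real.cos_le_one u, Real.neg_one_le_cos v, Real.cos_le_one v]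

lemma circ_cost {q r : ℝ} (hq : 0 < q) (j : ℤ) (b : Bool) (s t : ℝ) :
    |circ q r j b s - circ q r j b t| ^ q = (2:ℝ) ^ (-(j * r)) *
    |(if b then Real.cos ((2:ℝ) ^ (j:ℝ) * s) else Real.sin ((2:ℝ) ^ (j:ℝ) * s)) -
      (if b then Real.cos ((2:ℝ) ^ (j:ℝ) * t) else Real.sin ((2:ℝ) ^ (j:ℝ) * t))| ^ q := by
  unfold circ
  rw [← mul_sub, abs_mul, Real.mul_rpow (abs_nonneg _) (abs_nonneg _), abs_of_pos (by positivity),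
    ← Real.rpow_mul (by norm_num)]
  congr 2
  field_simp

lemma circ_upper {q r δ : ℝ} (hr : 1 ≤ r) (hδ0 : 0 < δ) (hδ : δ ≤ 1) (hδq : r + δ ≤ q) {s t : ℝ} (x : ℝ)
    (hx : |s - t| = 2 ^ x) (b : Bool) (l : ℤ) :
    |circ q r (l - ⌊x⌋) b s - circ q r (l - ⌊x⌋) b t| ^ q ≤ 2 ^ q * |s - t| ^ r * 2 ^ (-(δ * |(l:ℝ)|)) := by
  have hq : 0 < q := by linarith
  have f1 := Int.floor_le x
  have f2 := Int.lt_floor_add_one x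
  rw [circ_cost hq, hx, ← Real.rpow_mul (by norm_num), ← Real.rpow_add (by norm_num),
    ← Real.rpow_add (by norm_num)]
  obtain ⟨h1, h2⟩ := cs_diff b ((2:ℝ) ^ ((l - ⌊x⌋ : ℤ):ℝ) * s) ((2:ℝ) ^ ((l - ⌊x⌋ : ℤ):ℝ) * t)
  rw [← mul_sub, abs_mul, hx, abs_of_pos (a := (2:ℝ) ^ ((l - ⌊x⌋ : ℤ):ℝ)) (by positivity),
    ← Real.rpow_add (by norm_num)] at h1
  have hD := abs_nonneg ((if b then Real.cos ((2:ℝ) ^ ((l - ⌊x⌋ : ℤ):ℝ) * s) else Real.sin ((2:ℝ) ^ ((l - ⌊x⌋ : ℤ):ℝ) * s)) -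
      (if b then Real.cos ((2:ℝ) ^ ((l - ⌊x⌋ : ℤ):ℝ) * t) else Real.sin ((2:ℝ) ^ ((l - ⌊x⌋ : ℤ):ℝ) * t)))
  generalize |(if b then Real.cos ((2:ℝ) ^ ((l - ⌊x⌋ : ℤ):ℝ) * s) else Real.sin ((2:ℝ) ^ ((l - ⌊x⌋ : ℤ):ℝ) * s)) -
      (if b then Real.cos ((2:ℝ) ^ ((l - ⌊x⌋ : ℤ):ℝ) * t) else Real.sin ((2:ℝ) ^ ((l - ⌊x⌋ : ℤ):ℝ) * t))| = D at *
  generalize ⌊x⌋ = n at *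
  push_cast at *
  rcases le_or_gt 0 l with hl | hl
  · have hl' : (0:ℝ) ≤ l := by exact_mod_cast hl
    calc (2:ℝ) ^ (-((l - n) * r)) * D ^ q ≤ (2:ℝ) ^ (-((l - n) * r)) * 2 ^ q := by gcongr
      _ = (2:ℝ) ^ (-((l - n) * r) + q) := by rw [Real.rpow_add (by norm_num)]
      _ ≤ _ := by
        apply Real.rpow_le_rpow_of_exponent_le (by norm_num)
        rw [abs_of_nonneg hl']
        nlinarith
  · have hl' : (l:ℝ) + 1 ≤ 0 := by exact_mod_cast hl
    calc (2:ℝ) ^ (-((l - n) * r)) * D ^ q ≤ (2:ℝ) ^ (-((l - n) * r)) * (2 ^ (l - n + x)) ^ q := by gcongr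
      _ = (2:ℝ) ^ (-((l - n) * r) + (l - n + x) * q) := by
        rw [← Real.rpow_mul (by norm_num), ← Real.rpow_add (by norm_num)]
      _ ≤ _ := by
        apply Real.rpow_le_rpow_of_exponent_le (by norm_num)
        rw [abs_of_nonpos (by linarith)]
        have a1 : (l - n + x) * (q - r) ≤ (l + 1) * (q - r) := by
          apply mul_le_mul_of_nonneg_right <;> linarith
        have a2 : l * (q - r) ≤ l * δ := by
          apply mul_le_mul_of_nonpos_left <;> linarith
        nlinarith

lemma circ_lower {q r : ℝ} (hr : 1 ≤ r) (hq : r ≤ q) {s t : ℝ} (x : ℝ)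
    (hx : |s - t| = 2 ^ x) : ∃ j b, |s - t| ^ r ≤ 8 ^ q * |circ q r j b s - circ q r j b t| ^ q := by
  have f1 := Int.floor_le x
  have f2 := Int.lt_floor_add_one x
  have key : ∃ b : Bool, 1 / 8 ≤
      |(if b then Real.cos ((2:ℝ) ^ ((-1 - ⌊x⌋ : ℤ):ℝ) * s) else Real.sin ((2:ℝ) ^ ((-1 - ⌊x⌋ : ℤ):ℝ) * s)) -
      (if b then Real.cos ((2:ℝ) ^ ((-1 - ⌊x⌋ : ℤ):ℝ) * t) else Real.sin ((2:ℝ) ^ ((-1 - ⌊x⌋ : ℤ):ℝ) * t))| := by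
    have hd : |(2:ℝ) ^ ((-1 - ⌊x⌋ : ℤ):ℝ) * s - (2:ℝ) ^ ((-1 - ⌊x⌋ : ℤ):ℝ) * t| = 2 ^ (-1 - ⌊x⌋ + x) := by
      rw [← mul_sub, abs_mul, hx, abs_of_pos (by positivity), ← Real.rpow_add (by norm_num)]
      push_cast; rfl
    have hd1 : 1 / 2 ≤ |(2:ℝ) ^ ((-1 - ⌊x⌋ : ℤ):ℝ) * s - (2:ℝ) ^ ((-1 - ⌊x⌋ : ℤ):ℝ) * t| := by
      rw [hd]
      calc (1:ℝ)/2 = 2 ^ (-1:ℝ) := by rw [Real.rpow_neg_one]; norm_num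
        _ ≤ _ := Real.rpow_le_rpow_of_exponent_le (by norm_num) (by linarith)
    have hd2 : |(2:ℝ) ^ ((-1 - ⌊x⌋ : ℤ):ℝ) * s - (2:ℝ) ^ ((-1 - ⌊x⌋ : ℤ):ℝ) * t| ≤ 1 := by
      rw [hd]
      exact Real.rpow_le_one_of_one_le_of_nonpos (by norm_num) (by linarith)
    generalize (2:ℝ) ^ ((-1 - ⌊x⌋ : ℤ):ℝ) * s = u at *
    generalize (2:ℝ) ^ ((-1 - ⌊x⌋ : ℤ):ℝ) * t = v at *
    by_contra hcon
    push Not at hcon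
    have c1 := hcon true
    have c2 := hcon false
    simp only [if_true, Bool.false_eq_true, if_false] at c1 c2
    rw [abs_lt] at c1 c2
    have e1 : (Real.cos u - Real.cos v) ^ 2 < 1 / 64 := by nlinarith
    have e2 : (Real.sin u - Real.sin v) ^ 2 < 1 / 64 := by nlinarith
    have e3 : (Real.cos u - Real.cos v) ^ 2 + (Real.sin u - Real.sin v) ^ 2 = 2 - 2 * Real.cos |u - v| := by
      rw [Real.cos_abs, Real.cos_sub]
      nlinarith [Real.sin_sq_add_cos_sq u, Real.sin_sq_add_cos_sq v]
    have e4 := Real.cos_le_one_sub_mul_cos_sq (x := |u - v|) (by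
      rw [abs_abs]; linarith [Real.pi_gt_three])
    have e5 : 1 / 8 ≤ 2 / Real.pi ^ 2 := by
      have := Real.pi_pos
      have := Real.pi_lt_four
      rw [div_le_div_iff₀ (by norm_num) (by positivity)]
      nlinarith
    have e6 : 1 / 8 * (1 / 4) ≤ 2 / Real.pi ^ 2 * |u - v| ^ 2 := by
      apply mul_le_mul e5 (by nlinarith) (by norm_num) (by positivity)
    linarith
  obtain ⟨b, hb⟩ := key
  refine ⟨-1 - ⌊x⌋, b, ?_⟩
  rw [circ_cost (by linarith)]
  calc |s - t| ^ r = 2 ^ (x * r) := by rw [hx, ← Real.rpow_mul (by norm_num)]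
    _ ≤ (2:ℝ) ^ (-(((-1 - ⌊x⌋ : ℤ) : ℝ) * r)) := by
      apply Real.rpow_le_rpow_of_exponent_le (by norm_num)
      push_cast
      nlinarith
    _ = 8 ^ q * ((2:ℝ) ^ (-(((-1 - ⌊x⌋ : ℤ) : ℝ) * r)) * (1 / 8) ^ q) := by
      rw [mul_left_comm, ← Real.mul_rpow (by norm_num) (by norm_num)]
      norm_num
    _ ≤ _ := by gcongr; linarith

lemma circ_emb {q q' : ℝ} (hq' : 1 ≤ q') (hqq : q' < q) : ∃ C : ℝ≥0∞, C ≠ ⊤ ∧ ∀ r, 1 ≤ r → r ≤ q' →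
    ∀ s t : ℝ, cst r s t ≤ C * ∑' jb : ℤ × Bool, cst q (circ q r jb.1 jb.2 s) (circ q r jb.1 jb.2 t) ∧
      ∑' jb : ℤ × Bool, cst q (circ q r jb.1 jb.2 s) (circ q r jb.1 jb.2 t) ≤ C * cst r s t := by
  let δ := min 1 (q - q')
  have hδ0 : 0 < δ := lt_min one_pos (by linarith)
  have hδ1 : δ ≤ 1 := min_le_left _ _
  have hδ2 : δ ≤ q - q' := min_le_right _ _
  have hq0 : 0 < q := by linarith
  let S : ℝ≥0∞ := ∑' l : ℤ, ENNReal.ofReal (2 ^ (-(δ * |(l:ℝ)|)))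
  have hS : S ≠ ⊤ := by
    have hn : Summable fun n : ℕ => (2:ℝ) ^ (-(δ * (n:ℝ))) := by
      have : ∀ n : ℕ, (2:ℝ) ^ (-(δ * (n:ℝ))) = ((2:ℝ) ^ (-δ)) ^ n := fun n => by
        rw [← Real.rpow_natCast, ← Real.rpow_mul (by norm_num)]; ring_nf
      simp_rw [this]
      apply summable_geometric_of_lt_one (by positivity)
      exact Real.rpow_lt_one_of_one_lt_of_neg (by norm_num) (by linarith)
    have : Summable fun l : ℤ => (2:ℝ) ^ (-(δ * |(l:ℝ)|)) := by
      refine Summable.of_nat_of_neg ?_ ?_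
      · simpa using hn
      · simpa using hn
    exact this.tsum_ofReal_ne_top
  refine ⟨ENNReal.ofReal (8 ^ q) + 2 * (ENNReal.ofReal (2 ^ q) * S), ?_, ?_⟩
  · refine ENNReal.add_ne_top.2 ⟨ENNReal.ofReal_ne_top, ENNReal.mul_ne_top (by simp)
      (ENNReal.mul_ne_top ENNReal.ofReal_ne_top hS)⟩
  intro r hr hrq s t
  by_cases hst : s = t
  · subst hst
    rw [cst_self (by linarith)]
    simp [cst_self hq0]
  have hpos : 0 < |s - t| := abs_pos.2 (sub_ne_zero.2 hst)
  obtain ⟨x, hx⟩ : ∃ x : ℝ, |s - t| = 2 ^ x :=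
    ⟨Real.logb 2 |s - t|, (Real.rpow_logb (by norm_num) (by norm_num) hpos).symm⟩
  constructor
  · obtain ⟨j, b, h⟩ := circ_lower hr (by linarith : r ≤ q) x hx
    calc cst r s t ≤ ENNReal.ofReal (8 ^ q) * cst q (circ q r j b s) (circ q r j b t) := by
          rw [cst_eq_ofReal (by linarith), cst_eq_ofReal (by linarith), ← ENNReal.ofReal_mul (by positivity)]
          exact ENNReal.ofReal_le_ofReal h
      _ ≤ _ := by
        refine mul_le_mul' le_self_add ?_
        exact ENNReal.le_tsum (f := fun jb : ℤ × Bool =>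
          cst q (circ q r jb.1 jb.2 s) (circ q r jb.1 jb.2 t)) (j, b)
  · have hb : ∀ b, ∑' j : ℤ, cst q (circ q r j b s) (circ q r j b t) ≤
        ENNReal.ofReal (2 ^ q) * S * cst r s t := by
      intro b
      rw [← (Equiv.subRight ⌊x⌋).tsum_eq]
      calc _ ≤ ∑' l : ℤ, (ENNReal.ofReal (2 ^ q) * cst r s t) * ENNReal.ofReal (2 ^ (-(δ * |(l:ℝ)|))) := by
            refine ENNReal.tsum_le_tsum fun l => ?_
            rw [cst_eq_ofReal (by linarith), cst_eq_ofReal (by linarith), ← ENNReal.ofReal_mul (by positivity),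
              ← ENNReal.ofReal_mul (by positivity)]
            exact ENNReal.ofReal_le_ofReal (circ_upper hr hδ0 hδ1 (by linarith) x hx b l)
        _ = _ := by
          rw [ENNReal.tsum_mul_left]
          ring
    rw [ENNReal.tsum_prod (f := fun j b => cst q (circ q r j b s) (circ q r j b t)), ENNReal.tsum_comm,
      tsum_bool]
    calc _ ≤ _ := add_le_add (hb false) (hb true)
      _ = (2 * (ENNReal.ofReal (2 ^ q) * S)) * cst r s t := by ring
      _ ≤ _ := mul_le_mul' le_add_self le_rfl

lemma RR_upper {p q : ℝ} (hp : 1 ≤ p) (hpq : p < q) (m : ℕ → ℕ) (hm : ∀ k, 1 ≤ m k) (U : Set ℕ) :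
    BorelReducible (RR p m U) (lpRel q) := by
  classical
  let q' := (p + q) / 2
  obtain ⟨C, hC, hCC⟩ := circ_emb (q := q) (q' := q') (by simp only [q']; linarith) (by simp only [q']; linarith)
  have hpos : ∀ k, 0 < ex p k := fun k => by linarith [le_ex p k]
  have hm1 : ∀ k, (1:ℝ≥0∞) ≤ m k := fun k => by exact_mod_cast hm k
  -- per block coordinates
  obtain ⟨K, hK⟩ : ∃ K : ℕ, ∀ k, q' < ex p k → k ≠ 0 ∧ k < K := by
    obtain ⟨K, hK⟩ := exists_nat_gt (1 / (q' - p))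
    refine ⟨K, fun k hk => ?_⟩
    have hqp : 0 < q' - p := by simp only [q']; linarith
    have hk0 : k ≠ 0 := by
      rintro rfl
      rw [ex_zero] at hk; linarith
    refine ⟨hk0, ?_⟩
    have hk1 : (0:ℝ) < k := by exact_mod_cast Nat.pos_of_ne_zero hk0
    unfold ex at hk
    have : (k:ℝ) < K := by
      refine lt_trans ?_ hK
      rw [lt_div_iff₀ hqp]
      have : q' - p < 1 / k := by linarith
      rw [lt_div_iff₀ hk1] at this
      linarith
    exact_mod_cast this
  let C' : ℝ≥0∞ := C + ∑ k ∈ Finset.range K, (m k : ℝ≥0∞) ^ (p + q + 1)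
  have hC' : C' ≠ ⊤ := by
    refine ENNReal.add_ne_top.2 ⟨hC, ?_⟩
    refine ENNReal.sum_ne_top.2 fun k _ => ENNReal.rpow_ne_top_of_nonneg (by linarith) (by simp)
  have hΦ : ∀ k, ∃ Φ : ℤ × Bool → ℝ → ℝ, (∀ jb, Measurable (Φ jb)) ∧ ∀ u v,
      cst (ex p k) (gam m k u) (gam m k v) ≤ C' * ∑' jb, cst q (Φ jb (gam m k u)) (Φ jb (gam m k v)) ∧
      ∑' jb, cst q (Φ jb (gam m k u)) (Φ jb (gam m k v)) ≤ C' * cst (ex p k) (gam m k u) (gam m k v) := by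
    intro k
    by_cases hk : q' < ex p k
    · obtain ⟨hk0, hkK⟩ := hK k hk
      refine ⟨fun jb t => if jb = (0, true) then t else 0, fun jb => ?_, fun u v => ?_⟩
      · show Measurable fun t : ℝ => if jb = (0, true) then t else 0
        split_ifs
        · exact measurable_id
        · exact measurable_const
      · have hsum : ∑' jb : ℤ × Bool, cst q (if jb = (0, true) then (gam m k u) else 0)
            (if jb = (0, true) then (gam m k v) else 0) = cst q (gam m k u) (gam m k v) := by
          rw [tsum_eq_single (0, true)]
          · simp
          · intro jb hjb
            simp [hjb, cst_self (by linarith : 0 < q)]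
        rw [hsum]
        have hle : (m k : ℝ≥0∞) ^ (p + q + 1) ≤ C' := by
          refine le_trans ?_ le_add_self
          exact Finset.single_le_sum (f := fun k => (m k : ℝ≥0∞) ^ (p + q + 1)) (fun _ _ => zero_le)
            (Finset.mem_range.2 hkK)
        constructor
        · refine (cst_comp (hm1 k) (by simp) (hpos k) (by linarith) (by linarith : 0 < p + q + 1)
            (by linarith [le_ex p k]) (gam_edist m hk0 (hm k) _ _)).trans (mul_le_mul' hle le_rfl)
        · refine (cst_comp (hm1 k) (by simp) (by linarith) (hpos k) (by linarith : 0 < p + q + 1)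
            (by linarith [ex_le p k]) (gam_edist m hk0 (hm k) _ _)).trans (mul_le_mul' hle le_rfl)
    · push Not at hk
      refine ⟨fun jb => circ q (ex p k) jb.1 jb.2, fun jb => circ_measurable _ _ _ _, fun u v => ?_⟩
      obtain ⟨h1, h2⟩ := hCC (ex p k) (hp.trans (le_ex p k)) hk (gam m k u) (gam m k v)
      exact ⟨h1.trans (mul_le_mul' le_self_add le_rfl), h2.trans (mul_le_mul' le_self_add le_rfl)⟩
  choose Φ hΦm hΦ using hΦ
  obtain ⟨e⟩ : Nonempty (ℕ ≃ (ℕ × ℕ) × (ℤ × Bool)) := inferInstance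
  refine ⟨fun x n => Φ (e n).1.1 (e n).2 (TU m U x (e n).1), ?_, fun x y => ?_⟩
  · refine measurable_pi_lambda _ fun n => ?_
    have : Measurable fun x => TU m U x (e n).1 :=
      (measurable_pi_apply (e n).1).comp (TU_measurable m U)
    exact (hΦm _ _).comp this
  · rw [lpRel_iff (by linarith), e.tsum_eq (fun w : (ℕ × ℕ) × (ℤ × Bool) =>
      cst q (Φ w.1.1 w.2 (TU m U x w.1)) (Φ w.1.1 w.2 (TU m U y w.1))),
      ENNReal.tsum_prod (f := fun (w : ℕ × ℕ) (w' : ℤ × Bool) =>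
      cst q (Φ w.1 w' (TU m U x w)) (Φ w.1 w' (TU m U y w)))]
    constructor
    · refine ne_top_comp hC' fun ki => ?_
      obtain ⟨u, hu⟩ := TU_eq_gam m U x ki
      obtain ⟨v, hv⟩ := TU_eq_gam m U y ki
      rw [hu, hv]
      exact (hΦ ki.1 u v).2
    · refine ne_top_comp hC' fun ki => ?_
      obtain ⟨u, hu⟩ := TU_eq_gam m U x ki
      obtain ⟨v, hv⟩ := TU_eq_gam m U y ki
      rw [hu, hv]
      exact (hΦ ki.1 u v).1


lemma num_step {p : ℝ} (hp : 1 ≤ p) (k : ℕ) (hk : 1 ≤ k) (a : ℕ) : ∃ M N : ℕ, a ≤ M ∧ 1 ≤ M ∧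
    (a : ℝ) ^ (p + 1) ≤ N ∧ 2 ^ k * (M : ℝ) ^ ex p (k + 1) ≤ N ∧ N * 2 ^ k ≤ (M : ℝ) ^ ex p k := by
  have hpos : 0 < ex p k - ex p (k + 1) := by linarith [ex_lt p hk]
  have ht := (tendsto_rpow_atTop hpos).comp (tendsto_natCast_atTop_atTop (R := ℝ))
  obtain ⟨M, hM, hMa⟩ := ((ht.eventually_ge_atTop (((a : ℝ) ^ (p + 1) + 1 + 2 ^ k) * 2 ^ k)).and
    (eventually_ge_atTop (max a 1))).exists
  have h1 : 1 ≤ M := (le_max_right _ _).trans hMa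
  have h1' : (1:ℝ) ≤ M := by exact_mod_cast h1
  have ha0 : (0:ℝ) ≤ (a : ℝ) ^ (p + 1) := by positivity
  have hm0 : (0:ℝ) ≤ 2 ^ k * (M : ℝ) ^ ex p (k + 1) := by positivity
  have hle := Nat.le_ceil ((a : ℝ) ^ (p + 1) + 2 ^ k * (M : ℝ) ^ ex p (k + 1))
  have hlt := Nat.ceil_lt_add_one (add_nonneg ha0 hm0)
  refine ⟨M, ⌈(a : ℝ) ^ (p + 1) + 2 ^ k * (M : ℝ) ^ ex p (k + 1)⌉₊, (le_max_left _ _).trans hMa, h1,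
    by linarith, by linarith, ?_⟩
  have hx : (1:ℝ) ≤ (M : ℝ) ^ ex p (k + 1) := Real.one_le_rpow h1' (by linarith [le_ex p (k+1)])
  have e : (M : ℝ) ^ ex p k = (M : ℝ) ^ (ex p k - ex p (k + 1)) * (M : ℝ) ^ ex p (k + 1) := by
    rw [← Real.rpow_add (by linarith)]; ring_nf
  rw [e]
  simp only [Function.comp] at hM
  have hx0 : 0 ≤ (M : ℝ) ^ ex p (k + 1) := by linarith
  calc _ ≤ ((a : ℝ) ^ (p + 1) + 2 ^ k * (M : ℝ) ^ ex p (k + 1) + 1) * 2 ^ k := by gcongr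
    _ ≤ ((((a : ℝ) ^ (p + 1) + 1 + 2 ^ k)) * 2 ^ k) * (M : ℝ) ^ ex p (k + 1) := by
      have h2 : (0:ℝ) ≤ 2 ^ k := by positivity
      have : (a : ℝ) ^ (p + 1) + 2 ^ k * (M : ℝ) ^ ex p (k + 1) + 1 ≤
          ((a : ℝ) ^ (p + 1) + 1 + 2 ^ k) * (M : ℝ) ^ ex p (k + 1) := by nlinarith
      calc _ ≤ (((a : ℝ) ^ (p + 1) + 1 + 2 ^ k) * (M : ℝ) ^ ex p (k + 1)) * 2 ^ k := by gcongr
        _ = _ := by ring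
    _ ≤ _ := by gcongr

lemma nat_rpow_ofReal {M : ℕ} (hM : 1 ≤ M) (r : ℝ) : (M : ℝ≥0∞) ^ r = ENNReal.ofReal ((M : ℝ) ^ r) := by
  rw [← ENNReal.ofReal_rpow_of_pos (by exact_mod_cast hM), ENNReal.ofReal_natCast]

lemma num_seq {p : ℝ} (hp : 1 ≤ p) : ∃ m : ℕ → ℕ, Monotone m ∧ (∀ k, 1 ≤ m k) ∧
    ∀ k, 1 ≤ k → ∃ N : ℕ, 1 ≤ N * (m (k - 1) : ℝ≥0∞) ^ (-(p + 1)) ∧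
      1 ≤ N * (2⁻¹ ^ k * (m k : ℝ≥0∞) ^ (-ex p (k + 1))) ∧
      N * (m k : ℝ≥0∞) ^ (-ex p k) ≤ 2⁻¹ ^ k := by
  choose! M N h1 h2 h3 h4 h5 using fun k (hk : 1 ≤ k) a => num_step hp k hk a
  let m : ℕ → ℕ := fun k => Nat.rec 1 (fun k a => M (k + 1) a) k
  have hm : ∀ k, m (k + 1) = M (k + 1) (m k) := fun k => rfl
  have hm1 : ∀ k, 1 ≤ m k := by
    intro k
    cases k with
    | zero => exact le_rfl
    | succ k => rw [hm]; exact h2 _ (by omega) _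
  clear_value m
  refine ⟨m, monotone_nat_of_le_succ fun k => by rw [hm]; exact h1 _ (by omega) _, hm1, ?_⟩
  intro k hk
  obtain ⟨k, rfl⟩ : ∃ l, k = l + 1 := ⟨k - 1, by omega⟩
  refine ⟨N (k + 1) (m k), ?_⟩
  have a3 := h3 (k + 1) hk (m k)
  have a4 := h4 (k + 1) hk (m k)
  have a5 := h5 (k + 1) hk (m k)
  rw [← hm] at a4 a5
  generalize N (k + 1) (m k) = n at *
  have e2 : (2⁻¹ : ℝ≥0∞) ^ (k + 1) = ENNReal.ofReal ((2 ^ (k + 1))⁻¹) := by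
    rw [ENNReal.ofReal_inv_of_pos (by positivity), ENNReal.ofReal_pow (by norm_num), ENNReal.inv_pow]
    simp
  have en : (n : ℝ≥0∞) = ENNReal.ofReal n := (ENNReal.ofReal_natCast n).symm
  have p1 : (0:ℝ) < (m k : ℝ) := Nat.cast_pos.2 (hm1 k)
  have p2 : (0:ℝ) < (m (k + 1) : ℝ) := Nat.cast_pos.2 (hm1 (k + 1))
  simp only [Nat.add_sub_cancel]
  rw [e2, en, nat_rpow_ofReal (hm1 _), nat_rpow_ofReal (hm1 _), nat_rpow_ofReal (hm1 _),
    ← ENNReal.ofReal_mul (by positivity), ← ENNReal.ofReal_mul (by positivity),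
    ← ENNReal.ofReal_mul (by positivity), ← ENNReal.ofReal_mul (by positivity),
    ENNReal.one_le_ofReal, ENNReal.one_le_ofReal, Real.rpow_neg p1.le, Real.rpow_neg p2.le,
    Real.rpow_neg p2.le]
  refine ⟨?_, ?_, ENNReal.ofReal_le_ofReal ?_⟩
  · rw [← div_eq_mul_inv, one_le_div (by positivity)]; exact a3
  · rw [← mul_inv, ← div_eq_mul_inv, one_le_div (by positivity)]; exact a4
  · rw [← div_eq_mul_inv, div_le_iff₀ (by positivity), ← div_eq_inv_mul, le_div_iff₀ (by positivity)]
    exact a5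

/-- embedding of the grid group -/
noncomputable def emb (m τ : ℕ → ℕ) (s : ∀ i, ℕ → Fin (m (τ i) + 1)) (kn : ℕ × ℕ) : ℝ :=
  if kn.1 = τ kn.2.unpair.1 then ((s kn.2.unpair.1 kn.2.unpair.2 : ℕ) : ℝ) else 0

lemma emb_measurable (m τ : ℕ → ℕ) : Measurable (emb m τ) := by
  refine measurable_pi_lambda _ fun kn => ?_
  unfold emb
  split_ifs
  · have h1 : Measurable fun s : (∀ i, ℕ → Fin (m (τ i) + 1)) => s kn.2.unpair.1 kn.2.unpair.2 :=
      (measurable_pi_apply _).comp (measurable_pi_apply _)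
    have h2 : Measurable fun g : Fin (m (τ kn.2.unpair.1) + 1) => ((g : ℕ) : ℝ) := measurable_of_finite _
    exact h2.comp h1
  · exact measurable_const

lemma DD_emb {p : ℝ} (hp : 1 ≤ p) (m τ : ℕ → ℕ) {U : Set ℕ} (hτU : ∀ i, τ i ∈ U) (hτ0 : ∀ i, τ i ≠ 0)
    (s s' : ∀ i, ℕ → Fin (m (τ i) + 1)) :
    DD p (TU m U (emb m τ s)) (TU m U (emb m τ s')) = ∑' i, ∑' n,
      cst (ex p (τ i)) (((s i n : ℕ) : ℝ) / m (τ i)) (((s' i n : ℕ) : ℝ) / m (τ i)) := by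
  have hpos : ∀ k, 0 < ex p k := fun k => by linarith [le_ex p k]
  unfold DD
  rw [ENNReal.tsum_prod (f := fun k n => cst (ex p k) (TU m U (emb m τ s) (k, n))
    (TU m U (emb m τ s') (k, n))), ENNReal.tsum_comm,
    ← ENNReal.tsum_prod (f := fun i n => cst (ex p (τ i)) (((s i n : ℕ) : ℝ) / m (τ i))
      (((s' i n : ℕ) : ℝ) / m (τ i))), ← Nat.pairEquiv.symm.tsum_eq]
  refine tsum_congr fun n => ?_
  have e : Nat.pairEquiv.symm n = n.unpair := rfl
  rw [e, tsum_eq_single (τ n.unpair.1)]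
  · simp only [TU, emb, hτU, if_true]
    rw [gam_nat m (hτ0 _) (by omega), gam_nat m (hτ0 _) (by omega)]
  · intro k hk
    simp only [TU, emb, hk, if_false]
    exact cst_self (hpos _) _

theorem RR_inf {p : ℝ} (hp : 1 ≤ p) (m : ℕ → ℕ) (hmono : Monotone m) (hm : ∀ k, 1 ≤ m k)
    (hN : ∀ k, 1 ≤ k → ∃ N : ℕ, 1 ≤ N * (m (k - 1) : ℝ≥0∞) ^ (-(p + 1)) ∧
      1 ≤ N * (2⁻¹ ^ k * (m k : ℝ≥0∞) ^ (-ex p (k + 1))) ∧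
      N * (m k : ℝ≥0∞) ^ (-ex p k) ≤ 2⁻¹ ^ k) {U V : Set ℕ} (hV : 0 ∈ V)
    (h : BorelReducible (RR p m U) (RR p m V)) : (U \ V).Finite := by
  classical
  by_contra hW
  replace hW : (U \ V).Infinite := hW
  obtain ⟨θ, hθ, hred⟩ := h
  obtain ⟨w0, hw0⟩ := hW.nonempty
  let τ : ℕ → ℕ := fun n => if n.unpair.1 ∈ U \ V then n.unpair.1 else w0
  have hτW : ∀ i, τ i ∈ U \ V := fun i => by
    by_cases h : i.unpair.1 ∈ U \ V
    · simp only [τ, h, if_true]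
    · simp only [τ, h, if_false]; exact hw0
  have hτ0 : ∀ i, τ i ≠ 0 := fun i h => (hτW i).2 (h ▸ hV)
  have hτinf : ∀ k ∈ U \ V, {i | τ i = k}.Infinite := by
    intro k hk
    refine Set.infinite_of_injective_forall_mem (f := fun n => Nat.pair k n) (fun a b hab => ?_) fun n => ?_
    · exact (Nat.pair_eq_pair.1 hab).2
    · show τ _ = k
      simp only [τ, Nat.unpair_pair]
      rw [if_pos hk]
  clear_value τ
  have h1 : ∀ k, 1 ≤ ex p k := fun k => hp.trans (le_ex p k)
  have hpos : ∀ k, 0 < ex p k := fun k => by linarith [le_ex p k]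
  let f : (∀ i, ℕ → Fin (m (τ i) + 1)) → ℕ → ℝ := fun s j => TU m V (θ (emb m τ s)) j.unpair
  let r : ℕ → ℝ := fun j => ex p j.unpair.1
  have hfm : Measurable f := by
    refine measurable_pi_lambda _ fun j => ?_
    exact (measurable_pi_apply j.unpair).comp ((TU_measurable m V).comp (hθ.comp (emb_measurable m τ)))
  have hf : ∀ s s', ∑' j, cst (r j) (f s j) (f s' j) ≠ ⊤ ↔ ∑' i, ∑' n,
      cst (ex p (τ i)) (((s i n : ℕ) : ℝ) / m (τ i)) (((s' i n : ℕ) : ℝ) / m (τ i)) ≠ ⊤ := by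
    intro s s'
    rw [← DD_emb hp m τ (fun i => (hτW i).1) hτ0 s s']
    have e : ∑' j, cst (r j) (f s j) (f s' j) =
        DD p (TU m V (θ (emb m τ s))) (TU m V (θ (emb m τ s'))) := by
      unfold DD
      rw [← Nat.pairEquiv.symm.tsum_eq]
      rfl
    rw [e]
    exact (hred _ _).symm
  obtain ⟨b, z, K, hK, ha, hb⟩ := fusion (G := fun i => Fin (m (τ i) + 1)) (fun j => cst (r j))
    (fun j => cst_continuous _) (fun j a => cst_self (hpos _) a) f hfm (by
      intro x L h hh h' hh'
      rw [hf]
      rw [tsum_eq_sum (s := Finset.range L)]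
      · refine ENNReal.sum_ne_top.2 fun i _ => ?_
        rw [tsum_eq_sum (s := Finset.range L)]
        · exact ENNReal.sum_ne_top.2 fun n _ => cst_ne_top (hpos _).le _ _
        · intro n hn
          rw [Finset.mem_range] at hn
          have e1 := hh i n (fun hc => hn hc.2)
          have e2 := hh' i n (fun hc => hn hc.2)
          simp only [Pi.add_apply, e1, e2]
          exact cst_self (hpos _) _
      · intro i hi
        rw [Finset.mem_range] at hi
        refine ENNReal.tsum_eq_zero.2 fun n => ?_
        have e1 := hh i n (fun hc => hi hc.1)
        have e2 := hh' i n (fun hc => hi hc.1)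
        simp only [Pi.add_apply, e1, e2]
        exact cst_self (hpos _) _)
  refine contra m hm τ (U \ V) hW hτinf (ex p) (fun k => ex p (k + 1)) h1
    (fun k => (m (k - 1) : ℝ≥0∞) ^ (-(p + 1))) (fun k hk => ?_) r (p + 1) (fun j => h1 _)
    (fun j => ex_le p _) (fun v => f fun i n => if n = b i then v i else z i n) K hK ha hb ?_ ?_
  · refine hN k ?_
    rcases Nat.eq_zero_or_pos k with h | h
    · exact absurd hV (h ▸ hk.2)
    · exact h
  · intro v v'
    rw [hf]
    refine iff_of_eq (congrArg (fun t => t ≠ ⊤) (tsum_congr fun i => ?_))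
    rw [tsum_eq_single (b i)]
    · simp
    · intro n hn
      simp only [hn, if_false]
      exact cst_self (hpos _) _
  · intro k hk j
    by_cases hj0 : j.unpair.1 = 0
    · left
      simp only [r, hj0, ex_zero]
      exact le_ex p _
    rcases lt_trichotomy j.unpair.1 k with hlt | heq | hgt
    · right
      intro v v'
      obtain ⟨u, hu⟩ := TU_eq_gam m V (θ (emb m τ fun i n => if n = b i then v i else z i n)) j.unpair
      obtain ⟨w, hw⟩ := TU_eq_gam m V (θ (emb m τ fun i n => if n = b i then v' i else z i n)) j.unpair
      simp only [f, r]
      rw [hu, hw]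
      rcases gam_edist m hj0 (hm _) u w with h | ⟨h, -⟩
      · left; simp [cst, h, hpos]
      · right
        unfold cst
        refine le_trans ?_ (ENNReal.rpow_le_rpow h (hpos _).le)
        rw [ENNReal.inv_rpow, ENNReal.rpow_neg, ENNReal.inv_le_inv]
        have hmm : (m j.unpair.1 : ℝ≥0∞) ≤ m (k - 1) := by
          exact_mod_cast hmono (by omega)
        have h1m : (1:ℝ≥0∞) ≤ m j.unpair.1 := by exact_mod_cast hm _
        calc _ ≤ (m j.unpair.1 : ℝ≥0∞) ^ (p + 1) := ENNReal.rpow_le_rpow_of_exponent_le h1m (ex_le p _)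
          _ ≤ _ := ENNReal.rpow_le_rpow hmm (by linarith)
    · right
      intro v v'
      left
      have : j.unpair.1 ∉ V := heq ▸ hk.2
      simp only [f, r, TU, this, if_false]
      exact cst_self (hpos _) _
    · left
      exact ex_anti p (by omega) hgt



end Main

theorem stmt16 : ∀ p : ℝ, 1 ≤ p →
    ∃ E : Set ℕ → ((ℕ → Icc (0:ℝ) 1) → (ℕ → Icc (0:ℝ) 1) → Prop),
      (∀ U : Set ℕ, Equivalence (E U) ∧
        MeasurableSet {z : (ℕ → Icc (0:ℝ) 1) × (ℕ → Icc (0:ℝ) 1) | E U z.1 z.2}) ∧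
      (∀ q : ℝ, p < q → ∀ U : Set ℕ,
        BorelReducible (lpRel p) (E U) ∧ BorelReducible (E U) (lpRel q)) ∧
      (∀ U V : Set ℕ, (U \ V).Finite ↔ BorelReducible (E U) (E V)) := by
  intro p hp
  obtain ⟨m, hmono, hm, hN⟩ := num_seq hp
  have hunc1 : ¬ Countable (ℕ → Icc (0:ℝ) 1) := by
    intro h
    have : Function.Injective fun a : Icc (0:ℝ) 1 => (fun _ : ℕ => a) := fun a b hab => congrFun hab 0
    have hc : Countable (Icc (0:ℝ) 1) := this.countable
    exact (Cardinal.Real.Icc_countable_iff.not.2 (by norm_num : ¬ ((1:ℝ) ≤ 0))) (Set.countable_coe_iff.1 hc)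
  have hunc2 : ¬ Countable (ℕ × ℕ → ℝ) := by
    intro h
    have : Function.Injective fun a : ℝ => (fun _ : ℕ × ℕ => a) := fun a b hab => congrFun hab (0, 0)
    have hc : Countable ℝ := this.countable
    exact not_countable hc
  let φ : (ℕ → Icc (0:ℝ) 1) ≃ᵐ (ℕ × ℕ → ℝ) := PolishSpace.measurableEquivOfNotCountable hunc1 hunc2
  let U' : Set ℕ → Set ℕ := fun U => {k | k = 0 ∨ (1 ≤ k ∧ k - 1 ∈ U)}
  have h0 : ∀ U, 0 ∈ U' U := fun U => Or.inl rfl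
  have hfin : ∀ U V, (U' U \ U' V).Finite ↔ (U \ V).Finite := by
    intro U V
    have : U' U \ U' V = Nat.succ '' (U \ V) := by
      ext k
      cases k with
      | zero => simp [U']
      | succ k => simp [U']
    rw [this]
    exact Set.finite_image_iff Nat.succ_injective.injOn
  have hto : ∀ U V, BorelReducible (fun x y => RR p m (U' U) (φ x) (φ y))
      (fun x y => RR p m (U' V) (φ x) (φ y)) ↔ BorelReducible (RR p m (U' U)) (RR p m (U' V)) := by
    intro U V
    constructor
    · rintro ⟨θ, hθ, h⟩
      refine ⟨fun x => φ (θ (φ.symm x)), φ.measurable.comp (hθ.comp φ.symm.measurable), fun x y => ?_⟩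
      have := h (φ.symm x) (φ.symm y)
      simpa using this
    · rintro ⟨θ, hθ, h⟩
      refine ⟨fun x => φ.symm (θ (φ x)), φ.symm.measurable.comp (hθ.comp φ.measurable), fun x y => ?_⟩
      simp [h]
  refine ⟨fun U x y => RR p m (U' U) (φ x) (φ y), fun U => ⟨?_, ?_⟩, fun q hq U => ⟨?_, ?_⟩, fun U V => ?_⟩
  · have he := RR_equiv hp m (U' U)
    exact ⟨fun x => he.refl _, fun h => he.symm h, fun h h' => he.trans h h'⟩
  · exact (RR_meas p m (U' U)).preimage (f := fun z : (ℕ → Icc (0:ℝ) 1) × (ℕ → Icc (0:ℝ) 1) => (φ z.1, φ z.2))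
      ((φ.measurable.comp measurable_fst).prodMk (φ.measurable.comp measurable_snd))
  · obtain ⟨θ, hθ, h⟩ := RR_lower hp m (h0 U)
    refine ⟨fun x => φ.symm (θ x), φ.symm.measurable.comp hθ, fun x y => ?_⟩
    simp [h]
  · obtain ⟨θ, hθ, h⟩ := RR_upper hp hq m hm (U' U)
    exact ⟨fun x => θ (φ x), hθ.comp φ.measurable, fun x y => h _ _⟩
  · rw [hto, ← hfin]
    exact ⟨fun h => RR_fin hp m hm (h0 U) (h0 V) h, fun h => RR_inf hp m hmono hm hN (h0 V) h⟩
end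

section
/- For all p, q with 1 ≤ p < q < ∞ there exists a family (E_ξ)_{ξ∈{0,1}^ω} of Borel equivalence relations on [0,1]^ω such that ℝ^ω/ℓ_p ≤_B E_ξ ≤_B ℝ^ω/ℓ_q for every ξ ∈ {0,1}^ω, and for all distinct ξ, ζ ∈ {0,1}^ω the relations E_ξ and E_ζ are Borel incomparable: neither E_ξ ≤_B E_ζ nor E_ζ ≤_B E_ξ. -/
open Set

namespace S17
open Filter Topology ENNReal

lemma open_prefix {U : Set (ℕ → ℤ)} (hU : IsOpen U) {x : ℕ → ℤ} (hx : x ∈ U) :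
    ∃ N, ∀ y : ℕ → ℤ, (∀ m < N, y m = x m) → y ∈ U := by
  obtain ⟨v, ⟨z, n, rfl⟩, hxv, hv⟩ :=
    (PiNat.isTopologicalBasis_cylinders (fun _ : ℕ => ℤ)).exists_subset_of_mem_open hx hU
  refine ⟨n, fun y hy => hv ?_⟩
  rw [PiNat.mem_cylinder_iff] at hxv ⊢
  intro i hi
  rw [hy i hi, hxv i hi]

lemma generic {ι : Type*} [Countable ι] (Q : ι → Set (ℕ → ℤ)) (hQ : ∀ i, MeasurableSet (Q i)) :
    ∃ (O : ℕ → Set (ℕ → ℤ)) (x0 : ℕ → ℤ), (∀ n, IsOpen (O n)) ∧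
      (∀ (g : ℕ →₀ ℤ) n, x0 + ⇑g ∈ O n) ∧
      ∀ i x, (∀ n, x ∈ O n) → x ∈ Q i →
        ∃ N, ∀ y : ℕ → ℤ, (∀ n, y ∈ O n) → (∀ m < N, y m = x m) → y ∈ Q i := by
  choose U hUo hU using fun i => (hQ i).residualEq_isOpen
  have h1 : ∀ᶠ x in residual (ℕ → ℤ), ∀ i, (x ∈ Q i ↔ x ∈ U i) := by
    rw [eventually_countable_forall]
    intro i
    exact (hU i).mem_iff
  obtain ⟨t, hts, htG, htd⟩ := mem_residual.1 h1
  obtain ⟨O, hO, rfl⟩ := isGδ_iff_eq_iInter_nat.1 htG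
  have htr : (⋂ n, O n) ∈ residual (ℕ → ℤ) := residual_of_dense_Gδ htG htd
  have h2 : ∀ᶠ x in residual (ℕ → ℤ), ∀ g : ℕ →₀ ℤ, x + ⇑g ∈ ⋂ n, O n := by
    rw [eventually_countable_forall]
    intro g
    exact tendsto_residual_of_isOpenMap (Homeomorph.addRight (⇑g)).continuous
      (Homeomorph.addRight (⇑g : ℕ → ℤ)).isOpenMap htr
  obtain ⟨x0, hx0⟩ := (dense_of_mem_residual h2).nonempty
  refine ⟨O, x0, hO, fun g n => mem_iInter.1 (hx0 g) n, ?_⟩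
  intro i x hx hxQ
  obtain ⟨N, hN⟩ := open_prefix (hUo i) ((hts (mem_iInter.2 hx) i).1 hxQ)
  exact ⟨N, fun y hy hyx => (hts (mem_iInter.2 hy) i).2 (hN y hyx)⟩

/-- box of finitely supported integer vectors -/
noncomputable def box (M : ℕ → ℕ) (n : ℕ) : Set (ℕ →₀ ℤ) :=
  {g | (∀ i, 0 ≤ g i ∧ g i ≤ M i) ∧ ∀ i, n ≤ i → g i = 0}

lemma box_finite (M : ℕ → ℕ) (n : ℕ) : (box M n).Finite := by
  let m : ℕ →₀ ℤ := Finsupp.onFinset (Finset.range n) (fun i => if i < n then (M i : ℤ) else 0)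
    (by intro a ha; by_contra h; simp at h; simp [h] at ha)
  apply (Set.finite_Icc (0 : ℕ →₀ ℤ) m).subset
  rintro g ⟨hg, hg'⟩
  refine ⟨fun i => (hg i).1, fun i => ?_⟩
  simp only [m, Finsupp.onFinset_apply]
  split_ifs with h
  · exact (hg i).2
  · rw [hg' i (by omega)]

lemma exists_uniform {α : Type*} {S : Set α} (hS : S.Finite) (P : α → ℕ → Prop)
    (hmono : ∀ a n m, n ≤ m → P a n → P a m) (h : ∀ a ∈ S, ∃ n, P a n) :
    ∃ n, ∀ a ∈ S, P a n := by
  have : ∀ a ∈ S, ∀ᶠ n in atTop, P a n := fun a ha => by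
    obtain ⟨n, hn⟩ := h a ha
    exact eventually_atTop.2 ⟨n, fun m hm => hmono a n m hm hn⟩
  exact ((eventually_all_finite hS).2 this).exists

lemma control (D : ℕ → ℤ → ℤ → ℝ≥0∞) (θ : (ℕ → ℤ) → (ℕ → ℤ)) (hθ : Measurable θ)
    (h : ∀ x y : ℕ → ℤ, (∃ n, ∀ i ≥ n, x i = y i) → ∑' i, D i (θ x i) (θ y i) ≠ ⊤)
    (M : ℕ → ℕ) :
    ∃ (x0 : ℕ → ℤ) (C : Set (ℕ → ℤ)) (l Φ : ℕ → ℕ), Monotone l ∧ (∀ n, n ≤ l n) ∧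
      (∀ g : ℕ →₀ ℤ, x0 + ⇑g ∈ C) ∧
      (∀ n, ∀ r ∈ box M n, ∀ x ∈ C, (∀ i < Φ n, x i = (x0 + ⇑r) i) →
        ∑' i, D (i + l n) (θ x (i + l n)) (θ (x - ⇑r) (i + l n)) ≤ (2 : ℝ≥0∞)⁻¹ ^ n) ∧
      (∀ n, ∀ r ∈ box M n, ∀ x ∈ C, (∀ i < Φ n, x i = (x0 + ⇑r) i) →
        ∀ i < l n, θ x i = θ (x0 + ⇑r) i) ∧
      (∀ x, (∀ m, ∃ n ≥ m, ∃ r ∈ box M n, ∀ i < Φ n, x i = (x0 + ⇑r) i) → x ∈ C) := by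
  let Q : ((ℕ →₀ ℤ) × ℕ × ℕ) ⊕ (ℕ × ℤ) → Set (ℕ → ℤ) := Sum.elim
    (fun s => {x | ∑' i, D (i + s.2.1) (θ x (i + s.2.1)) (θ (x - ⇑s.1) (i + s.2.1))
      ≤ (2 : ℝ≥0∞)⁻¹ ^ s.2.2})
    (fun s => {x | θ x s.1 = s.2})
  have hQ : ∀ s, MeasurableSet (Q s) := by
    rintro (⟨g, l, j⟩ | ⟨i, a⟩)
    · refine measurableSet_le (Measurable.tsum fun i => ?_) measurable_const
      have hD : Measurable (fun ab : ℤ × ℤ => D (i + l) ab.1 ab.2) := measurable_of_countable _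
      refine hD.comp (Measurable.prodMk ?_ ?_)
      · exact (measurable_pi_apply _).comp hθ
      · exact (measurable_pi_apply _).comp (hθ.comp (measurable_id.sub_const _))
    · exact ((measurable_pi_apply i).comp hθ) (measurableSet_singleton a)
  obtain ⟨O, x0, hO, hx0, hgen⟩ := generic Q hQ
  have hl : ∀ n, ∃ l, ∀ r ∈ box M n,
      ∑' i, D (i + l) (θ (x0 + ⇑r) (i + l)) (θ (x0 + ⇑r - ⇑r) (i + l)) ≤ (2 : ℝ≥0∞)⁻¹ ^ n := by
    intro n
    have : ∀ r ∈ box M n, ∀ᶠ l in atTop,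
        ∑' i, D (i + l) (θ (x0 + ⇑r) (i + l)) (θ (x0 + ⇑r - ⇑r) (i + l)) ≤ (2 : ℝ≥0∞)⁻¹ ^ n := by
      intro r hr
      have hfin := h (x0 + ⇑r) (x0 + ⇑r - ⇑r) ⟨n, fun i hi => by simp [hr.2 i hi]⟩
      have := ENNReal.tendsto_sum_nat_add _ hfin
      refine this.eventually_le_const ?_
      exact ENNReal.pow_pos (by simp) n
    exact ((eventually_all_finite (box_finite M n)).2 this).exists
  choose l0 hl0 using hl
  let l : ℕ → ℕ := fun n => ∑ m ∈ Finset.range (n + 1), (l0 m + 1)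
  have hlmono : Monotone l := by
    intro a b hab
    exact Finset.sum_le_sum_of_subset (by simpa using hab)
  have hln : ∀ n, n ≤ l n := by
    intro n
    calc n ≤ ∑ m ∈ Finset.range (n + 1), 1 := by simp
      _ ≤ _ := Finset.sum_le_sum fun i _ => by omega
  have hl0l : ∀ n, l0 n ≤ l n := by
    intro n
    calc l0 n ≤ l0 n + 1 := by omega
      _ ≤ _ := Finset.single_le_sum (f := fun m => l0 m + 1) (fun _ _ => by omega) (by simp)
  have hl : ∀ n, ∀ r ∈ box M n,
      ∑' i, D (i + l n) (θ (x0 + ⇑r) (i + l n)) (θ (x0 + ⇑r - ⇑r) (i + l n))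
        ≤ (2 : ℝ≥0∞)⁻¹ ^ n := by
    intro n r hr
    refine le_trans ?_ (hl0 n r hr)
    obtain ⟨d, hd⟩ := Nat.exists_eq_add_of_le (hl0l n)
    have := ENNReal.tsum_comp_le_tsum_of_injective (f := fun i => i + d)
      (add_left_injective d)
      (fun i => D (i + l0 n) (θ (x0 + ⇑r) (i + l0 n)) (θ (x0 + ⇑r - ⇑r) (i + l0 n)))
    refine le_trans (le_of_eq ?_) this
    refine tsum_congr fun i => ?_
    have e : i + l n = i + d + l0 n := by omega
    rw [e]
  have hΦ : ∀ n, ∃ N, ∀ r ∈ box M n,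
      ((∀ x, (∀ k, x ∈ O k) → (∀ i < N, x i = (x0 + ⇑r) i) →
        ∑' i, D (i + l n) (θ x (i + l n)) (θ (x - ⇑r) (i + l n)) ≤ (2 : ℝ≥0∞)⁻¹ ^ n) ∧
      (∀ x, (∀ k, x ∈ O k) → (∀ i < N, x i = (x0 + ⇑r) i) →
        ∀ i < l n, θ x i = θ (x0 + ⇑r) i)) ∧
      (∀ x, (∀ i < N, x i = (x0 + ⇑r) i) → ∀ k ≤ n, x ∈ O k) := by
    intro n
    refine exists_uniform (box_finite M n) _ ?_ ?_
    · rintro r a b hab ⟨⟨h1, h2⟩, h3⟩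
      exact ⟨⟨fun x hx hx' => h1 x hx fun i hi => hx' i (by omega),
        fun x hx hx' => h2 x hx fun i hi => hx' i (by omega)⟩,
        fun x hx' => h3 x fun i hi => hx' i (by omega)⟩
    · intro r hr
      obtain ⟨N1, hN1⟩ := hgen (Sum.inl (r, l n, n)) (x0 + ⇑r) (hx0 r) (hl n r hr)
      have h2 : ∀ i ∈ Set.Iio (l n), ∃ N, ∀ y : ℕ → ℤ, (∀ k, y ∈ O k) →
          (∀ m < N, y m = (x0 + ⇑r) m) → θ y i = θ (x0 + ⇑r) i := fun i _ =>
        hgen (Sum.inr (i, θ (x0 + ⇑r) i)) (x0 + ⇑r) (hx0 r) rfl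
      obtain ⟨N2, hN2⟩ := exists_uniform (Set.finite_Iio (l n)) _
        (fun a n m hnm h y hy hy' => h y hy fun i hi => hy' i (by omega)) h2
      have h3 : ∀ k ∈ Set.Iic n, ∃ N, ∀ y : ℕ → ℤ,
          (∀ m < N, y m = (x0 + ⇑r) m) → y ∈ O k := fun k _ => open_prefix (hO k) (hx0 r k)
      obtain ⟨N3, hN3⟩ := exists_uniform (Set.finite_Iic n) _
        (fun a n m hnm h y hy' => h y fun i hi => hy' i (by omega)) h3
      refine ⟨max N1 (max N2 N3), ⟨?_, ?_⟩, ?_⟩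
      · intro x hx hx'
        exact hN1 x hx fun m hm => hx' m (lt_of_lt_of_le hm (by simp))
      · intro x hx hx' i hi
        exact hN2 i hi x hx fun m hm => hx' m (lt_of_lt_of_le hm (by simp))
      · intro x hx' k hk
        exact hN3 k hk x fun m hm => hx' m (lt_of_lt_of_le hm (by simp))
  choose Φ hΦ using hΦ
  refine ⟨x0, {x | ∀ k, x ∈ O k}, l, Φ, hlmono, hln, hx0, fun n r hr => (hΦ n r hr).1.1,
    fun n r hr => (hΦ n r hr).1.2, ?_⟩
  intro x hx k
  obtain ⟨n, hn, r, hr, hxr⟩ := hx k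
  exact (hΦ n r hr).2 x hxr k hn

lemma tsum_blocks (f : ℕ → ℝ≥0∞) (L : ℕ → ℕ) (h0 : L 0 = 0) (hL : Monotone L)
    (hinf : ∀ n, n ≤ L n) :
    ∑' j, ∑ i ∈ Finset.Ico (L j) (L (j + 1)), f i = ∑' i, f i := by
  have h1 : ∀ n, ∑ j ∈ Finset.range n, ∑ i ∈ Finset.Ico (L j) (L (j + 1)), f i
      = ∑ i ∈ Finset.range (L n), f i := by
    intro n
    induction n with
    | zero => simp [h0]
    | succ n ih =>
      rw [Finset.sum_range_succ, ih, Finset.range_eq_Ico, Finset.range_eq_Ico,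
        Finset.sum_Ico_consecutive _ (Nat.zero_le _) (hL (Nat.le_succ n))]
  have h2 := (ENNReal.summable (f := fun j => ∑ i ∈ Finset.Ico (L j) (L (j + 1)), f i)).hasSum.tendsto_sum_nat
  have h3 := (ENNReal.summable (f := f)).hasSum.tendsto_sum_nat.comp
    (tendsto_atTop_mono hinf tendsto_id)
  refine tendsto_nhds_unique h2 ?_
  refine h3.congr fun n => ?_
  simp [h1]

lemma seq_choice (Φ : ℕ → ℕ) (P : ℕ → Set ℕ) (hP : ∀ j, (P j).Infinite) :
    ∃ k : ℕ → ℕ, (∀ j, k j ∈ P j) ∧ ∀ j, Φ (k j + 1) ≤ k (j + 1) ∧ k j < k (j + 1) := by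
  have := fun j n => (hP j).exists_gt n
  choose s hs hs' using this
  let k : ℕ → ℕ := fun n => Nat.rec (s 0 0) (fun j a => s (j + 1) (Φ (a + 1) + a)) n
  have hk : ∀ j, k (j + 1) = s (j + 1) (Φ (k j + 1) + k j) := fun j => rfl
  refine ⟨k, ?_, ?_⟩
  · intro j
    cases j with
    | zero => exact hs 0 0
    | succ j => rw [hk]; exact hs _ _
  · intro j
    have := hs' (j + 1) (Φ (k j + 1) + k j)
    rw [hk]
    omega

/-- place the values `z j` at the positions `k j` -/
noncomputable def ext (k : ℕ → ℕ) (z : ℕ → ℤ) : ℕ → ℤ := Function.extend k z 0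

/-- block distance -/
noncomputable def HH (D : ℕ → ℤ → ℤ → ℝ≥0∞) (θ : (ℕ → ℤ) → (ℕ → ℤ)) (x0 : ℕ → ℤ) (J : Finset ℕ)
    (k : ℕ) (a b : ℤ) : ℝ≥0∞ :=
  ∑ i ∈ J, D i (θ (x0 + ⇑(Finsupp.single k a)) i) (θ (x0 + ⇑(Finsupp.single k b)) i)

theorem rigid (D : ℕ → ℤ → ℤ → ℝ≥0∞) (Q : ℝ≥0∞) (hQ : Q ≠ ⊤)
    (hD0 : ∀ i a, D i a a = 0) (hDs : ∀ i a b, D i a b = D i b a)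
    (hDt : ∀ i a b c, D i a c ≤ Q * (D i a b + D i b c))
    (θ : (ℕ → ℤ) → (ℕ → ℤ)) (hθ : Measurable θ)
    (h : ∀ x y : ℕ → ℤ, (∃ n, ∀ i ≥ n, x i = y i) → ∑' i, D i (θ x i) (θ y i) ≠ ⊤)
    (M : ℕ → ℕ) (P : ℕ → Set ℕ) (hP : ∀ j, (P j).Infinite) :
    ∃ (k : ℕ → ℕ) (x0 : ℕ → ℤ) (J : ℕ → Finset ℕ), StrictMono k ∧ (∀ j, k j ∈ P j) ∧
      ∀ z z' : ℕ → ℤ, (∀ j, 0 ≤ z j ∧ z j ≤ M (k j)) → (∀ j, 0 ≤ z' j ∧ z' j ≤ M (k j)) →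
        (∑' i, D i (θ (x0 + ext k z) i) (θ (x0 + ext k z') i) ≠ ⊤ ↔
          ∑' j, HH D θ x0 (J j) (k j) (z j) (z' j) ≠ ⊤) := by
  obtain ⟨x0, C, l, Φ, hlm, hln, hC, h1, h2, h3⟩ := control D θ hθ h M
  obtain ⟨k, hkP, hk⟩ := seq_choice Φ P hP
  have hkm : StrictMono k := strictMono_nat_of_lt_succ fun j => (hk j).2
  let L : ℕ → ℕ := fun j => match j with | 0 => 0 | j + 1 => l (k j + 1)
  have hL : Monotone L := by
    refine monotone_nat_of_le_succ fun j => ?_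
    cases j with
    | zero => exact Nat.zero_le _
    | succ j => exact hlm (by have := (hk j).2; omega)
  have hLn : ∀ n, n ≤ L n := by
    intro n
    cases n with
    | zero => exact Nat.zero_le _
    | succ j =>
      have := hln (k j + 1)
      have := hkm.le_apply (x := j)
      show j + 1 ≤ l (k j + 1)
      omega
  refine ⟨k, x0, fun j => Finset.Ico (L j) (L (j + 1)), hkm, hkP, ?_⟩
  have key : ∀ z : ℕ → ℤ, (∀ j, 0 ≤ z j ∧ z j ≤ M (k j)) →
      ∑' j, ∑ i ∈ Finset.Ico (L j) (L (j + 1)),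
        D i (θ (x0 + ext k z) i) (θ (x0 + ⇑(Finsupp.single (k j) (z j))) i) ≠ ⊤ := by
    intro z hz
    have hext : ∀ i, (∃ j, k j = i ∧ ext k z i = z j) ∨ ((∀ j, k j ≠ i) ∧ ext k z i = 0) := by
      intro i
      by_cases hi : ∃ j, k j = i
      · obtain ⟨j, rfl⟩ := hi
        exact Or.inl ⟨j, rfl, hkm.injective.extend_apply _ _ _⟩
      · refine Or.inr ⟨by simpa using hi, ?_⟩
        exact Function.extend_apply' _ _ _ hi
    let zt : ℕ → (ℕ →₀ ℤ) := fun n => Finsupp.onFinset (Finset.range n)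
      (fun i => if i < n then ext k z i else 0)
      (by intro a ha; by_contra h; simp at h; simp [h] at ha)
    have hzt : ∀ n i, zt n i = if i < n then ext k z i else 0 := fun n i => rfl
    have hztb : ∀ n, zt n ∈ box M n := by
      intro n
      refine ⟨fun i => ?_, fun i hi => ?_⟩
      · rw [hzt]
        split_ifs
        · rcases hext i with ⟨j, rfl, hj⟩ | ⟨_, hj⟩
          · rw [hj]; exact hz j
          · rw [hj]; simp
        · simp
      · rw [hzt, if_neg (by omega)]
    have hagree : ∀ j, ∀ i < k (j + 1), (x0 + ext k z) i = (x0 + ⇑(zt (k j + 1))) i := by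
      intro j i hi
      simp only [Pi.add_apply, hzt]
      split_ifs with h
      · rfl
      · rcases hext i with ⟨j', rfl, hj⟩ | ⟨_, hj⟩
        · have a := hkm.lt_iff_lt.1 hi
          have b : k j < k j' := by omega
          have c := hkm.lt_iff_lt.1 b
          omega
        · rw [hj]
    have hxC : x0 + ext k z ∈ C := by
      apply h3
      intro m
      refine ⟨k m + 1, ?_, zt (k m + 1), hztb _, fun i hi => hagree m i ?_⟩
      · have := hkm.le_apply (x := m)
        omega
      · exact lt_of_lt_of_le hi (hk m).1
    have hdec : ∀ j, ∀ i < L (j + 1), θ (x0 + ext k z) i = θ (x0 + ⇑(zt (k j + 1))) i := by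
      intro j i hi
      exact h2 (k j + 1) _ (hztb _) _ hxC
        (fun i hi => hagree j i (lt_of_lt_of_le hi (hk j).1)) i hi
    have hkz : ∀ j, ext k z (k j) = z j := fun j => hkm.injective.extend_apply _ _ _
    have hb : ∀ j, ∑ i ∈ Finset.Ico (L j) (L (j + 1)),
        D i (θ (x0 + ext k z) i) (θ (x0 + ⇑(Finsupp.single (k j) (z j))) i)
        ≤ (2 : ℝ≥0∞)⁻¹ ^ j := by
      intro j
      cases j with
      | zero =>
        refine le_trans (le_of_eq ?_) zero_le
        refine Finset.sum_eq_zero fun i hi => ?_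
        rw [hdec 0 i (Finset.mem_Ico.1 hi).2]
        have : zt (k 0 + 1) = Finsupp.single (k 0) (z 0) := by
          ext i
          rw [hzt, Finsupp.single_apply]
          by_cases hi : k 0 = i
          · subst hi
            simp [hkz]
          · rw [if_neg hi]
            split_ifs with h
            · rcases hext i with ⟨j', rfl, hj⟩ | ⟨_, hj⟩
              · exact absurd (hkm.monotone (Nat.zero_le j')) (by omega)
              · exact hj
            · rfl
        rw [this, hD0]
      | succ j =>
        have hsub : x0 + ⇑(Finsupp.single (k (j + 1)) (z (j + 1)))
            = x0 + ⇑(zt (k (j + 1) + 1)) - ⇑(zt (k j + 1)) := by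
          funext i
          simp only [Pi.add_apply, Pi.sub_apply, hzt]
          rw [Finsupp.single_apply]
          have hlt := (hk j).2
          by_cases hi : k (j + 1) = i
          · subst hi
            simp [hkz, Nat.not_lt.2 (Nat.succ_le_of_lt hlt)]
          · rw [if_neg hi]
            by_cases h1 : i < k j + 1
            · rw [if_pos h1, if_pos (by omega)]; ring
            · rw [if_neg h1]
              split_ifs with h
              · rcases hext i with ⟨j', rfl, hj⟩ | ⟨_, hj⟩
                · have a : k j' < k (j + 1) := by omega
                  have b : k j < k j' := by omega
                  have a := hkm.lt_iff_lt.1 a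
                  have b := hkm.lt_iff_lt.1 b
                  omega
                · rw [hj]; ring
              · ring
        have e := h1 (k j + 1) (zt (k j + 1)) (hztb _) (x0 + ⇑(zt (k (j + 1) + 1))) (hC _) (by
          intro i hi
          have hi' : i < k (j + 1) := lt_of_lt_of_le hi (hk j).1
          rw [← hagree j i hi', ← hagree (j + 1) i (by have := (hk (j + 1)).2; omega)])
        rw [← hsub] at e
        have : ∑ i ∈ Finset.Ico (L (j + 1)) (L (j + 1 + 1)),
            D i (θ (x0 + ext k z) i) (θ (x0 + ⇑(Finsupp.single (k (j + 1)) (z (j + 1)))) i)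
            ≤ (2 : ℝ≥0∞)⁻¹ ^ (k j + 1) := by
          refine le_trans ?_ e
          rw [Finset.sum_Ico_eq_sum_range]
          refine le_trans (le_of_eq ?_) (ENNReal.sum_le_tsum
            (Finset.range (L (j + 1 + 1) - L (j + 1))))
          refine Finset.sum_congr rfl fun i hi => ?_
          rw [Finset.mem_range] at hi
          rw [hdec (j + 1) _ (by omega), add_comm (L (j + 1)) i]
        refine this.trans ?_
        have hj := hkm.le_apply (x := j)
        exact pow_le_pow_of_le_one zero_le (by simp) (by omega)
    refine ne_top_of_le_ne_top ?_ (ENNReal.tsum_le_tsum hb)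
    rw [ENNReal.tsum_geometric]
    simp
  intro z z' hz hz'
  have kz := key z hz
  have kz' := key z' hz'
  rw [← tsum_blocks (fun i => D i (θ (x0 + ext k z) i) (θ (x0 + ext k z') i)) L rfl hL hLn]
  have hDt2 : ∀ i a b c d, D i a d ≤ Q * (D i a b + Q * (D i b c + D i c d)) := by
    intro i a b c d
    refine (hDt i a b d).trans ?_
    gcongr
    exact hDt i b c d
  constructor
  · intro hf
    have : ∑' j, HH D θ x0 (Finset.Ico (L j) (L (j + 1))) (k j) (z j) (z' j) ≤
        ∑' j, Q * ((∑ i ∈ Finset.Ico (L j) (L (j + 1)),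
          D i (θ (x0 + ext k z) i) (θ (x0 + ⇑(Finsupp.single (k j) (z j))) i)) +
          Q * ((∑ i ∈ Finset.Ico (L j) (L (j + 1)),
            D i (θ (x0 + ext k z) i) (θ (x0 + ext k z') i)) +
            ∑ i ∈ Finset.Ico (L j) (L (j + 1)),
          D i (θ (x0 + ext k z') i) (θ (x0 + ⇑(Finsupp.single (k j) (z' j))) i))) := by
      refine ENNReal.tsum_le_tsum fun j => ?_
      rw [← Finset.sum_add_distrib, Finset.mul_sum, ← Finset.sum_add_distrib, Finset.mul_sum]
      refine Finset.sum_le_sum fun i _ => ?_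
      rw [hDs i (θ (x0 + ext k z) i) (θ (x0 + ⇑(Finsupp.single (k j) (z j))) i)]
      exact hDt2 _ _ _ _ _
    refine ne_top_of_le_ne_top ?_ this
    rw [ENNReal.tsum_mul_left, ENNReal.tsum_add, ENNReal.tsum_mul_left, ENNReal.tsum_add]
    finiteness
  · intro hf
    have : ∑' j, ∑ i ∈ Finset.Ico (L j) (L (j + 1)),
            D i (θ (x0 + ext k z) i) (θ (x0 + ext k z') i) ≤
        ∑' j, Q * ((∑ i ∈ Finset.Ico (L j) (L (j + 1)),
          D i (θ (x0 + ext k z) i) (θ (x0 + ⇑(Finsupp.single (k j) (z j))) i)) +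
          Q * (HH D θ x0 (Finset.Ico (L j) (L (j + 1))) (k j) (z j) (z' j) +
            ∑ i ∈ Finset.Ico (L j) (L (j + 1)),
          D i (θ (x0 + ext k z') i) (θ (x0 + ⇑(Finsupp.single (k j) (z' j))) i))) := by
      refine ENNReal.tsum_le_tsum fun j => ?_
      rw [HH, ← Finset.sum_add_distrib, Finset.mul_sum, ← Finset.sum_add_distrib, Finset.mul_sum]
      refine Finset.sum_le_sum fun i _ => ?_
      rw [hDs i (θ (x0 + ext k z') i) (θ (x0 + ⇑(Finsupp.single (k j) (z' j))) i)]
      exact hDt2 _ _ _ _ _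
    refine ne_top_of_le_ne_top ?_ this
    rw [ENNReal.tsum_mul_left, ENNReal.tsum_add, ENNReal.tsum_mul_left, ENNReal.tsum_add]
    finiteness



/-! ### the concrete relations -/

noncomputable def rho (K : ℕ) (a b : ℤ) : ℝ := min 1 (|(a : ℝ) - b| / K)

lemma rho_nonneg (K : ℕ) (a b : ℤ) : 0 ≤ rho K a b := by unfold rho; positivity
lemma rho_le_one (K : ℕ) (a b : ℤ) : rho K a b ≤ 1 := min_le_left _ _
lemma rho_self (K : ℕ) (a : ℤ) : rho K a a = 0 := by simp [rho]
lemma rho_comm (K : ℕ) (a b : ℤ) : rho K a b = rho K b a := by simp [rho, abs_sub_comm]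
lemma rho_triangle (K : ℕ) (a b c : ℤ) : rho K a c ≤ rho K a b + rho K b c := by
  have h : |(a : ℝ) - c| / K ≤ |(a : ℝ) - b| / K + |(b : ℝ) - c| / K := by
    rw [← add_div]
    gcongr
    exact abs_sub_le _ _ _
  have h1 : 0 ≤ |(a : ℝ) - b| / K := by positivity
  have h2 : 0 ≤ |(b : ℝ) - c| / K := by positivity
  unfold rho
  rcases min_cases 1 (|(a : ℝ) - b| / K) with ⟨e1, _⟩ | ⟨e1, _⟩ <;>
  rcases min_cases 1 (|(b : ℝ) - c| / K) with ⟨e2, _⟩ | ⟨e2, _⟩ <;>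
  rcases min_cases 1 (|(a : ℝ) - c| / K) with ⟨e3, _⟩ | ⟨e3, _⟩ <;>
  rw [e1, e2, e3] <;> linarith

lemma rho_ge (K : ℕ) (hK : 1 ≤ K) (a b : ℤ) (hab : a ≠ b) : 1 / (K : ℝ) ≤ rho K a b := by
  have hK' : (1 : ℝ) ≤ K := by exact_mod_cast hK
  refine le_min ?_ ?_
  · rw [div_le_one (by linarith)]; exact hK'
  · gcongr
    have : (1 : ℤ) ≤ |a - b| := Int.one_le_abs (sub_ne_zero.2 hab)
    exact_mod_cast this

lemma rho_path (K : ℕ) (f : ℕ → ℤ) (N : ℕ) :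
    rho K (f 0) (f N) ≤ ∑ j ∈ Finset.range N, rho K (f j) (f (j + 1)) := by
  induction N with
  | zero => simp [rho_self]
  | succ N ih =>
    rw [Finset.sum_range_succ]
    exact (rho_triangle K _ (f N) _).trans (by linarith)

lemma rho_path_pow (K : ℕ) (f : ℕ → ℤ) (N : ℕ) (s : ℝ) (hs : 1 ≤ s) :
    rho K (f 0) (f N) ^ s ≤ (N : ℝ) ^ (s - 1) *
      ∑ j ∈ Finset.range N, rho K (f j) (f (j + 1)) ^ s := by
  refine (Real.rpow_le_rpow (rho_nonneg _ _ _) (rho_path K f N) (by linarith)).trans ?_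
  have := Real.rpow_sum_le_const_mul_sum_rpow_of_nonneg (Finset.range N)
    (f := fun j => rho K (f j) (f (j + 1))) hs (fun i _ => rho_nonneg _ _ _)
  simpa using this

def KK (n : ℕ) : ℕ := 2 ^ (n ^ 2 * 2 ^ n)
noncomputable def rr (p ε : ℝ) (n : ℕ) : ℝ := p + ε / 2 ^ n
noncomputable def eta (ε : ℝ) (n : ℕ) : ℝ := 2 ^ (-(ε * n / 2))

open Classical in
noncomputable def Kc (A : Set ℕ) (i : ℕ) : ℕ := if i.unpair.1 ∈ A then KK i.unpair.1 else 2 ^ i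
open Classical in
noncomputable def rc (p ε : ℝ) (A : Set ℕ) (i : ℕ) : ℝ :=
  if i.unpair.1 ∈ A then rr p ε i.unpair.1 else p

noncomputable def DD (p ε : ℝ) (A : Set ℕ) (i : ℕ) (a b : ℤ) : ℝ :=
  rho (Kc A i) a b ^ rc p ε A i

lemma KK_one_le (n : ℕ) : 1 ≤ KK n := Nat.one_le_two_pow
lemma KK_cast (n : ℕ) : (KK n : ℝ) = (2 : ℝ) ^ ((n : ℝ) ^ 2 * 2 ^ n) := by
  unfold KK
  have : ((n : ℝ) ^ 2 * 2 ^ n) = ((n ^ 2 * 2 ^ n : ℕ) : ℝ) := by push_cast; ring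
  rw [this, Real.rpow_natCast]
  push_cast
  ring
lemma KK_rpow (n : ℕ) (s : ℝ) : (KK n : ℝ) ^ s = (2 : ℝ) ^ ((n : ℝ) ^ 2 * 2 ^ n * s) := by
  rw [KK_cast, ← Real.rpow_mul (by norm_num)]

lemma rrX (p ε : ℝ) (n : ℕ) : (n : ℝ) ^ 2 * 2 ^ n * rr p ε n
    = (n : ℝ) ^ 2 * 2 ^ n * p + ε * (n : ℝ) ^ 2 := by
  unfold rr
  field_simp

lemma Kc_one_le (A : Set ℕ) (i : ℕ) : 1 ≤ Kc A i := by
  unfold Kc; split_ifs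
  · exact KK_one_le _
  · exact Nat.one_le_two_pow

lemma rc_ge (p ε : ℝ) (hε : 0 < ε) (A : Set ℕ) (i : ℕ) : p ≤ rc p ε A i := by
  unfold rc rr; split_ifs
  · have : 0 < ε / 2 ^ i.unpair.1 := by positivity
    linarith
  · exact le_rfl

lemma rc_le (p ε : ℝ) (hε : 0 < ε) (A : Set ℕ) (i : ℕ) : rc p ε A i ≤ p + ε := by
  unfold rc rr; split_ifs
  · have : ε / 2 ^ i.unpair.1 ≤ ε := div_le_self hε.le (one_le_pow₀ (by norm_num))
    linarith
  · linarith

lemma DD_nonneg (p ε : ℝ) (A : Set ℕ) (i : ℕ) (a b : ℤ) : 0 ≤ DD p ε A i a b :=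
  Real.rpow_nonneg (rho_nonneg _ _ _) _

lemma contraction (p ε : ℝ) (hp : 1 ≤ p) (hε : 0 < ε) (B : Set ℕ) (n : ℕ) (hn : 1 ≤ n)
    (hnB : n ∉ B) (i : ℕ) (f : ℕ → ℤ) :
    DD p ε B i (f 0) (f (KK n)) ≤ eta ε n * (KK n : ℝ) ^ (rr p ε n - 1) *
      ∑ j ∈ Finset.range (KK n), DD p ε B i (f j) (f (j + 1)) := by
  have hn' : (1 : ℝ) ≤ n := by exact_mod_cast hn
  have hnn : (n : ℝ) ≤ (n : ℝ) ^ 2 := by nlinarith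
  have hrhs : eta ε n * (KK n : ℝ) ^ (rr p ε n - 1)
      = (2 : ℝ) ^ (-(ε * n / 2) + ((n : ℝ) ^ 2 * 2 ^ n * p + ε * (n : ℝ) ^ 2
        - (n : ℝ) ^ 2 * 2 ^ n)) := by
    rw [eta, KK_rpow, ← Real.rpow_add (by norm_num), mul_sub, rrX, mul_one]
  have hsum : ∀ s : ℝ, ∀ K : ℕ,
      0 ≤ ∑ j ∈ Finset.range (KK n), rho K (f j) (f (j + 1)) ^ s := fun s K =>
    Finset.sum_nonneg fun j _ => Real.rpow_nonneg (rho_nonneg _ _ _) _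
  unfold DD
  by_cases hi : i.unpair.1 ∈ B
  · have hr : rc p ε B i = rr p ε i.unpair.1 := by simp [rc, hi]
    have hK : Kc B i = KK i.unpair.1 := by simp [Kc, hi]
    rw [hr, hK]
    generalize i.unpair.1 = m at *
    have hmn : m ≠ n := fun h => hnB (h ▸ hi)
    have hrm : p ≤ rr p ε m := by
      have : 0 < ε / 2 ^ m := by positivity
      unfold rr; linarith
    rcases lt_or_gt_of_ne hmn with hlt | hgt
    ·
      have hm' : (m : ℝ) + 1 ≤ n := by exact_mod_cast hlt
      have h1 : rho (KK m) (f 0) (f (KK n)) ^ rr p ε m ≤ rho (KK m) (f 0) (f (KK n)) ^ p :=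
        Real.rpow_le_rpow_of_exponent_ge_of_imp (rho_nonneg _ _ _) (rho_le_one _ _ _) hrm
          (fun _ h => by linarith)
      have h2 := rho_path_pow (KK m) f (KK n) p hp
      have h3 : ∀ j ∈ Finset.range (KK n), rho (KK m) (f j) (f (j + 1)) ^ p ≤
          (2 : ℝ) ^ (ε * (m : ℝ) ^ 2) * rho (KK m) (f j) (f (j + 1)) ^ rr p ε m := by
        intro j _
        by_cases hj : f j = f (j + 1)
        · rw [← hj, rho_self, Real.zero_rpow (by linarith), Real.zero_rpow (by linarith)]
          simp
        · have h4 := rho_ge (KK m) (KK_one_le m) _ _ hj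
          have hKpos : (0 : ℝ) < KK m := by exact_mod_cast KK_one_le m
          have hpos : 0 < rho (KK m) (f j) (f (j + 1)) := lt_of_lt_of_le (by positivity) h4
          have h5 : (2 : ℝ) ^ (ε * (m : ℝ) ^ 2) = (KK m : ℝ) ^ (rr p ε m - p) := by
            rw [KK_rpow, mul_sub, rrX]; congr 1; ring
          have h6 : (1 : ℝ) ≤ (KK m : ℝ) ^ (rr p ε m - p) *
              rho (KK m) (f j) (f (j + 1)) ^ (rr p ε m - p) := by
            rw [← Real.mul_rpow hKpos.le hpos.le]
            refine Real.one_le_rpow ?_ (by linarith)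
            rw [div_le_iff₀ hKpos] at h4
            linarith
          have h7 : rho (KK m) (f j) (f (j + 1)) ^ rr p ε m =
              rho (KK m) (f j) (f (j + 1)) ^ (rr p ε m - p) *
              rho (KK m) (f j) (f (j + 1)) ^ p := by
            rw [← Real.rpow_add hpos]; congr 1; ring
          rw [h5, h7, ← mul_assoc]
          exact le_mul_of_one_le_left (Real.rpow_nonneg hpos.le _) h6
      have h4 := Finset.sum_le_sum h3
      rw [← Finset.mul_sum] at h4
      refine h1.trans (h2.trans ((mul_le_mul_of_nonneg_left h4 (by positivity)).trans ?_))
      rw [← mul_assoc, hrhs, KK_rpow, ← Real.rpow_add (by norm_num)]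
      refine mul_le_mul_of_nonneg_right ?_ (hsum _ _)
      refine Real.rpow_le_rpow_of_exponent_le (by norm_num) ?_
      have : (m : ℝ) ^ 2 ≤ (n : ℝ) ^ 2 - n / 2 := by
        have : (0 : ℝ) ≤ m := by positivity
        nlinarith
      nlinarith
    ·
      refine (rho_path_pow (KK m) f (KK n) (rr p ε m) (hp.trans hrm)).trans ?_
      refine mul_le_mul_of_nonneg_right ?_ (hsum _ _)
      rw [hrhs, KK_rpow]
      refine Real.rpow_le_rpow_of_exponent_le (by norm_num) ?_
      have h1 : (n : ℝ) ^ 2 * 2 ^ n * (ε / 2 ^ m) ≤ ε * (n : ℝ) ^ 2 / 2 := by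
        have h2 : ε / 2 ^ m ≤ ε / 2 ^ (n + 1) := by
          gcongr
          · norm_num
          · exact hgt
        have h3 : (n : ℝ) ^ 2 * 2 ^ n * (ε / 2 ^ (n + 1)) = ε * (n : ℝ) ^ 2 / 2 := by
          field_simp; ring
        rw [← h3]
        gcongr
      have h4 : (n : ℝ) ^ 2 * 2 ^ n * (rr p ε m - 1) = (n : ℝ) ^ 2 * 2 ^ n * p +
        (n : ℝ) ^ 2 * 2 ^ n * (ε / 2 ^ m) - (n : ℝ) ^ 2 * 2 ^ n := by unfold rr; ring
      rw [h4]
      nlinarith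
  · have hr : rc p ε B i = p := by simp [rc, hi]
    rw [hr]
    refine (rho_path_pow _ f (KK n) p hp).trans ?_
    refine mul_le_mul_of_nonneg_right ?_ (hsum _ _)
    rw [hrhs, KK_rpow]
    refine Real.rpow_le_rpow_of_exponent_le (by norm_num) ?_
    nlinarith

end S17

namespace S17
open Filter Topology ENNReal

noncomputable def DE (p ε : ℝ) (A : Set ℕ) (i : ℕ) (a b : ℤ) : ℝ≥0∞ :=
  ENNReal.ofReal (DD p ε A i a b)

/-- the relation attached to `A` -/
def RR (p ε : ℝ) (A : Set ℕ) (x y : ℕ → ℤ) : Prop := ∑' i, DE p ε A i (x i) (y i) ≠ ⊤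

lemma DE_self (p ε : ℝ) (hp : 1 ≤ p) (hε : 0 < ε) (A : Set ℕ) (i : ℕ) (a : ℤ) :
    DE p ε A i a a = 0 := by
  have := rc_ge p ε hε A i
  rw [DE, DD, rho_self, Real.zero_rpow (by linarith)]; simp

lemma DE_comm (p ε : ℝ) (A : Set ℕ) (i : ℕ) (a b : ℤ) : DE p ε A i a b = DE p ε A i b a := by
  rw [DE, DE, DD, DD, rho_comm]

lemma DE_tri (p ε : ℝ) (hp : 1 ≤ p) (hε : 0 < ε) (A : Set ℕ) (i : ℕ) (a b c : ℤ) :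
    DE p ε A i a c ≤ ENNReal.ofReal (2 ^ (p + ε)) * (DE p ε A i a b + DE p ε A i b c) := by
  have h1 := rc_ge p ε hε A i
  have h2 := rc_le p ε hε A i
  unfold DE
  rw [← ENNReal.ofReal_add (DD_nonneg _ _ _ _ _ _) (DD_nonneg _ _ _ _ _ _),
    ← ENNReal.ofReal_mul (by positivity)]
  refine ENNReal.ofReal_le_ofReal ?_
  unfold DD
  generalize rc p ε A i = r at *
  have h0 := rho_triangle (Kc A i) a b c
  have n1 := rho_nonneg (Kc A i) a b
  have n2 := rho_nonneg (Kc A i) b c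
  have n3 := rho_nonneg (Kc A i) a c
  have h3 := Real.rpow_sum_le_const_mul_sum_rpow_of_nonneg Finset.univ
    (f := ![rho (Kc A i) a b, rho (Kc A i) b c]) (p := r) (by linarith)
    (by intro j _; fin_cases j <;> simp [n1, n2])
  simp only [Fin.sum_univ_two, Finset.card_univ, Fintype.card_fin] at h3
  simp at h3
  refine (Real.rpow_le_rpow n3 h0 (by linarith)).trans (h3.trans ?_)
  refine mul_le_mul_of_nonneg_right ?_ (by positivity)
  exact Real.rpow_le_rpow_of_exponent_le (by norm_num) (by linarith)

lemma RR_equiv (p ε : ℝ) (hp : 1 ≤ p) (hε : 0 < ε) (A : Set ℕ) : Equivalence (RR p ε A) := by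
  refine ⟨fun x => ?_, fun {x y} h => ?_, fun {x y z} h h' => ?_⟩
  · simp [RR, DE_self p ε hp hε]
  · unfold RR at *
    simpa only [DE_comm p ε A _ (y _) (x _)] using h
  · unfold RR at *
    refine ne_top_of_le_ne_top ?_ (ENNReal.tsum_le_tsum fun i => DE_tri p ε hp hε A i _ (y i) _)
    rw [ENNReal.tsum_mul_left, ENNReal.tsum_add]
    finiteness

lemma RR_meas (p ε : ℝ) (A : Set ℕ) :
    MeasurableSet {z : (ℕ → ℤ) × (ℕ → ℤ) | RR p ε A z.1 z.2} := by
  have : Measurable fun z : (ℕ → ℤ) × (ℕ → ℤ) => ∑' i, DE p ε A i (z.1 i) (z.2 i) := by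
    refine Measurable.tsum fun i => ?_
    have hD : Measurable (fun ab : ℤ × ℤ => DE p ε A i ab.1 ab.2) := measurable_of_countable _
    have hg : Measurable (fun z : (ℕ → ℤ) × (ℕ → ℤ) => (z.1 i, z.2 i)) := by fun_prop
    have := hD.comp hg
    exact this
  exact (this (measurableSet_singleton ⊤)).compl

lemma HH_contraction (p ε : ℝ) (hp : 1 ≤ p) (hε : 0 < ε) (B : Set ℕ) (n : ℕ) (hn : 1 ≤ n)
    (hnB : n ∉ B) (θ : (ℕ → ℤ) → (ℕ → ℤ)) (x0 : ℕ → ℤ) (J : Finset ℕ) (k : ℕ) :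
    HH (DE p ε B) θ x0 J k 0 (KK n) ≤
      ENNReal.ofReal (eta ε n * (KK n : ℝ) ^ (rr p ε n - 1)) *
      ∑ j ∈ Finset.range (KK n), HH (DE p ε B) θ x0 J k (j : ℤ) ((j : ℤ) + 1) := by
  unfold HH
  rw [Finset.sum_comm, Finset.mul_sum]
  refine Finset.sum_le_sum fun i _ => ?_
  have h := contraction p ε hp hε B n hn hnB i
    (fun j : ℕ => θ (x0 + ⇑(Finsupp.single k (j : ℤ))) i)
  unfold DE
  rw [← ENNReal.ofReal_sum_of_nonneg (fun _ _ => DD_nonneg _ _ _ _ _ _),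
    ← ENNReal.ofReal_mul (by unfold eta; positivity)]
  refine ENNReal.ofReal_le_ofReal ?_
  simpa using h

lemma tsum_supp {β : Type*} (e : β → ℕ) (he : Function.Injective e) (f : ℕ → ℝ≥0∞)
    (hf : ∀ j, j ∉ range e → f j = 0) : ∑' j, f j = ∑' x, f (e x) := by
  refine (he.tsum_eq ?_).symm
  intro j hj
  by_contra h
  exact hj (hf j h)

lemma eta_pos (ε : ℝ) (n : ℕ) : 0 < eta ε n := by unfold eta; positivity

lemma eta_KK (p ε : ℝ) (hp : 1 ≤ p) (hε : 0 < ε) (n : ℕ) (hn : 1 ≤ n) :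
    1 ≤ eta ε n * (KK n : ℝ) ^ (rr p ε n) := by
  have hn' : (1 : ℝ) ≤ n := by exact_mod_cast hn
  rw [eta, KK_rpow, rrX, ← Real.rpow_add (by norm_num)]
  refine Real.one_le_rpow (by norm_num) ?_
  have : 0 ≤ (n : ℝ) ^ 2 * 2 ^ n * p := by positivity
  have h2 : (n : ℝ) ≤ (n : ℝ) ^ 2 := by nlinarith
  have h3 := mul_le_mul_of_nonneg_left h2 hε.le
  have h4 : 0 ≤ ε * n := by positivity
  linarith

lemma eta_sum (ε : ℝ) (hε : 0 < ε) (s : ℕ → ℕ) (hs : StrictMono s) :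
    ∑' n, ENNReal.ofReal (eta ε (s n)) ≠ ⊤ := by
  have h1 : ∀ n, ENNReal.ofReal (eta ε (s n)) ≤ ENNReal.ofReal ((2 : ℝ) ^ (-(ε / 2))) ^ n := by
    intro n
    rw [← ENNReal.ofReal_pow (by positivity)]
    refine ENNReal.ofReal_le_ofReal ?_
    rw [← Real.rpow_natCast, ← Real.rpow_mul (by norm_num), eta]
    refine Real.rpow_le_rpow_of_exponent_le (by norm_num) ?_
    have : (n : ℝ) ≤ s n := by exact_mod_cast hs.le_apply
    nlinarith
  refine ne_top_of_le_ne_top ?_ (ENNReal.tsum_le_tsum h1)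
  rw [ENNReal.tsum_geometric]
  have : ENNReal.ofReal ((2 : ℝ) ^ (-(ε / 2))) < 1 := by
    rw [← ENNReal.ofReal_one, ENNReal.ofReal_lt_ofReal_iff (by norm_num)]
    exact Real.rpow_lt_one_of_one_lt_of_neg (by norm_num) (by linarith)
  simp only [ne_eq, ENNReal.inv_eq_top]
  exact (tsub_pos_of_lt this).ne'

theorem nonred (p ε : ℝ) (hp : 1 ≤ p) (hε : 0 < ε) (A B : Set ℕ) (h0 : 0 ∉ A)
    (hAB : (A \ B).Infinite) (θ : (ℕ → ℤ) → (ℕ → ℤ)) (hθ : Measurable θ)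
    (hred : ∀ x y, RR p ε A x y ↔ RR p ε B (θ x) (θ y)) : False := by
  classical
  obtain ⟨s, hs, hsAB⟩ : ∃ s : ℕ → ℕ, StrictMono s ∧ ∀ n, s n ∈ A \ B :=
    ⟨Nat.nth (· ∈ A \ B), Nat.nth_strictMono hAB, fun n => Nat.nth_mem_of_infinite hAB n⟩
  have hs1 : ∀ n, 1 ≤ s n := fun n => Nat.one_le_iff_ne_zero.2 fun h => h0 (h ▸ (hsAB n).1)
  let t : ℕ → ℕ := fun j => s j.unpair.1
  have ht1 : ∀ j, 1 ≤ t j := fun j => hs1 _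
  have htA : ∀ j, t j ∈ A := fun j => (hsAB _).1
  have htB : ∀ j, t j ∉ B := fun j => (hsAB _).2
  let P : ℕ → Set ℕ := fun j => {k | k.unpair.1 = t j}
  have hPinf : ∀ j, (P j).Infinite := by
    intro j
    refine infinite_of_injective_forall_mem (f := fun l : ℕ => Nat.pair (t j) l) ?_ ?_
    · intro a b hab
      simpa using hab
    · intro l; simp [P]
  obtain ⟨k, x0, J, hkm, hkP, hmain⟩ := rigid (DE p ε B) (ENNReal.ofReal (2 ^ (p + ε)))
    ENNReal.ofReal_ne_top (DE_self p ε hp hε B) (DE_comm p ε B) (DE_tri p ε hp hε B) θ hθ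
    (by
      rintro x y ⟨n, hn⟩
      refine (hred x y).1 ?_
      unfold RR
      rw [tsum_eq_sum (s := Finset.range n)]
      · exact ENNReal.sum_ne_top.2 fun i _ => ENNReal.ofReal_ne_top
      · intro i hi
        rw [hn i (by simpa using hi), DE_self p ε hp hε])
    (fun i => KK i.unpair.1) P hPinf
  have hkt : ∀ j, (k j).unpair.1 = t j := hkP
  set H : ℕ → ℤ → ℤ → ℝ≥0∞ := fun j => HH (DE p ε B) θ x0 (J j) (k j) with hH
  have hmain' : ∀ z z' : ℕ → ℤ, (∀ j, 0 ≤ z j ∧ z j ≤ KK (t j)) →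
      (∀ j, 0 ≤ z' j ∧ z' j ≤ KK (t j)) →
      (∑' j, DE p ε A (k j) (z j) (z' j) ≠ ⊤ ↔ ∑' j, H j (z j) (z' j) ≠ ⊤) := by
    intro z z' hz hz'
    rw [← hmain z z' (by simpa [hkt] using hz) (by simpa [hkt] using hz')]
    change _ ↔ RR p ε B _ _
    rw [← hred]
    unfold RR
    rw [tsum_supp k hkm.injective
      (fun i => DE p ε A i ((x0 + ext k z) i) ((x0 + ext k z') i))]
    · have : ∀ j, DE p ε A (k j) ((x0 + ext k z) (k j)) ((x0 + ext k z') (k j))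
          = DE p ε A (k j) (z j) (z' j) := by
        intro j
        simp [ext, hkm.injective.extend_apply, DE, DD, rho]
      simp only [this]
    · intro j hj
      have hj' : ¬ ∃ a, k a = j := hj
      simp [ext, Function.extend_apply' _ _ _ hj', DE_self p ε hp hε]
  have hDD : ∀ j a b, DE p ε A (k j) a b
      = ENNReal.ofReal (rho (KK (t j)) a b ^ rr p ε (t j)) := by
    intro j a b
    simp [DE, DD, Kc, rc, hkt, htA]
  have hKpos : ∀ n, (0 : ℝ) < KK n := fun n => by exact_mod_cast KK_one_le n
  have hDD1 : ∀ j, DE p ε A (k j) 0 (KK (t j)) = 1 := by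
    intro j
    have : rho (KK (t j)) 0 (KK (t j)) = 1 := by
      simp [rho, (hKpos (t j)).ne']
    rw [hDD, this]; simp
  have hDDs : ∀ j (a : ℤ), DE p ε A (k j) a (a + 1)
      = ENNReal.ofReal ((KK (t j) : ℝ) ^ (-rr p ε (t j))) := by
    intro j a
    have : rho (KK (t j)) a (a + 1) = (KK (t j) : ℝ)⁻¹ := by
      have : (KK (t j) : ℝ)⁻¹ ≤ 1 := inv_le_one_of_one_le₀ (by exact_mod_cast KK_one_le _)
      simp [rho, this]
    rw [hDD, this, Real.rpow_neg (hKpos _).le, Real.inv_rpow (hKpos _).le]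
  have claim1 : ∃ c : ℝ, 0 < c ∧ ∀ᶠ j in atTop, ENNReal.ofReal c ≤ H j 0 (KK (t j)) := by
    by_contra hcon
    push Not at hcon
    have hfr : ∀ m : ℕ, ∃ᶠ j in atTop, H j 0 (KK (t j)) < ENNReal.ofReal ((1 / 2 : ℝ) ^ m) := by
      intro m
      have := hcon ((1 / 2 : ℝ) ^ m) (by positivity)
      simpa [Filter.Frequently] using this
    obtain ⟨φ, hφ, hφH⟩ := extraction_forall_of_frequently hfr
    have h1 := hmain' 0 (fun j => if j ∈ range φ then KK (t j) else 0) (by simp)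
      (by intro j; split_ifs <;> simp)
    have h2 : ∑' j, H j ((0 : ℕ → ℤ) j) (if j ∈ range φ then (KK (t j) : ℤ) else 0) ≠ ⊤ := by
      rw [tsum_supp φ hφ.injective]
      · refine ne_top_of_le_ne_top ?_ (ENNReal.tsum_le_tsum (g := fun m => (2⁻¹ : ℝ≥0∞) ^ m) ?_)
        · rw [ENNReal.tsum_geometric]; simp
        · intro m
          simp only [mem_range_self, if_true, Pi.zero_apply]
          refine (hφH m).le.trans (le_of_eq ?_)
          rw [ENNReal.ofReal_pow (by norm_num)]
          congr 1
          rw [one_div, ENNReal.ofReal_inv_of_pos (by norm_num)]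
          simp
      · intro j hj
        simp [hj, hH, HH, DE_self p ε hp hε]
    refine h1.2 h2 ?_
    rw [tsum_supp φ hφ.injective]
    · simp only [mem_range_self, if_true, Pi.zero_apply, hDD1]
      exact ENNReal.tsum_const_eq_top_of_ne_zero (by simp)
    · intro j hj
      simp [hj, DE_self p ε hp hε]
  obtain ⟨c, hc, hcH⟩ := claim1
  have claim2 : ∀ j, ENNReal.ofReal c ≤ H j 0 (KK (t j)) → ∃ a : ℤ, 0 ≤ a ∧ a + 1 ≤ KK (t j) ∧
      ENNReal.ofReal (c / (eta ε (t j) * (KK (t j) : ℝ) ^ rr p ε (t j))) ≤ H j a (a + 1) := by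
    intro j hj
    by_contra hcon
    push Not at hcon
    have h1 := HH_contraction p ε hp hε B (t j) (ht1 j) (htB j) θ x0 (J j) (k j)
    have h2 : ∑ a ∈ Finset.range (KK (t j)), H j (a : ℤ) ((a : ℤ) + 1) <
        ∑ a ∈ Finset.range (KK (t j)),
          ENNReal.ofReal (c / (eta ε (t j) * (KK (t j) : ℝ) ^ rr p ε (t j))) := by
      refine ENNReal.sum_lt_sum_of_nonempty ?_ ?_
      · exact ⟨0, Finset.mem_range.2 (KK_one_le _)⟩
      · intro a ha
        refine hcon a (by positivity) ?_
        have := Finset.mem_range.1 ha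
        exact_mod_cast this
    have hpos : 0 < eta ε (t j) * (KK (t j) : ℝ) ^ (rr p ε (t j) - 1) :=
      mul_pos (eta_pos _ _) (Real.rpow_pos_of_pos (hKpos _) _)
    have h3 : ENNReal.ofReal c < ENNReal.ofReal c := by
      calc ENNReal.ofReal c ≤ _ := hj
        _ ≤ _ := h1
        _ < ENNReal.ofReal (eta ε (t j) * (KK (t j) : ℝ) ^ (rr p ε (t j) - 1)) *
          ∑ a ∈ Finset.range (KK (t j)),
          ENNReal.ofReal (c / (eta ε (t j) * (KK (t j) : ℝ) ^ rr p ε (t j))) := by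
            refine ENNReal.mul_lt_mul_right ?_ ENNReal.ofReal_ne_top h2
            simpa using hpos
        _ = ENNReal.ofReal c := by
          have e1 := eta_pos ε (t j)
          have e2 := Real.rpow_pos_of_pos (hKpos (t j)) (rr p ε (t j))
          have e3 := hKpos (t j)
          rw [Finset.sum_const, Finset.card_range, nsmul_eq_mul, ← ENNReal.ofReal_natCast,
            ← ENNReal.ofReal_mul (by positivity), ← ENNReal.ofReal_mul hpos.le]
          congr 1
          rw [Real.rpow_sub e3, Real.rpow_one]
          field_simp
    exact lt_irrefl _ h3
  choose! a ha0 ha1 haH using claim2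
  have hinf : ∀ n, {j | t j = s n ∧ ENNReal.ofReal c ≤ H j 0 (KK (t j))}.Infinite := by
    intro n
    have h1 : {j | t j = s n}.Infinite := by
      refine infinite_of_injective_forall_mem (f := fun l : ℕ => Nat.pair n l) ?_ ?_
      · intro a b hab
        simpa using hab
      · intro l; simp [t]
    have h2 : ∃ᶠ j in atTop, t j = s n := Nat.frequently_atTop_iff_infinite.2 h1
    exact Nat.frequently_atTop_iff_infinite.1 (h2.and_eventually hcH)
  let m : ℕ → ℕ := fun n => ⌈eta ε n * (KK n : ℝ) ^ rr p ε n⌉₊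
  let e : (Σ n : ℕ, Fin (m (s n))) → ℕ := fun x => (hinf x.1).natEmbedding _ x.2
  have he : ∀ x, t (e x) = s x.1 ∧ ENNReal.ofReal c ≤ H (e x) 0 (KK (t (e x))) := fun x =>
    ((hinf x.1).natEmbedding _ x.2).2
  have heinj : Function.Injective e := by
    rintro ⟨n, l⟩ ⟨n', l'⟩ hx
    have h1 := (he ⟨n, l⟩).1
    rw [hx, (he ⟨n', l'⟩).1] at h1
    have h2 : n' = n := hs.injective h1
    subst h2
    have h3 := ((hinf n').natEmbedding _).injective (Subtype.ext hx)
    obtain rfl : l = l' := Fin.ext h3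
    rfl
  have h1 := hmain' (fun j => if j ∈ range e then a j else 0)
    (fun j => if j ∈ range e then a j + 1 else 0)
    (by
      intro j; split_ifs with h
      · obtain ⟨x, rfl⟩ := h
        have := ha0 _ (he x).2
        have := ha1 _ (he x).2
        omega
      · simp)
    (by
      intro j; split_ifs with h
      · obtain ⟨x, rfl⟩ := h
        have := ha0 _ (he x).2
        have := ha1 _ (he x).2
        omega
      · simp)
  refine h1.1 ?_ ?_
  · rw [tsum_supp e heinj]
    · simp only [mem_range_self, if_true, hDDs, (he _).1]
      rw [ENNReal.tsum_sigma']
      have hb : ∀ n, ∑' l : Fin (m (s n)), ENNReal.ofReal ((KK (s n) : ℝ) ^ (-rr p ε (s n)))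
          ≤ 2 * ENNReal.ofReal (eta ε (s n)) := by
        intro n
        rw [tsum_fintype, Finset.sum_const, Finset.card_univ, Fintype.card_fin, nsmul_eq_mul,
          ← ENNReal.ofReal_natCast, ← ENNReal.ofReal_mul (by positivity)]
        have : (2 : ℝ≥0∞) = ENNReal.ofReal 2 := by simp
        rw [this, ← ENNReal.ofReal_mul (by positivity)]
        refine ENNReal.ofReal_le_ofReal ?_
        have q1 := eta_KK p ε hp hε (s n) (hs1 n)
        have q2 : (m (s n) : ℝ) < eta ε (s n) * (KK (s n) : ℝ) ^ rr p ε (s n) + 1 :=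
          Nat.ceil_lt_add_one (by linarith)
        have q3 := Real.rpow_pos_of_pos (hKpos (s n)) (rr p ε (s n))
        rw [Real.rpow_neg (hKpos _).le, ← div_eq_mul_inv, div_le_iff₀ q3]
        linarith
      refine ne_top_of_le_ne_top ?_ (ENNReal.tsum_le_tsum hb)
      rw [ENNReal.tsum_mul_left]
      exact ENNReal.mul_ne_top (by simp) (eta_sum ε hε s hs)
    · intro j hj
      simp only [hj, if_false]
      exact DE_self p ε hp hε _ _ _
  · rw [tsum_supp e heinj]
    · simp only [mem_range_self, if_true]
      rw [ENNReal.tsum_sigma']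
      have hb : ∀ n, ENNReal.ofReal c ≤
          ∑' l : Fin (m (s n)), H (e ⟨n, l⟩) (a (e ⟨n, l⟩)) (a (e ⟨n, l⟩) + 1) := by
        intro n
        have q1 := eta_KK p ε hp hε (s n) (hs1 n)
        have hb' : ∀ l : Fin (m (s n)),
            ENNReal.ofReal (c / (eta ε (s n) * (KK (s n) : ℝ) ^ rr p ε (s n)))
            ≤ H (e ⟨n, l⟩) (a (e ⟨n, l⟩)) (a (e ⟨n, l⟩) + 1) := by
          intro l
          have := haH _ (he ⟨n, l⟩).2
          rwa [(he ⟨n, l⟩).1] at this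
        refine le_trans ?_ (ENNReal.tsum_le_tsum hb')
        rw [tsum_fintype, Finset.sum_const, Finset.card_univ, Fintype.card_fin, nsmul_eq_mul,
          ← ENNReal.ofReal_natCast, ← ENNReal.ofReal_mul (by positivity)]
        refine ENNReal.ofReal_le_ofReal ?_
        have q2 : eta ε (s n) * (KK (s n) : ℝ) ^ rr p ε (s n) ≤ m (s n) := Nat.le_ceil _
        rw [mul_div_assoc', le_div_iff₀ (by linarith)]
        nlinarith
      refine top_unique (le_trans (le_of_eq ?_) (ENNReal.tsum_le_tsum hb))
      exact (ENNReal.tsum_const_eq_top_of_ne_zero (by simpa using hc)).symm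
    · intro j hj
      simp [hj, hH, HH, DE_self p ε hp hε]

end S17

namespace S17
open Filter Topology ENNReal

lemma summable_iff_ne_top {β : Type*} (f : β → ℝ) (hf : ∀ i, 0 ≤ f i) :
    Summable f ↔ ∑' i, ENNReal.ofReal (f i) ≠ ⊤ := by
  constructor
  · intro h
    rw [← ENNReal.ofReal_tsum_of_nonneg hf h]
    exact ENNReal.ofReal_ne_top
  · intro h
    have := ENNReal.summable_toReal h
    simpa [ENNReal.toReal_ofReal (hf _)] using this

lemma summable_min (f r : ℕ → ℝ) (hf : ∀ i, 0 ≤ f i) (hr : ∀ i, 0 < r i) :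
    Summable (fun i => min 1 (f i) ^ r i) ↔ Summable (fun i => f i ^ r i) := by
  constructor
  · intro h
    have h1 : ∀ᶠ i in cofinite, min 1 (f i) ^ r i < 1 :=
      h.tendsto_cofinite_zero.eventually_lt_const (by norm_num)
    refine (summable_congr_cofinite ?_).1 h
    filter_upwards [h1] with i hi
    rcases min_cases 1 (f i) with ⟨e, _⟩ | ⟨e, _⟩
    · rw [e, Real.one_rpow] at hi
      exact absurd hi (lt_irrefl _)
    · rw [e]
  · intro h
    refine Summable.of_nonneg_of_le (fun i => ?_) (fun i => ?_) h
    · exact Real.rpow_nonneg (le_min (by norm_num) (hf i)) _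
    · exact Real.rpow_le_rpow (le_min (by norm_num) (hf i)) (min_le_right _ _) (hr i).le

lemma RR_iff (p ε : ℝ) (hp : 1 ≤ p) (hε : 0 < ε) (A : Set ℕ) (x y : ℕ → ℤ) :
    RR p ε A x y ↔ Summable (fun i => (|(x i : ℝ) - y i| / Kc A i) ^ rc p ε A i) := by
  rw [← summable_min _ _ (fun i => by positivity)
    (fun i => by have := rc_ge p ε hε A i; linarith)]
  rw [summable_iff_ne_top]
  · rfl
  · intro i
    exact DD_nonneg p ε A i _ _

lemma add_rpow_le (p a b : ℝ) (hp : 1 ≤ p) (ha : 0 ≤ a) (hb : 0 ≤ b) :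
    (a + b) ^ p ≤ 2 ^ (p - 1) * (a ^ p + b ^ p) := by
  have h3 := Real.rpow_sum_le_const_mul_sum_rpow_of_nonneg Finset.univ
    (f := ![a, b]) (p := p) hp
    (by intro j _; fin_cases j <;> simp [ha, hb])
  simpa [Fin.sum_univ_two] using h3

lemma summable_close (p : ℝ) (hp : 1 ≤ p) (a b c : ℕ → ℝ) (ha : ∀ i, 0 ≤ a i) (hb : ∀ i, 0 ≤ b i)
    (hc : ∀ i, 0 ≤ c i) (h : ∀ i, a i ≤ b i + c i) (hs : Summable fun i => c i ^ p)
    (hbs : Summable fun i => b i ^ p) : Summable fun i => a i ^ p := by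
  refine Summable.of_nonneg_of_le (fun i => Real.rpow_nonneg (ha i) _) (fun i => ?_)
    ((hbs.add hs).mul_left (2 ^ (p - 1)))
  exact (Real.rpow_le_rpow (ha i) (h i) (by linarith)).trans (add_rpow_le p _ _ hp (hb i) (hc i))

theorem lp_to_RR (p ε : ℝ) (hp : 1 ≤ p) (hε : 0 < ε) (A : Set ℕ) (h0 : 0 ∉ A) :
    ∃ θ : (ℕ → ℝ) → (ℕ → ℤ), Measurable θ ∧
      ∀ x y, (Summable fun n => |x n - y n| ^ p) ↔ RR p ε A (θ x) (θ y) := by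
  refine ⟨fun x i => if i.unpair.1 = 0 then ⌊(2 : ℝ) ^ i * x i.unpair.2⌋ else 0, ?_, ?_⟩
  · refine measurable_pi_lambda _ fun i => ?_
    split_ifs
    · exact Int.measurable_floor.comp (measurable_const.mul (measurable_pi_apply _))
    · exact measurable_const
  · intro x y
    rw [RR_iff p ε hp hε]
    have hinj : Function.Injective (fun l : ℕ => Nat.pair 0 l) := by
      intro a b hab
      simpa using hab
    have hsw := hinj.summable_iff (f := (fun i : ℕ => (|(((if i.unpair.1 = 0 then ⌊(2 : ℝ) ^ i * x i.unpair.2⌋ else 0 : ℤ)) : ℝ)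
        - ((if i.unpair.1 = 0 then ⌊(2 : ℝ) ^ i * y i.unpair.2⌋ else 0 : ℤ) : ℝ)| / Kc A i)
          ^ rc p ε A i)) ?_
    swap
    · intro i hi
      have : i.unpair.1 ≠ 0 := by
        intro h
        refine hi ⟨i.unpair.2, ?_⟩
        show Nat.pair 0 i.unpair.2 = i
        rw [← h, Nat.pair_unpair]
      have hr := rc_ge p ε hε A i
      simp only [this, if_false]
      simp [Real.zero_rpow (show rc p ε A i ≠ 0 by linarith)]
    have hfun : ((fun i : ℕ => (|(((if i.unpair.1 = 0 then ⌊(2 : ℝ) ^ i * x i.unpair.2⌋ else 0 : ℤ)) : ℝ)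
        - ((if i.unpair.1 = 0 then ⌊(2 : ℝ) ^ i * y i.unpair.2⌋ else 0 : ℤ) : ℝ)| / Kc A i)
          ^ rc p ε A i) ∘ fun l : ℕ => Nat.pair 0 l) =
        fun l => (|(⌊(2 : ℝ) ^ (Nat.pair 0 l) * x l⌋ : ℝ) - ⌊(2 : ℝ) ^ (Nat.pair 0 l) * y l⌋|
          / 2 ^ (Nat.pair 0 l)) ^ p := by
      funext l
      simp [Kc, rc, h0]
    rw [hfun] at hsw
    refine Iff.trans ?_ hsw
    have hcs : Summable fun l : ℕ => ((1 / 2 : ℝ) ^ l) ^ p := by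
      have : (fun l : ℕ => ((1 / 2 : ℝ) ^ l) ^ p) = fun l : ℕ => ((1 / 2 : ℝ) ^ p) ^ l := by
        funext l
        rw [← Real.rpow_natCast, ← Real.rpow_natCast, ← Real.rpow_mul (by norm_num),
          ← Real.rpow_mul (by norm_num), mul_comm]
      rw [this]
      refine summable_geometric_of_lt_one (by positivity) ?_
      exact Real.rpow_lt_one (by norm_num) (by norm_num) (by linarith)
    have hest : ∀ l, abs ((|(⌊(2 : ℝ) ^ (Nat.pair 0 l) * x l⌋ : ℝ) - ⌊(2 : ℝ) ^ (Nat.pair 0 l) * y l⌋|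
          / 2 ^ (Nat.pair 0 l)) - |x l - y l|) ≤ (1 / 2 : ℝ) ^ l := by
      intro l
      have hl : (2 : ℝ) ^ l ≤ 2 ^ Nat.pair 0 l :=
        pow_le_pow_right₀ (by norm_num) (Nat.right_le_pair 0 l)
      generalize (2 : ℝ) ^ Nat.pair 0 l = N at *
      have hN : 0 < N := lt_of_lt_of_le (by positivity) hl
      have e1 : |x l - y l| = |N * x l - N * y l| / N := by
        rw [← mul_sub, abs_mul, abs_of_pos hN]; field_simp
      rw [e1, ← sub_div, abs_div, abs_of_pos hN]
      have e2 : abs (|(⌊N * x l⌋ : ℝ) - ⌊N * y l⌋| - |N * x l - N * y l|) ≤ 1 := by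
        refine (abs_abs_sub_abs_le _ _).trans ?_
        have a1 := Int.floor_le (N * x l)
        have a2 := Int.lt_floor_add_one (N * x l)
        have a3 := Int.floor_le (N * y l)
        have a4 := Int.lt_floor_add_one (N * y l)
        rw [abs_le]; constructor <;> linarith
      rw [one_div, inv_pow, ← one_div]
      gcongr
    constructor
    · intro h
      refine summable_close p hp _ _ (fun l => (1 / 2 : ℝ) ^ l) (fun _ => by positivity)
        (fun _ => abs_nonneg _) (fun _ => by positivity) (fun l => ?_) hcs h
      have := (abs_le.1 (hest l)).2
      linarith
    · intro h
      refine summable_close p hp _ _ (fun l => (1 / 2 : ℝ) ^ l) (fun _ => abs_nonneg _)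
        (fun _ => by positivity) (fun _ => by positivity) (fun l => ?_) hcs h
      have := (abs_le.1 (hest l)).1
      linarith

/-! ### snowflake embedding into `ℓ_q` -/

noncomputable def wave (b : Bool) (u : ℝ) : ℝ := if b then Real.cos u else Real.sin u

lemma wave_lip (b : Bool) (u v : ℝ) : |wave b u - wave b v| ≤ 2 * min 1 |u - v| := by
  have h1 : |wave b u - wave b v| ≤ |u - v| := by
    cases b
    · simpa [wave, Real.dist_eq] using Real.abs_sin_sub_sin_le u v
    · simpa [wave, Real.dist_eq] using Real.abs_cos_sub_cos_le u v
  have h2 : |wave b u - wave b v| ≤ 2 := by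
    cases b
    · simp only [wave]
      have a1 := Real.sin_le_one u
      have a2 := Real.sin_le_one v
      have a3 := Real.neg_one_le_sin u
      have a4 := Real.neg_one_le_sin v
      rw [abs_le]; simp; constructor <;> linarith
    · simp only [wave]
      have a1 := Real.cos_le_one u
      have a2 := Real.cos_le_one v
      have a3 := Real.neg_one_le_cos u
      have a4 := Real.neg_one_le_cos v
      rw [abs_le]; simp; constructor <;> linarith
  have := abs_nonneg (u - v)
  rcases min_cases 1 |u - v| with ⟨e, _⟩ | ⟨e, _⟩ <;> rw [e] <;> linarith

lemma wave_lower (u v : ℝ) (h1 : 1 / 2 ≤ |u - v|) (h2 : |u - v| ≤ 1) :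
    ∃ b, 1 / 8 ≤ |wave b u - wave b v| := by
  by_contra hcon
  push Not at hcon
  have c1 := hcon true
  have c2 := hcon false
  simp only [wave, if_true, Bool.false_eq_true, if_false] at c1 c2
  have hpi := Real.pi_gt_three
  have hpi' := Real.pi_le_four
  have h3 := Real.cos_le_one_sub_mul_cos_sq (x := u - v) (by linarith)
  have h4 : (1 : ℝ) / 4 ≤ (u - v) ^ 2 := by
    rw [← sq_abs]; nlinarith
  have h5 : (2 : ℝ) / 16 ≤ 2 / Real.pi ^ 2 := by
    gcongr
    nlinarith
  have h6 : Real.cos (u - v) ≤ 1 - 1 / 32 := by nlinarith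
  rw [Real.cos_sub] at h6
  have s1 := sq_lt_sq' (abs_lt.1 c1).1 (abs_lt.1 c1).2
  have s2 := sq_lt_sq' (abs_lt.1 c2).1 (abs_lt.1 c2).2
  have := Real.sin_sq_add_cos_sq u
  have := Real.sin_sq_add_cos_sq v
  nlinarith

end S17

namespace S17
open Filter Topology ENNReal

noncomputable def WW (q r : ℝ) (s : ℝ) (m : ℤ × Bool) : ℝ :=
  2 ^ (-((m.1 : ℝ) * r / q)) * wave m.2 (2 ^ (m.1 : ℝ) * s)

lemma WW_pow (q r s t : ℝ) (hq : 0 < q) (m : ℤ × Bool) :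
    |WW q r s m - WW q r t m| ^ q = 2 ^ (-((m.1 : ℝ) * r)) *
      |wave m.2 (2 ^ (m.1 : ℝ) * s) - wave m.2 (2 ^ (m.1 : ℝ) * t)| ^ q := by
  unfold WW
  rw [← mul_sub, abs_mul, Real.mul_rpow (abs_nonneg _) (abs_nonneg _),
    abs_of_pos (by positivity), ← Real.rpow_mul (by norm_num)]
  congr 2
  field_simp

lemma exists_J (δ : ℝ) (hδ : 0 < δ) :
    ∃ J : ℤ, (2 : ℝ) ^ (J : ℝ) ≤ δ ∧ δ < 2 ^ ((J : ℝ) + 1) := by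
  obtain ⟨J, h1, h2⟩ := exists_mem_Ico_zpow hδ (show (1 : ℝ) < 2 by norm_num)
  refine ⟨J, ?_, ?_⟩
  · rw [Real.rpow_intCast]; exact h1
  · have : ((J : ℝ) + 1) = ((J + 1 : ℤ) : ℝ) := by push_cast; ring
    rw [this, Real.rpow_intCast]; exact h2

lemma geom_int (κ : ℝ) (hκ : 0 < κ) : Summable fun i : ℤ => (2 : ℝ) ^ (-(κ * |(i : ℝ)|)) := by
  have h : Summable fun n : ℕ => (2 : ℝ) ^ (-(κ * (n : ℝ))) := by
    have : (fun n : ℕ => (2 : ℝ) ^ (-(κ * (n : ℝ)))) = fun n : ℕ => ((2 : ℝ) ^ (-κ)) ^ n := by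
      funext n
      rw [← Real.rpow_natCast, ← Real.rpow_mul (by norm_num)]
      congr 1; ring
    rw [this]
    refine summable_geometric_of_lt_one (by positivity) ?_
    exact Real.rpow_lt_one_of_one_lt_of_neg (by norm_num) (by linarith)
  refine Summable.of_nat_of_neg ?_ ?_
  · simpa using h
  · simpa using h

lemma term_upper (q κ r δ : ℝ) (J i : ℤ) (hq : 0 < q) (hr : κ ≤ r) (hr0 : 0 ≤ r) (hrq : κ ≤ q - r)
    (h1 : (2 : ℝ) ^ (J : ℝ) ≤ δ) (h2 : δ < 2 ^ ((J : ℝ) + 1)) :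
    (2 : ℝ) ^ (-(((i - J : ℤ) : ℝ) * r)) * (2 * min 1 (2 ^ ((i - J : ℤ) : ℝ) * δ)) ^ q
      ≤ δ ^ r * (2 ^ (2 * q) * 2 ^ (-(κ * |(i : ℝ)|))) := by
  have hδ : 0 < δ := lt_of_lt_of_le (by positivity) h1
  have a1 : (2 : ℝ) ^ (-(((i - J : ℤ) : ℝ) * r)) ≤ δ ^ r * 2 ^ (-(i * r)) := by
    have : (2 : ℝ) ^ (-(((i - J : ℤ) : ℝ) * r)) = (2 ^ (J : ℝ)) ^ r * 2 ^ (-(i * r)) := by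
      rw [← Real.rpow_mul (by norm_num), ← Real.rpow_add (by norm_num)]
      congr 1; push_cast; ring
    rw [this]
    gcongr
  have a2 : (2 : ℝ) ^ ((i - J : ℤ) : ℝ) * δ ≤ 2 ^ ((i : ℝ) + 1) := by
    have : (2 : ℝ) ^ ((i : ℝ) + 1) = 2 ^ ((i - J : ℤ) : ℝ) * 2 ^ ((J : ℝ) + 1) := by
      rw [← Real.rpow_add (by norm_num)]
      congr 1; push_cast; ring
    rw [this]
    gcongr
  have hm0 : 0 ≤ min 1 ((2 : ℝ) ^ ((i - J : ℤ) : ℝ) * δ) := by positivity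
  have key : (2 : ℝ) ^ (-((i : ℝ) * r)) * (2 * min 1 (2 ^ ((i - J : ℤ) : ℝ) * δ)) ^ q ≤
      2 ^ (2 * q) * 2 ^ (-(κ * |(i : ℝ)|)) := by
    rcases le_total 0 i with hi | hi
    · have hi' : (0 : ℝ) ≤ i := by exact_mod_cast hi
      have : (2 * min 1 ((2 : ℝ) ^ ((i - J : ℤ) : ℝ) * δ)) ^ q ≤ 2 ^ q := by
        refine Real.rpow_le_rpow (by positivity) ?_ hq.le
        linarith [min_le_left 1 ((2 : ℝ) ^ ((i - J : ℤ) : ℝ) * δ)]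
      calc _ ≤ (2 : ℝ) ^ (-((i : ℝ) * r)) * 2 ^ q := by gcongr
        _ = 2 ^ (-((i : ℝ) * r) + q) := by rw [Real.rpow_add (by norm_num)]
        _ ≤ 2 ^ (2 * q + -(κ * |(i : ℝ)|)) := by
          apply Real.rpow_le_rpow_of_exponent_le (by norm_num)
          rw [abs_of_nonneg hi']
          nlinarith
        _ = _ := by rw [Real.rpow_add (by norm_num)]
    · have hi' : (i : ℝ) ≤ 0 := by exact_mod_cast hi
      have : (2 * min 1 ((2 : ℝ) ^ ((i - J : ℤ) : ℝ) * δ)) ^ q ≤ (2 ^ ((i : ℝ) + 2)) ^ q := by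
        refine Real.rpow_le_rpow (by positivity) ?_ hq.le
        have e : (2 : ℝ) ^ ((i : ℝ) + 2) = 2 * 2 ^ ((i : ℝ) + 1) := by
          rw [show (i : ℝ) + 2 = 1 + (i + 1) by ring, Real.rpow_add (by norm_num), Real.rpow_one]
        rw [e]
        linarith [min_le_right 1 ((2 : ℝ) ^ ((i - J : ℤ) : ℝ) * δ)]
      calc _ ≤ (2 : ℝ) ^ (-((i : ℝ) * r)) * (2 ^ ((i : ℝ) + 2)) ^ q := by gcongr
        _ = 2 ^ (-((i : ℝ) * r) + ((i : ℝ) + 2) * q) := by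
          rw [← Real.rpow_mul (by norm_num), ← Real.rpow_add (by norm_num)]
        _ ≤ 2 ^ (2 * q + -(κ * |(i : ℝ)|)) := by
          apply Real.rpow_le_rpow_of_exponent_le (by norm_num)
          rw [abs_of_nonpos hi']
          nlinarith
        _ = _ := by rw [Real.rpow_add (by norm_num)]
  calc _ ≤ (δ ^ r * 2 ^ (-((i : ℝ) * r))) * (2 * min 1 (2 ^ ((i - J : ℤ) : ℝ) * δ)) ^ q := by
        gcongr
    _ = δ ^ r * (2 ^ (-((i : ℝ) * r)) * (2 * min 1 (2 ^ ((i - J : ℤ) : ℝ) * δ)) ^ q) := by ring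
    _ ≤ _ := by gcongr

lemma snow_upper (p r1 q : ℝ) (hp : 1 ≤ p) (hq : r1 < q) (hpq : p ≤ r1) :
    ∃ C : ℝ≥0∞, C ≠ ⊤ ∧ ∀ r s t, p ≤ r → r ≤ r1 →
      ∑' m, ENNReal.ofReal (|WW q r s m - WW q r t m| ^ q) ≤ C * ENNReal.ofReal (|s - t| ^ r) := by
  set κ := min p (q - r1) with hκ
  have hκ0 : 0 < κ := lt_min (by linarith) (by linarith)
  have hq0 : 0 < q := by linarith
  refine ⟨∑' m : ℤ × Bool, ENNReal.ofReal (2 ^ (2 * q) * 2 ^ (-(κ * |(m.1 : ℝ)|))), ?_, ?_⟩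
  · rw [ENNReal.tsum_prod (f := fun (i : ℤ) (b : Bool) =>
      ENNReal.ofReal (2 ^ (2 * q) * 2 ^ (-(κ * |(i : ℝ)|))))]
    simp only [tsum_bool, ENNReal.tsum_add]
    have := (summable_iff_ne_top (fun i : ℤ => (2 : ℝ) ^ (2 * q) * 2 ^ (-(κ * |(i : ℝ)|)))
      (fun i => by positivity)).1 ((geom_int κ hκ0).mul_left _)
    exact ENNReal.add_ne_top.2 ⟨this, this⟩
  · intro r s t hpr hr1
    rcases eq_or_ne s t with rfl | hst
    · simp [Real.zero_rpow hq0.ne']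
    have hδ : 0 < |s - t| := abs_pos.2 (sub_ne_zero.2 hst)
    obtain ⟨J, h1, h2⟩ := exists_J _ hδ
    rw [← ENNReal.tsum_mul_right]
    rw [← (Equiv.prodCongr (Equiv.subRight J) (Equiv.refl Bool)).tsum_eq
      (fun m => ENNReal.ofReal (|WW q r s m - WW q r t m| ^ q))]
    refine ENNReal.tsum_le_tsum fun m => ?_
    rw [← ENNReal.ofReal_mul (by positivity)]
    refine ENNReal.ofReal_le_ofReal ?_
    rw [WW_pow _ _ _ _ hq0]
    have hu := term_upper q κ r _ J m.1 hq0 ((min_le_left _ _).trans hpr) (by linarith)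
      ((min_le_right _ _).trans (by linarith)) h1 h2
    rw [mul_comm (_ ^ r)] at hu
    refine le_trans ?_ hu
    simp only [Equiv.prodCongr_apply, Prod.map, Equiv.subRight_apply, Equiv.refl_apply]
    gcongr
    refine (wave_lip _ _ _).trans ?_
    rw [← mul_sub, abs_mul, abs_of_pos (by positivity : (0 : ℝ) < 2 ^ ((m.1 - J : ℤ) : ℝ))]

lemma snow_lower (q r s t : ℝ) (hq : 0 < q) (hr : 0 < r) :
      ENNReal.ofReal ((1 / 8) ^ q) * ENNReal.ofReal (|s - t| ^ r) ≤
      ∑' m, ENNReal.ofReal (|WW q r s m - WW q r t m| ^ q) := by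
  rcases eq_or_ne s t with rfl | hst
  · simp [Real.zero_rpow hr.ne']
  have hδ : 0 < |s - t| := abs_pos.2 (sub_ne_zero.2 hst)
  obtain ⟨J, h1, h2⟩ := exists_J _ hδ
  have hneg : (2 : ℝ) ^ (((-J - 1 : ℤ)) : ℝ) * 2 ^ ((J : ℝ) + 1) = 1 := by
    rw [← Real.rpow_add (by norm_num)]
    push_cast
    rw [show (-(J : ℝ) - 1 + (J + 1)) = 0 by ring, Real.rpow_zero]
  have hneg' : (2 : ℝ) ^ (((-J - 1 : ℤ)) : ℝ) * 2 ^ (J : ℝ) = 1 / 2 := by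
    rw [Real.rpow_add (by norm_num), Real.rpow_one] at hneg
    linarith
  have hpos : (0 : ℝ) < 2 ^ (((-J - 1 : ℤ)) : ℝ) := by positivity
  obtain ⟨b, hb⟩ := wave_lower (2 ^ (((-J - 1 : ℤ)) : ℝ) * s) (2 ^ (((-J - 1 : ℤ)) : ℝ) * t)
    (by rw [← mul_sub, abs_mul, abs_of_pos hpos, ← hneg']; gcongr)
    (by rw [← mul_sub, abs_mul, abs_of_pos hpos, ← hneg]; gcongr)
  refine le_trans ?_ (ENNReal.le_tsum ((-J - 1 : ℤ), b))
  rw [← ENNReal.ofReal_mul (by positivity)]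
  refine ENNReal.ofReal_le_ofReal ?_
  rw [WW_pow _ _ _ _ hq, mul_comm]
  have : |s - t| ^ r ≤ 2 ^ (-(((-J - 1 : ℤ) : ℝ) * r)) := by
    calc |s - t| ^ r ≤ (2 ^ ((J : ℝ) + 1)) ^ r := by gcongr
      _ = _ := by
        rw [← Real.rpow_mul (by norm_num)]; congr 1; push_cast; ring
  gcongr

theorem RR_to_lq (p ε q : ℝ) (hp : 1 ≤ p) (hε : 0 < ε) (hq : p + ε < q) (A : Set ℕ) :
    ∃ θ : (ℕ → ℤ) → (ℕ → ℝ), Measurable θ ∧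
      ∀ x y, RR p ε A x y ↔ (Summable fun n => |θ x n - θ y n| ^ q) := by
  obtain ⟨C, hC, hup⟩ := snow_upper p (p + ε) q hp hq (by linarith)
  have hq0 : 0 < q := by linarith
  let e : ℕ ≃ ℕ × (ℤ × Bool) := (nonempty_equiv_of_countable (α := ℕ) (β := ℕ × (ℤ × Bool))).some
  refine ⟨fun x n => WW q (rc p ε A (e n).1) ((x (e n).1 : ℝ) / Kc A (e n).1) (e n).2, ?_, ?_⟩
  · refine measurable_pi_lambda _ fun n => ?_
    exact (measurable_of_countable (fun z : ℤ =>
      WW q (rc p ε A (e n).1) ((z : ℝ) / Kc A (e n).1) (e n).2)).comp (measurable_pi_apply (e n).1)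
  · intro x y
    rw [RR_iff p ε hp hε, summable_iff_ne_top _ (fun i => by positivity),
      summable_iff_ne_top _ (fun i => by positivity)]
    have hre := e.tsum_eq (fun m : ℕ × (ℤ × Bool) => ENNReal.ofReal
      (|WW q (rc p ε A m.1) ((x m.1 : ℝ) / Kc A m.1) m.2 -
        WW q (rc p ε A m.1) ((y m.1 : ℝ) / Kc A m.1) m.2| ^ q))
    rw [ENNReal.tsum_prod (f := fun (i : ℕ) (m : ℤ × Bool) => ENNReal.ofReal
      (|WW q (rc p ε A i) ((x i : ℝ) / Kc A i) m -
        WW q (rc p ε A i) ((y i : ℝ) / Kc A i) m| ^ q))] at hre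
    rw [hre]
    have hd : ∀ i, |(x i : ℝ) - y i| / Kc A i = |(x i : ℝ) / Kc A i - (y i : ℝ) / Kc A i| := by
      intro i
      rw [← sub_div, abs_div, abs_of_nonneg (by positivity : (0 : ℝ) ≤ Kc A i)]
    simp only [hd]
    constructor
    · intro h
      refine ne_top_of_le_ne_top (ENNReal.mul_ne_top hC h) ?_
      rw [← ENNReal.tsum_mul_left]
      exact ENNReal.tsum_le_tsum fun i => hup _ _ _ (rc_ge p ε hε A i) (rc_le p ε hε A i)
    · intro h htop
      apply h
      have hle : ENNReal.ofReal ((1 / 8) ^ q) * ∑' i, ENNReal.ofReal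
          (|(x i : ℝ) / Kc A i - (y i : ℝ) / Kc A i| ^ rc p ε A i) ≤
          ∑' (i : ℕ) (m : ℤ × Bool), ENNReal.ofReal
            (|WW q (rc p ε A i) ((x i : ℝ) / Kc A i) m -
              WW q (rc p ε A i) ((y i : ℝ) / Kc A i) m| ^ q) := by
        rw [← ENNReal.tsum_mul_left]
        exact ENNReal.tsum_le_tsum fun i => snow_lower q (rc p ε A i) _ _ hq0
          (by have := rc_ge p ε hε A i; linarith)
      rw [htop, ENNReal.mul_top (by simp; positivity)] at hle
      exact top_le_iff.1 hle

def AA (ξ : ℕ → Bool) : Set ℕ :=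
  range fun n => Encodable.encode ((List.range n).map ξ) + 1

lemma AA_zero (ξ : ℕ → Bool) : 0 ∉ AA ξ := by
  rintro ⟨n, hn⟩
  simp at hn

lemma AA_diff (ξ ζ : ℕ → Bool) (h : ξ ≠ ζ) : (AA ξ \ AA ζ).Infinite := by
  obtain ⟨k, hk⟩ := Function.ne_iff.1 h
  refine Set.infinite_of_injective_forall_mem
    (f := fun n : ℕ => Encodable.encode ((List.range (n + k + 1)).map ξ) + 1) ?_ ?_
  · intro a b hab
    have := Encodable.encode_injective (Nat.succ_injective hab)
    have := congrArg List.length this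
    simp at this
    omega
  · intro n
    refine ⟨⟨_, rfl⟩, ?_⟩
    rintro ⟨m, hm⟩
    have h1 := Encodable.encode_injective (Nat.succ_injective hm)
    have h2 := congrArg List.length h1
    simp at h2
    subst h2
    rw [List.map_inj_left] at h1
    exact hk (h1 k (by simp)).symm

lemma cantor_unc : ¬ Countable (ℕ → Bool) := by
  intro h
  have h1 := Cardinal.mk_le_aleph0_iff.2 h
  have h2 : Cardinal.mk (ℕ → Bool) = Cardinal.continuum := by clear h1 h; simp
  rw [h2] at h1
  exact absurd h1 (not_le.2 Cardinal.aleph0_lt_continuum)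

lemma exists_iso : Nonempty ((ℕ → Icc (0:ℝ) 1) ≃ᵐ (ℕ → ℤ)) := by
  refine ⟨PolishSpace.measurableEquivOfNotCountable ?_ ?_⟩
  · intro hc
    have : Function.Injective (fun (f : ℕ → Bool) (n : ℕ) =>
        (if f n then 1 else 0 : Icc (0:ℝ) 1)) := by
      intro f g hfg
      funext n
      have := congrFun hfg n
      cases hf : f n <;> cases hg : g n <;> simp_all
    exact cantor_unc this.countable
  · intro hc
    have : Function.Injective (fun (f : ℕ → Bool) (n : ℕ) => (if f n then 1 else 0 : ℤ)) := by
      intro f g hfg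
      funext n
      have := congrFun hfg n
      cases hf : f n <;> cases hg : g n <;> simp_all
    exact cantor_unc this.countable

end S17

lemma S17.meas_comap {X Y : Type*} [MeasurableSpace X] [MeasurableSpace Y] (R : Y → Y → Prop)
    (hR : MeasurableSet {z : Y × Y | R z.1 z.2}) (f : X → Y) (hf : Measurable f) :
    MeasurableSet {z : X × X | R (f z.1) (f z.2)} := by
  have hg : Measurable (fun z : X × X => (f z.1, f z.2)) :=
    (hf.comp measurable_fst).prodMk (hf.comp measurable_snd)
  exact hg hR

lemma S17.nonred' (p ε : ℝ) (hp : 1 ≤ p) (hε : 0 < ε) (e : (ℕ → Icc (0:ℝ) 1) ≃ᵐ (ℕ → ℤ))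
    (ξ ζ : ℕ → Bool) (h : ξ ≠ ζ) :
    ¬ BorelReducible (fun x y => S17.RR p ε (S17.AA ξ) (e x) (e y))
      (fun x y => S17.RR p ε (S17.AA ζ) (e x) (e y)) := by
  rintro ⟨θ, hθ, hred⟩
  refine S17.nonred p ε hp hε _ _ (S17.AA_zero ξ) (S17.AA_diff ξ ζ h)
    (fun z => e (θ (e.symm z))) (e.measurable.comp (hθ.comp e.symm.measurable)) ?_
  intro x y
  have := hred (e.symm x) (e.symm y)
  simpa using this

theorem stmt17 : ∀ p q : ℝ, 1 ≤ p → p < q →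
    ∃ E : (ℕ → Bool) → ((ℕ → Icc (0:ℝ) 1) → (ℕ → Icc (0:ℝ) 1) → Prop),
      (∀ ξ, Equivalence (E ξ) ∧
        MeasurableSet {z : (ℕ → Icc (0:ℝ) 1) × (ℕ → Icc (0:ℝ) 1) | E ξ z.1 z.2}) ∧
      (∀ ξ, BorelReducible (lpRel p) (E ξ) ∧ BorelReducible (E ξ) (lpRel q)) ∧
      (∀ ξ ζ, ξ ≠ ζ →
        ¬ BorelReducible (E ξ) (E ζ) ∧ ¬ BorelReducible (E ζ) (E ξ)) := by
  intro p q hp hpq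
  obtain ⟨e⟩ := S17.exists_iso
  obtain ⟨ε, hε, hq⟩ : ∃ ε : ℝ, 0 < ε ∧ p + ε < q := ⟨(q - p) / 2, by linarith, by linarith⟩
  refine ⟨fun ξ x y => S17.RR p ε (S17.AA ξ) (e x) (e y), fun ξ => ⟨?_, ?_⟩, fun ξ => ⟨?_, ?_⟩,
    fun ξ ζ h => ⟨S17.nonred' p ε hp hε e ξ ζ h, S17.nonred' p ε hp hε e ζ ξ h.symm⟩⟩
  · have hE := S17.RR_equiv p ε hp hε (S17.AA ξ)
    exact ⟨fun x => hE.refl _, fun h => hE.symm h, fun h h' => hE.trans h h'⟩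
  · exact S17.meas_comap _ (S17.RR_meas p ε (S17.AA ξ)) e e.measurable
  · obtain ⟨θ, hθ, h⟩ := S17.lp_to_RR p ε hp hε (S17.AA ξ) (S17.AA_zero ξ)
    refine ⟨fun x => e.symm (θ x), e.symm.measurable.comp hθ, fun x y => ?_⟩
    simpa [lpRel] using h x y
  · obtain ⟨θ, hθ, h⟩ := S17.RR_to_lq p ε q hp hε hq (S17.AA ξ)
    exact ⟨fun x => θ (e x), hθ.comp e.measurable, fun x y => h (e x) (e y)⟩
end
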